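/- Let Γ ≤ Sym(Ω) be a permutation group on a finite set Ω of size n and let φ : Γ → S_k be a giant representation with k > max{8, 2 + log₂ n}. Let D ⊆ Ω be the set of points not affected by φ, and let Γ_(D) be the pointwise stabilizer of D in Γ. Then the image of Γ_(D) under φ contains the alternating group A_k. In particular, D ≠ Ω, i.e., at least one point of Ω is affected by φ. -/

import Mathlib

/-- `φ : Γ → S_k` is a giant representation: its image contains the alternating group `A_k`. -/
def IsGiantRep {Ω : Type*} (Γ : Subgroup (Equiv.Perm Ω)) {k : ℕ}
    (φ : ↥Γ →* Equiv.Perm (Fin k)) : Prop :=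
  alternatingGroup (Fin k) ≤ φ.range

/-- A point `α ∈ Ω` is affected by `φ` if the image of its stabilizer under `φ`
does not contain `A_k`. -/
def AffectedBy {Ω : Type*} (Γ : Subgroup (Equiv.Perm Ω)) {k : ℕ}
    (φ : ↥Γ →* Equiv.Perm (Fin k)) (α : Ω) : Prop :=
  ¬ alternatingGroup (Fin k) ≤ (MulAction.stabilizer ↥Γ α).map φ

/-- The pointwise stabilizer `Γ_(A)` of a set `A ⊆ Ω` in `Γ`. -/
def PointwiseStabilizer {Ω : Type*} (Γ : Subgroup (Equiv.Perm Ω)) (A : Set Ω) :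
    Subgroup ↥Γ :=
  ⨅ α ∈ A, MulAction.stabilizer ↥Γ α

set_option linter.unusedSectionVars false

section

open Subgroup
open scoped commutatorElement

/-- `H` is full for `φ : G →* S` when it is mapped onto `S`. -/
def IsFull {G S : Type*} [Group G] [Group S] (φ : G →* S) (H : Subgroup G) : Prop :=
  ∀ s, ∃ h ∈ H, φ h = s

namespace IsFull

variable {G S : Type*} [Group G] [Group S] {φ : G →* S}

lemma mono {H L : Subgroup G} (hH : IsFull φ H) (h : H ≤ L) : IsFull φ L := fun s =>
  let ⟨x, hx, e⟩ := hH s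
  ⟨x, h hx, e⟩

lemma top (h : Function.Surjective φ) : IsFull φ ⊤ := fun s =>
  let ⟨x, e⟩ := h s
  ⟨x, mem_top _, e⟩

lemma map_eq_top {H : Subgroup G} : IsFull φ H ↔ H.map φ = ⊤ := by
  rw [eq_top_iff]
  exact ⟨fun h s _ => h s, fun h s => h (mem_top s)⟩

lemma surjective_restrict {H : Subgroup G} (hH : IsFull φ H) :
    Function.Surjective (φ.comp H.subtype) := fun s =>
  let ⟨x, hx, e⟩ := hH s
  ⟨⟨x, hx⟩, e⟩

lemma of_commutator [Group.IsPerfect S] {A B M : Subgroup G} (hA : IsFull φ A)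
    (hB : IsFull φ B) (h : ∀ a ∈ A, ∀ b ∈ B, a * b * a⁻¹ * b⁻¹ ∈ M) : IsFull φ M := by
  have hM : ⁅A, B⁆ ≤ M := commutator_le.2 fun a ha b hb => h a ha b hb
  refine mono ?_ hM
  rw [map_eq_top] at *
  rw [map_commutator, hA, hB]
  exact Group.IsPerfect.commutator_eq_top

lemma commutator [Group.IsPerfect S] {A B : Subgroup G} (hA : IsFull φ A)
    (hB : IsFull φ B) : IsFull φ ⁅A, B⁆ :=
  of_commutator hA hB fun _ ha _ hb => commutator_mem_commutator ha hb

lemma inf [Group.IsPerfect S] {A B : Subgroup G} (hA : IsFull φ A) (hB : IsFull φ B)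
    (hAB : ∀ a ∈ A, ∀ b ∈ B, a * b * a⁻¹ ∈ B) (hBA : ∀ b ∈ B, ∀ a ∈ A, b * a * b⁻¹ ∈ A) :
    IsFull φ (A ⊓ B) := by
  refine of_commutator hA hB fun a ha b hb => ⟨?_, B.mul_mem (hAB a ha b hb) (B.inv_mem hb)⟩
  have := A.mul_mem ha (hBA b hb _ (A.inv_mem ha))
  simpa [mul_assoc] using this

lemma iInf [Group.IsPerfect S] {ι : Type*} [Finite ι] {B : Subgroup G} (hB : IsFull φ B)
    {F : ι → Subgroup G} (hF : ∀ i, IsFull φ (F i)) (hle : ∀ i, F i ≤ B)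
    (hn : ∀ i, ∀ b ∈ B, ∀ x ∈ F i, b * x * b⁻¹ ∈ F i) : IsFull φ (⨅ i, F i) := by
  classical
  have := Fintype.ofFinite ι
  have key : ∀ s : Finset ι, IsFull φ (B ⊓ ⨅ i ∈ s, F i) := by
    intro s
    induction s using Finset.induction_on with
    | empty => simpa using hB
    | insert i s _ ih =>
      have h2 : IsFull φ ((B ⊓ ⨅ i ∈ s, F i) ⊓ F i) := by
        refine inf ih (hF i) (fun a ha b hb => hn i a ha.1 b hb) fun b hb a ha => ⟨?_, ?_⟩
        · exact B.mul_mem (B.mul_mem (hle i hb) ha.1) (B.inv_mem (hle i hb))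
        · have h3 : a ∈ ⨅ i ∈ s, F i := ha.2
          show b * a * b⁻¹ ∈ ⨅ i ∈ s, F i
          simp only [Subgroup.mem_iInf] at h3 ⊢
          exact fun j hj => hn j b (hle i hb) a (h3 j hj)
      refine mono h2 ?_
      rw [Finset.iInf_insert]
      exact le_inf (inf_le_left.trans inf_le_left)
        (le_inf inf_le_right (inf_le_left.trans inf_le_right))
  refine mono (key Finset.univ) ?_
  simpa using fun i => inf_le_right.trans (iInf_le F i)

lemma ker_of_normal [IsSimpleGroup S] (hφ : Function.Surjective φ) {N : Subgroup G}
    (hN : N.Normal) (h : ¬ IsFull φ N) : N ≤ φ.ker := by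
  have h1 : (N.map φ).Normal := hN.map φ hφ
  rcases IsSimpleGroup.eq_bot_or_eq_top_of_normal _ h1 with h2 | h2
  · intro x hx
    have : φ x ∈ N.map φ := mem_map_of_mem φ hx
    rw [h2] at this
    simpa [MonoidHom.mem_ker] using this
  · exact absurd (map_eq_top.2 h2) h

/-- A subgroup containing a conjugate of a full subgroup is full. -/
lemma conj {H L : Subgroup G} (hH : IsFull φ H) (g : G)
    (h : ∀ x ∈ H, g * x * g⁻¹ ∈ L) : IsFull φ L := by
  intro s
  obtain ⟨x, hx, e⟩ := hH ((φ g)⁻¹ * s * φ g)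
  exact ⟨_, h x hx, by simp [e, mul_assoc]⟩

end IsFull

open scoped Pointwise in
lemma Sylow.exists_conj_of_card {L : Type*} [Group L] [Finite L] {p : ℕ} [Fact p.Prime]
    {P Q : Subgroup L} (hP : Nat.card P = p ^ (Nat.card L).factorization p)
    (hQ : Nat.card Q = p ^ (Nat.card L).factorization p) :
    ∃ g : L, ∀ x, x ∈ P ↔ g * x * g⁻¹ ∈ Q := by
  obtain ⟨g, hg⟩ := MulAction.exists_smul_eq L (Sylow.ofCard Q hQ) (Sylow.ofCard P hP)
  refine ⟨g⁻¹, fun x => ?_⟩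
  have h1 : (Sylow.ofCard P hP : Subgroup L) = MulAut.conj g • Q := by
    rw [← hg]; rfl
  have h2 : x ∈ P ↔ x ∈ MulAut.conj g • Q := by rw [← h1]; rfl
  rw [h2, Subgroup.mem_pointwise_smul_iff_inv_smul_mem]
  simp [MulAut.smul_def]

lemma Subgroup.exists_conj_of_card {G : Type*} [Group G] [Finite G] {p : ℕ} [Fact p.Prime]
    {L P Q : Subgroup G} (hPL : P ≤ L) (hQL : Q ≤ L)
    (hP : Nat.card P = p ^ (Nat.card L).factorization p)
    (hQ : Nat.card Q = p ^ (Nat.card L).factorization p) :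
    ∃ g ∈ L, ∀ x, x ∈ P ↔ g * x * g⁻¹ ∈ Q := by
  obtain ⟨g, hg⟩ := Sylow.exists_conj_of_card (p := p) (L := L) (P := P.subgroupOf L)
    (Q := Q.subgroupOf L)
    (by rw [← hP]; exact Nat.card_congr (subgroupOfEquivOfLe hPL).toEquiv)
    (by rw [← hQ]; exact Nat.card_congr (subgroupOfEquivOfLe hQL).toEquiv)
  refine ⟨g, g.2, fun x => ⟨fun hx => ?_, fun hx => ?_⟩⟩
  · exact mem_subgroupOf.1 ((hg ⟨x, hPL hx⟩).1 (mem_subgroupOf.2 hx))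
  · have hxL : x ∈ L := by
      have := L.mul_mem (L.mul_mem (L.inv_mem g.2) (hQL hx)) g.2
      simpa [mul_assoc] using this
    exact mem_subgroupOf.1 ((hg ⟨x, hxL⟩).2 (mem_subgroupOf.2 hx))

/-- Existence of Sylow subgroups of a subgroup `L`, containing a given `p`-subgroup. -/
lemma Subgroup.exists_sylow_ge {G : Type*} [Group G] [Finite G] {p : ℕ} [Fact p.Prime]
    {L P : Subgroup G} (hPL : P ≤ L) (hP : IsPGroup p P) :
    ∃ Q, P ≤ Q ∧ Q ≤ L ∧ Nat.card Q = p ^ (Nat.card L).factorization p := by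
  obtain ⟨Q, hQ⟩ := (hP.comap_of_injective L.subtype L.subtype_injective).exists_le_sylow
  refine ⟨Q.map L.subtype, ?_, map_subtype_le _, ?_⟩
  · intro x hx
    exact ⟨⟨x, hPL hx⟩, hQ (mem_subgroupOf.2 hx), rfl⟩
  · rw [← Q.card_eq_multiplicity]
    exact Nat.card_congr (Q.equivMapOfInjective _ L.subtype_injective).symm.toEquiv

lemma Subgroup.exists_sylow {G : Type*} [Group G] [Finite G] (p : ℕ) [Fact p.Prime]
    (L : Subgroup G) :
    ∃ Q, Q ≤ L ∧ Nat.card Q = p ^ (Nat.card L).factorization p := by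
  obtain ⟨Q, -, h⟩ := exists_sylow_ge (p := p) (bot_le : ⊥ ≤ L) IsPGroup.of_bot
  exact ⟨Q, h⟩

lemma Subgroup.isPGroup_of_card {G : Type*} [Group G] {p a : ℕ} {Q : Subgroup G}
    (h : Nat.card Q = p ^ a) : IsPGroup p Q := IsPGroup.of_card h

lemma Subgroup.mem_normalizer_of_forall {G : Type*} [Group G] [Finite G] {Q : Subgroup G} {g : G}
    (h : ∀ x ∈ Q, g * x * g⁻¹ ∈ Q) : g ∈ normalizer (Q : Set G) := by
  rw [mem_normalizer_iff_map_conj_eq]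
  refine eq_of_le_of_card_ge ?_ ?_
  · rintro _ ⟨x, hx, rfl⟩
    exact h x hx
  · exact (Nat.card_congr (Q.equivMapOfInjective _ (MulAut.conj g).injective).toEquiv).le

lemma Subgroup.conj_mem_of_mem_normalizer {G : Type*} [Group G] {Q : Subgroup G} {g x : G}
    (h : g ∈ normalizer (Q : Set G)) (hx : x ∈ Q) : g * x * g⁻¹ ∈ Q :=
  (mem_normalizer_iff.1 h x).1 hx

/-- Frattini argument. -/
lemma IsFull.normalizer {G S : Type*} [Group G] [Group S] {φ : G →* S} [Finite G]
    {p : ℕ} [Fact p.Prime] {H Q : Subgroup G} (hH : IsFull φ H) (hQ : Q ≤ H ⊓ φ.ker)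
    (hc : Nat.card Q = p ^ (Nat.card ↥(H ⊓ φ.ker)).factorization p) :
    IsFull φ (normalizer (Q : Set G) ⊓ H) := by
  intro s
  obtain ⟨h, hh, rfl⟩ := hH s
  have h1 : Q.map (MulAut.conj h).toMonoidHom ≤ H ⊓ φ.ker := by
    rintro _ ⟨x, hx, rfl⟩
    refine ⟨H.mul_mem (H.mul_mem hh (hQ hx).1) (H.inv_mem hh), ?_⟩
    exact (MonoidHom.normal_ker φ).conj_mem _ (hQ hx).2 _
  obtain ⟨g, hg, h2⟩ := exists_conj_of_card h1 hQ ((Nat.card_congr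
    (Q.equivMapOfInjective _ (MulAut.conj h).injective).toEquiv).symm.trans hc) hc
  refine ⟨g * h, ⟨mem_normalizer_of_forall fun x hx => ?_, H.mul_mem hg.1 hh⟩, ?_⟩
  · simpa [mul_assoc] using (h2 _).1 (mem_map_of_mem _ hx)
  · rw [map_mul, show φ g = 1 from hg.2, one_mul]

lemma Subgroup.pow_dvd_card_normalizer_inf {G : Type*} [Group G] [Finite G] {p a : ℕ}
    [Fact p.Prime] {K Q : Subgroup G} (hQK : Q ≤ K) (hQ : Nat.card Q = p ^ a)
    (hd : p ^ (a + 1) ∣ Nat.card K) :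
    p ^ (a + 1) ∣ Nat.card ↥(normalizer (Q : Set G) ⊓ K) := by
  have h1 : Nat.card (Q.subgroupOf K) = p ^ a := by
    rw [← hQ]; exact Nat.card_congr (subgroupOfEquivOfLe hQK).toEquiv
  have h2 := Sylow.prime_pow_dvd_card_normalizer hd h1
  rw [← subgroupOf_normalizer_eq hQK] at h2
  have h3 : Nat.card ↥((normalizer (Q : Set G)).subgroupOf K)
      = Nat.card ↥(normalizer (Q : Set G) ⊓ K) := by
    rw [← subgroupOf_map_subtype]
    exact Nat.card_congr (equivMapOfInjective _ _ K.subtype_injective).toEquiv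
  rwa [h3] at h2

/-- `φ` restricted to point stabilizers is onto, but not restricted to the kernel of the action;
moreover this is a minimal such situation. -/
structure MinCx {G S : Type} [Group G] [Group S] (X : Type) [MulAction G X] (φ : G →* S) :
    Prop where
  surj : Function.Surjective φ
  stab : ∀ x : X, IsFull φ (MulAction.stabilizer G x)
  notFull : ¬ IsFull φ (MulAction.toPermHom G X).ker
  min : ∀ (G' : Type) [Group G'] [Finite G'] (X' : Type) [Finite X'] [MulAction G' X']
    (φ' : G' →* S), Function.Surjective φ' →
    (Nat.card X' < Nat.card X ∨ Nat.card X' ≤ Nat.card X ∧ Nat.card G' < Nat.card G) →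
    (∀ x : X', IsFull φ' (MulAction.stabilizer G' x)) →
    IsFull φ' (MulAction.toPermHom G' X').ker

lemma MulAction.conj_mem_stabilizer {G X : Type*} [Group G] [MulAction G X] (g : G) {k : G} {x : X}
    (hk : k ∈ MulAction.stabilizer G x) : g * k * g⁻¹ ∈ MulAction.stabilizer G (g • x) := by
  rw [MulAction.mem_stabilizer_iff] at hk ⊢
  rw [mul_smul, mul_smul, inv_smul_smul, hk]

namespace MinCx

variable {G S X : Type} [Group G] [Group S] [MulAction G X] {φ : G →* S}

lemma not_fix_all (h : MinCx X φ) {H : Subgroup G} (hH : IsFull φ H) :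
    ¬ ∀ g ∈ H, ∀ x : X, g • x = x := fun hf =>
  h.notFull (hH.mono fun g hg => by
    rw [MonoidHom.mem_ker]
    ext x
    exact hf g hg x)

lemma eq_one [Finite G] [Finite X] [IsSimpleGroup S] (h : MinCx X φ) {g : G}
    (hg : ∀ x : X, g • x = x) : g = 1 := by
  by_contra hne
  set f := MulAction.toPermHom G X
  have hN : f.ker ≤ φ.ker := IsFull.ker_of_normal h.surj f.normal_ker h.notFull
  let φ' : f.range →* S := f.rangeRestrict.liftOfSurjective f.rangeRestrict_surjective
    ⟨φ, by rw [MonoidHom.ker_rangeRestrict]; exact hN⟩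
  have hφ' : ∀ g, φ' (f.rangeRestrict g) = φ g := fun g =>
    f.rangeRestrict.liftOfRightInverse_comp_apply _ _ _ g
  have hsurj : Function.Surjective φ' := fun s => by
    obtain ⟨g, rfl⟩ := h.surj s
    exact ⟨_, hφ' g⟩
  have hcard : Nat.card f.range < Nat.card G := by
    refine Nat.lt_of_le_of_ne (Nat.card_le_card_of_surjective _ f.rangeRestrict_surjective) ?_
    intro he
    have hb := (Nat.bijective_iff_surjective_and_card f.rangeRestrict).2
      ⟨f.rangeRestrict_surjective, he.symm⟩
    refine hne (hb.1 ?_)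
    rw [map_one]
    ext x
    exact hg x
  have := h.min f.range X φ' hsurj (Or.inr ⟨le_rfl, hcard⟩) fun x s => by
    obtain ⟨k, hk, rfl⟩ := h.stab x s
    exact ⟨f.rangeRestrict k, hk, hφ' k⟩
  refine h.notFull fun s => ?_
  obtain ⟨⟨_, k, rfl⟩, hk, hs⟩ := this s
  refine ⟨k, ?_, (hφ' k).symm.trans hs⟩
  rw [MonoidHom.mem_ker] at hk ⊢
  ext x
  exact congrArg (fun e : Equiv.Perm X => e x) hk

lemma exists_fix [Finite G] [Finite X] (h : MinCx X φ) {H : Subgroup G} (hH : IsFull φ H)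
    {D : Set X} (hD : ∀ g ∈ H, ∀ x ∈ D, g • x ∈ D)
    (hs : ∀ x ∈ D, IsFull φ (H ⊓ MulAction.stabilizer G x))
    (hlt : D ≠ Set.univ ∨ H ≠ ⊤) :
    ∃ F ≤ H, IsFull φ F ∧ ∀ g ∈ F, ∀ x ∈ D, g • x = x := by
  let A : SubMulAction H X := { carrier := D, smul_mem' := fun c x hx => hD c c.2 x hx }
  have hle : Nat.card A ≤ Nat.card X := Nat.card_le_card_of_injective _ Subtype.val_injective
  have := h.min H A (φ.comp H.subtype) hH.surjective_restrict (by
    rcases hlt with hlt | hlt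
    · left
      refine lt_of_le_of_ne hle fun he => hlt ?_
      have hb := (Nat.bijective_iff_injective_and_card (Subtype.val : A → X)).2
        ⟨Subtype.val_injective, he⟩
      refine Set.eq_univ_of_forall fun x => ?_
      obtain ⟨a, rfl⟩ := hb.2 x
      exact a.2
    · right
      refine ⟨hle, lt_of_le_of_ne (card_le_card_group H) fun he => hlt ?_⟩
      exact eq_top_of_card_eq H he) fun x s => by
    obtain ⟨g, hg, e⟩ := hs x x.2 s
    exact ⟨⟨g, hg.1⟩, Subtype.ext hg.2, e⟩
  refine ⟨_, map_subtype_le (MulAction.toPermHom H A).ker, fun s => ?_, ?_⟩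
  · obtain ⟨g, hg, e⟩ := this s
    exact ⟨g, mem_map_of_mem _ hg, e⟩
  · rintro _ ⟨g, hg, rfl⟩ x hx
    have h1 := congrArg (fun e : Equiv.Perm A => (e ⟨x, hx⟩ : X)) (MonoidHom.mem_ker.1 hg)
    exact h1

lemma exists_smul_eq [Finite G] [Finite X] [Group.IsPerfect S] (h : MinCx X φ) (x y : X) :
    ∃ g : G, g • x = y := by
  by_contra hne
  have hno : ∀ z : X, MulAction.orbit G z ≠ Set.univ := by
    intro z hz
    have hx : x ∈ MulAction.orbit G z := hz ▸ Set.mem_univ x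
    have hy : y ∈ MulAction.orbit G z := hz ▸ Set.mem_univ y
    rw [MulAction.mem_orbit_iff] at hx hy
    obtain ⟨a, rfl⟩ := hx
    obtain ⟨b, rfl⟩ := hy
    exact hne ⟨b * a⁻¹, by simp [mul_smul]⟩
  have hF : ∀ z : X, IsFull φ (fixingSubgroup G (MulAction.orbit G z)) := by
    intro z
    obtain ⟨F, -, hF, hfix⟩ := h.exists_fix (IsFull.top h.surj) (D := MulAction.orbit G z)
      (fun g _ x hx => by
        obtain ⟨c, rfl⟩ := hx
        exact ⟨g * c, by simp [mul_smul]⟩)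
      (fun x _ => by simpa using h.stab x) (Or.inl (hno z))
    exact hF.mono fun g hg => (mem_fixingSubgroup_iff G).2 fun y hy => hfix g hg y hy
  refine h.not_fix_all (IsFull.iInf (IsFull.top h.surj) hF (fun _ => le_top) ?_) ?_
  · intro z b _ g hg
    rw [mem_fixingSubgroup_iff] at hg ⊢
    intro y hy
    rw [mul_smul, mul_smul, hg, smul_inv_smul]
    obtain ⟨c, rfl⟩ := hy
    exact ⟨b⁻¹ * c, by simp [mul_smul]⟩
  · intro g hg z
    rw [Subgroup.mem_iInf] at hg
    exact (mem_fixingSubgroup_iff G).1 (hg z) z (MulAction.mem_orbit_self z)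

lemma exists_ker_smul_eq [Finite G] [Finite X] [Group.IsPerfect S] (h : MinCx X φ) (x y : X) :
    ∃ g ∈ φ.ker, g • x = y := by
  obtain ⟨g, rfl⟩ := h.exists_smul_eq x y
  obtain ⟨k, hk, e⟩ := h.stab x (φ g)
  refine ⟨g * k⁻¹, by simp [MonoidHom.mem_ker, e], ?_⟩
  rw [mul_smul, inv_smul_eq_iff.2 (show k • x = x from hk).symm]

lemma stabilizer_ne_top [Finite G] [Finite X] [Group.IsPerfect S] (h : MinCx X φ) (x : X) :
    MulAction.stabilizer G x ≠ ⊤ := by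
  intro ht
  refine h.not_fix_all (IsFull.top h.surj) fun g _ y => ?_
  obtain ⟨k, rfl⟩ := h.exists_smul_eq x y
  have h1 : ∀ g : G, g • x = x := fun g => by
    have : g ∈ MulAction.stabilizer G x := ht ▸ mem_top g
    exact this
  rw [h1 k, h1 g]

lemma two_point [Finite G] [Finite X] [Group.IsPerfect S] (h : MinCx X φ) {x y : X}
    (hxy : IsFull φ (MulAction.stabilizer G x ⊓ MulAction.stabilizer G y)) : x = y := by
  by_contra hne
  let R : Setoid X :=
    { r := fun x y => IsFull φ (MulAction.stabilizer G x ⊓ MulAction.stabilizer G y)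
      iseqv :=
        { refl := fun x => by rw [inf_idem]; exact h.stab x
          symm := fun h => by rw [inf_comm]; exact h
          trans := by
            intro a b c hab hbc
            obtain ⟨F, -, hF, hfix⟩ := h.exists_fix (h.stab b)
              (D := {x | IsFull φ (MulAction.stabilizer G b ⊓ MulAction.stabilizer G x)})
              (by
                intro g hg x hx
                refine IsFull.conj hx g fun k hk => mem_inf.2
                  ⟨mul_mem (mul_mem hg hk.1) (inv_mem hg), MulAction.conj_mem_stabilizer g hk.2⟩)
              (fun x hx => hx) (Or.inr (h.stabilizer_ne_top b))
            exact hF.mono fun g hg => ⟨hfix g hg a (by rw [Set.mem_ofPred_eq, inf_comm]; exact hab),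
              hfix g hg c hbc⟩ } }
  have hR : ∀ (g : G) (a b : X), R a b → R (g • a) (g • b) := by
    intro g a b hab
    exact IsFull.conj hab g fun k hk => mem_inf.2
      ⟨MulAction.conj_mem_stabilizer g hk.1, MulAction.conj_mem_stabilizer g hk.2⟩
  let _ : MulAction G (Quotient R) :=
    { smul := fun g => Quotient.map (g • ·) (hR g)
      one_smul := by
        rintro ⟨a⟩
        exact congrArg (Quotient.mk R) (one_smul G a)
      mul_smul := by
        rintro g k ⟨a⟩
        exact congrArg (Quotient.mk R) (mul_smul g k a) }
  have hq : ∀ (g : G) (a : X), g • (Quotient.mk R a) = Quotient.mk R (g • a) := fun _ _ => rfl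
  have hcard : Nat.card (Quotient R) < Nat.card X := by
    classical
    have := Fintype.ofFinite X
    have := Fintype.ofFinite (Quotient R)
    rw [Nat.card_eq_fintype_card, Nat.card_eq_fintype_card]
    exact Fintype.card_lt_of_surjective_not_injective _ Quotient.mk_surjective
      fun hi => hne (hi (Quotient.sound hxy))
  have hB := h.min G (Quotient R) φ h.surj (Or.inl hcard) (by
    rintro ⟨a⟩
    refine (h.stab a).mono fun g hg => ?_
    exact congrArg (Quotient.mk R) hg)
  set B := (MulAction.toPermHom G (Quotient R)).ker with hBdef
  have hBm : ∀ g ∈ B, ∀ a, R (g • a) a := fun g hg a => by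
    refine Quotient.exact ?_
    exact congrArg (fun e : Equiv.Perm (Quotient R) => e (Quotient.mk R a))
      (MonoidHom.mem_ker.1 hg)
  have hF : ∀ a : X, IsFull φ (fixingSubgroup G {b | R a b}) := by
    intro a
    obtain ⟨F, -, hF, hfix⟩ := h.exists_fix (h.stab a) (D := {b | R a b})
      (by
        intro g hg x hx
        have := hR g a x hx
        rwa [show g • a = a from hg] at this)
      (fun x hx => hx) (Or.inr (h.stabilizer_ne_top a))
    exact hF.mono fun g hg => (mem_fixingSubgroup_iff G).2 fun y hy => hfix g hg y hy
  have hBF : ∀ b ∈ B, ∀ a : X, ∀ g ∈ fixingSubgroup G {b | R a b},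
      b * g * b⁻¹ ∈ fixingSubgroup G {b | R a b} := by
    intro b hb a g hg
    rw [mem_fixingSubgroup_iff] at hg ⊢
    intro y hy
    rw [mul_smul, mul_smul, hg, smul_inv_smul]
    exact R.trans hy (R.symm (hBm _ (inv_mem hb) y))
  refine h.not_fix_all (IsFull.iInf (F := fun a => B ⊓ fixingSubgroup G {b | R a b}) hB
    (fun a => ?_) (fun _ => inf_le_left) ?_) ?_
  · exact IsFull.inf hB (hF a) (fun b hb g hg => hBF b hb a g hg)
      fun g _ b hb => (MonoidHom.normal_ker _).conj_mem b hb g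
  · intro a b hb g hg
    exact ⟨(MonoidHom.normal_ker _).conj_mem g hg.1 b, hBF b hb a g hg.2⟩
  · intro g hg z
    rw [Subgroup.mem_iInf] at hg
    exact (mem_fixingSubgroup_iff G).1 (hg z).2 z (R.refl z)

lemma le_stabilizer [Finite G] [Finite X] [Group.IsPerfect S] (h : MinCx X φ) {H : Subgroup G}
    (hne : H ≠ ⊤) {x : X} (hs : IsFull φ (H ⊓ MulAction.stabilizer G x)) :
    H ≤ MulAction.stabilizer G x := by
  have hinv : ∀ g ∈ H, ∀ y : X, IsFull φ (H ⊓ MulAction.stabilizer G y) →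
      IsFull φ (H ⊓ MulAction.stabilizer G (g • y)) := fun g hg y hy =>
    IsFull.conj hy g fun k hk => mem_inf.2 ⟨mul_mem (mul_mem hg hk.1) (inv_mem hg),
      MulAction.conj_mem_stabilizer g hk.2⟩
  obtain ⟨F, -, hF, hfix⟩ := h.exists_fix (hs.mono inf_le_left)
    (D := {x | IsFull φ (H ⊓ MulAction.stabilizer G x)}) hinv (fun x hx => hx) (Or.inr hne)
  intro g hg
  exact (h.two_point (hF.mono fun k hk => mem_inf.2 ⟨hfix k hk _ (hinv g hg x hs),
    hfix k hk _ hs⟩))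

end MinCx

namespace MinCx

variable {G S X : Type} [Group G] [Group S] [MulAction G X] {φ : G →* S}
variable [Finite G] [Finite X] [IsSimpleGroup S] [Group.IsPerfect S]

lemma card_mul_card_stabilizer (h : MinCx X φ) (x : X) :
    Nat.card X * Nat.card ↥(MulAction.stabilizer G x ⊓ φ.ker) = Nat.card φ.ker := by
  have : MulAction.IsPretransitive φ.ker X := ⟨fun a b => by
    obtain ⟨g, hg, e⟩ := h.exists_ker_smul_eq a b
    exact ⟨⟨g, hg⟩, e⟩⟩
  rw [← MulAction.index_stabilizer_of_transitive φ.ker x, mul_comm,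
    ← (MulAction.stabilizer φ.ker x).card_mul_index]
  congr 1
  have h1 : (MulAction.stabilizer φ.ker x).map φ.ker.subtype
      = MulAction.stabilizer G x ⊓ φ.ker := by
    ext g
    constructor
    · rintro ⟨k, hk, rfl⟩
      exact mem_inf.2 ⟨hk, k.2⟩
    · intro hg
      exact ⟨⟨g, hg.2⟩, hg.1, rfl⟩
  rw [← h1]
  exact (Nat.card_congr (equivMapOfInjective _ _ φ.ker.subtype_injective).toEquiv).symm

lemma card_stabilizer_eq (h : MinCx X φ) (x y : X) :
    Nat.card ↥(MulAction.stabilizer G x ⊓ φ.ker) = Nat.card ↥(MulAction.stabilizer G y ⊓ φ.ker) := by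
  have : Nonempty X := ⟨x⟩
  exact Nat.eq_of_mul_eq_mul_left Nat.card_pos
    ((h.card_mul_card_stabilizer x).trans (h.card_mul_card_stabilizer y).symm)

lemma fix_eq (h : MinCx X φ) {x y : X} (hxy : ∀ g : G, g • x = x → g • y = y) : x = y :=
  h.two_point ((h.stab x).mono fun g hg => mem_inf.2 ⟨hg, hxy g hg⟩)

lemma not_dvd (h : MinCx X φ) {p : ℕ} [Fact p.Prime] {x : X}
    (hp : p ∣ Nat.card ↥(MulAction.stabilizer G x ⊓ φ.ker)) : ¬ p ∣ Nat.card X := by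
  have hpp : p.Prime := Fact.out
  have : Nonempty X := ⟨x⟩
  obtain ⟨Q, hQ, hc⟩ := exists_sylow p (MulAction.stabilizer G x ⊓ φ.ker)
  set a := (Nat.card ↥(MulAction.stabilizer G x ⊓ φ.ker)).factorization p with ha
  have hκ : Nat.card ↥(MulAction.stabilizer G x ⊓ φ.ker) ≠ 0 := Nat.card_pos.ne'
  have ha0 : 0 < a := hpp.factorization_pos_of_dvd hκ hp
  have hN := (h.stab x).normalizer hQ hc
  have hNt : normalizer (Q : Set G) ≠ ⊤ := by
    intro ht
    have hQ1 : Q = ⊥ := by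
      rw [eq_bot_iff]
      intro q hq
      rw [mem_bot]
      refine h.eq_one fun y => ?_
      obtain ⟨g, rfl⟩ := h.exists_smul_eq x y
      have h1 : g⁻¹ * q * g⁻¹⁻¹ ∈ Q := conj_mem_of_mem_normalizer (ht ▸ mem_top g⁻¹) hq
      have h2 := MulAction.conj_mem_stabilizer g (hQ h1).1
      simpa [mul_assoc] using h2
    rw [hQ1, card_bot] at hc
    exact (Nat.one_lt_pow ha0.ne' hpp.one_lt).ne hc
  have hle := h.le_stabilizer hNt hN
  intro hn
  have hd : p ^ (a + 1) ∣ Nat.card φ.ker := by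
    rw [← h.card_mul_card_stabilizer x, pow_succ, mul_comm]
    exact mul_dvd_mul hn (Nat.ordProj_dvd _ _)
  have h1 := pow_dvd_card_normalizer_inf (hQ.trans inf_le_right) hc hd
  have h2 : Nat.card ↥(normalizer (Q : Set G) ⊓ φ.ker) ∣
      Nat.card ↥(MulAction.stabilizer G x ⊓ φ.ker) :=
    card_dvd_of_le (inf_le_inf_right _ hle)
  have := (hpp.pow_dvd_iff_le_factorization hκ).1 (h1.trans h2)
  omega

lemma coprime_card (h : MinCx X φ) (x : X) :
    (Nat.card X).Coprime (Nat.card ↥(MulAction.stabilizer G x ⊓ φ.ker)) := by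
  refine Nat.Coprime.symm (Nat.coprime_of_dvd fun p hp h1 => ?_)
  have := Fact.mk hp
  exact h.not_dvd h1

lemma exists_isPGroup_le (h : MinCx X φ) {p : ℕ} [Fact p.Prime] {x : X}
    (hp : p ∣ Nat.card ↥(MulAction.stabilizer G x ⊓ φ.ker)) {Q : Subgroup G}
    (hQ : IsPGroup p Q) : ∃ y : X, Q ≤ MulAction.stabilizer G y := by
  obtain ⟨y, hy⟩ := hQ.nonempty_fixed_point_of_prime_not_dvd_card X (h.not_dvd hp)
  exact ⟨y, fun q hq => hy ⟨q, hq⟩⟩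

lemma normalizer_le_stabilizer (h : MinCx X φ) {p : ℕ} [Fact p.Prime] {x : X}
    (hp : p ∣ Nat.card ↥(MulAction.stabilizer G x ⊓ φ.ker)) {Q : Subgroup G}
    (hQ : IsPGroup p Q) (hQK : Q ≤ φ.ker) (hne : Q ≠ ⊥)
    (hN : IsFull φ (normalizer (Q : Set G))) :
    ∃ y : X, normalizer (Q : Set G) ≤ MulAction.stabilizer G y := by
  induction hm : Nat.card φ.ker - Nat.card Q using Nat.strong_induction_on generalizing Q with
  | _ m ih =>
  have hpp : p.Prime := Fact.out
  have hNt : normalizer (Q : Set G) ≠ ⊤ := by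
    intro ht
    refine hne ?_
    obtain ⟨y, hy⟩ := h.exists_isPGroup_le hp hQ
    rw [eq_bot_iff]
    intro q hq
    rw [mem_bot]
    refine h.eq_one fun z => ?_
    obtain ⟨g, rfl⟩ := h.exists_smul_eq y z
    have h1 : g⁻¹ * q * g⁻¹⁻¹ ∈ Q := conj_mem_of_mem_normalizer (ht ▸ mem_top g⁻¹) hq
    have h2 := MulAction.conj_mem_stabilizer g (hy h1)
    simpa [mul_assoc] using h2
  have hQN : Q ≤ normalizer (Q : Set G) ⊓ φ.ker := le_inf le_normalizer hQK
  obtain ⟨Q2, hQ2, hle, hc⟩ := exists_sylow_ge (p := p) hQN hQ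
  by_cases hcard : Nat.card Q2 = Nat.card Q
  · have hcQ : Nat.card Q = p ^ (Nat.card ↥(normalizer (Q : Set G) ⊓ φ.ker)).factorization p := by
      rw [← hcard, hc]
    obtain ⟨y, hy⟩ := h.exists_isPGroup_le hp hQ
    refine ⟨y, h.le_stabilizer hNt ((h.stab y).normalizer (p := p) (le_inf hy hQK) ?_)⟩
    set a := (Nat.card ↥(normalizer (Q : Set G) ⊓ φ.ker)).factorization p
    have hd : ¬ p ^ (a + 1) ∣ Nat.card φ.ker := by
      intro hd
      have := (hpp.pow_dvd_iff_le_factorization Nat.card_pos.ne').1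
        (pow_dvd_card_normalizer_inf hQK hcQ hd)
      omega
    have h1 : p ^ a ∣ Nat.card ↥(MulAction.stabilizer G y ⊓ φ.ker) :=
      hcQ ▸ card_dvd_of_le (le_inf hy hQK)
    have h2 : ¬ p ^ (a + 1) ∣ Nat.card ↥(MulAction.stabilizer G y ⊓ φ.ker) := fun h3 =>
      hd (h3.trans (card_dvd_of_le inf_le_right))
    have hpos : Nat.card ↥(MulAction.stabilizer G y ⊓ φ.ker) ≠ 0 := Nat.card_pos.ne'
    rw [hpp.pow_dvd_iff_le_factorization hpos] at h1 h2
    rw [hcQ]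
    congr 1
    omega
  · have hlt : Nat.card Q < Nat.card Q2 :=
      lt_of_le_of_ne (Nat.card_le_card_of_injective _ (inclusion_injective hQ2)) (Ne.symm hcard)
    have hQ2K : Q2 ≤ φ.ker := hle.trans inf_le_right
    have hle2 : Nat.card Q2 ≤ Nat.card φ.ker := Nat.card_le_card_of_injective _
      (inclusion_injective hQ2K)
    have hF := hN.normalizer hle hc
    obtain ⟨y, hy⟩ := ih (Nat.card φ.ker - Nat.card Q2) (by omega) (isPGroup_of_card hc) hQ2K
      (by rintro rfl; exact hne (le_bot_iff.1 hQ2)) (hF.mono inf_le_left) rfl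
    refine ⟨y, h.le_stabilizer hNt (hF.mono fun g hg => mem_inf.2 ⟨hg.2, hy hg.1⟩)⟩

lemma le_stabilizer_or_coprime (h : MinCx X φ) (x : X) {H : Subgroup G} (hH : IsFull φ H)
    (hne : H ≠ ⊤) : (∃ y : X, H ≤ MulAction.stabilizer G y) ∨
      (Nat.card ↥(H ⊓ φ.ker)).Coprime (Nat.card ↥(MulAction.stabilizer G x ⊓ φ.ker)) := by
  refine or_iff_not_imp_right.2 fun hc => ?_
  obtain ⟨p, hpp, h1, h2⟩ := Nat.Prime.not_coprime_iff_dvd.1 hc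
  have := Fact.mk hpp
  obtain ⟨Q, hQ, hcQ⟩ := exists_sylow p (H ⊓ φ.ker)
  have hF := hH.normalizer hQ hcQ
  have hpos := hpp.factorization_pos_of_dvd (Nat.card_pos (α := ↥(H ⊓ φ.ker))).ne' h1
  obtain ⟨y, hy⟩ := h.normalizer_le_stabilizer h2 (isPGroup_of_card hcQ) (hQ.trans inf_le_right)
    (by
      rintro rfl
      rw [card_bot] at hcQ
      exact (Nat.one_lt_pow hpos.ne' hpp.one_lt).ne hcQ) (hF.mono inf_le_left)
  exact ⟨y, h.le_stabilizer hne (hF.mono fun g hg => mem_inf.2 ⟨hg.2, hy hg.1⟩)⟩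

/-- The minimality hypothesis applied to affine actions. -/
lemma isFull_ker_mulAut (h : MinCx X φ) {H A : Type} [Group H] [Group A] [Finite H] [Finite A]
    (π : H →* S) (hπ : Function.Surjective π) (ψ : H →* MulAut A)
    (hA : Nat.card A < Nat.card X) : IsFull π ψ.ker := by
  let _ : MulAction (A ⋊[ψ] H) A :=
    { smul := fun g a => g.left * ψ g.right a
      one_smul := fun a => by
        show (1 : A ⋊[ψ] H).left * ψ (1 : A ⋊[ψ] H).right a = a
        simp
      mul_smul := fun g k a => by
        show (g * k).left * ψ (g * k).right a = g.left * ψ g.right (k.left * ψ k.right a)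
        simp [mul_assoc] }
  have hsm : ∀ (g : A ⋊[ψ] H) (a : A), g • a = g.left * ψ g.right a := fun _ _ => rfl
  have : Finite (A ⋊[ψ] H) := Finite.of_equiv _ SemidirectProduct.equivProd.symm
  have := h.min (A ⋊[ψ] H) A (π.comp SemidirectProduct.rightHom)
    (hπ.comp SemidirectProduct.rightHom_surjective) (Or.inl hA) fun a s => by
      obtain ⟨k, rfl⟩ := hπ s
      refine ⟨⟨a * (ψ k a)⁻¹, k⟩, ?_, rfl⟩
      rw [MulAction.mem_stabilizer_iff, hsm]
      simp
  intro s
  obtain ⟨g, hg, rfl⟩ := this s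
  have hg' : ∀ a : A, g • a = a := fun a =>
    congrArg (fun e : Equiv.Perm A => e a) (MonoidHom.mem_ker.1 hg)
  have h1 : g.left = 1 := by
    have := hg' 1
    rw [hsm] at this
    simpa using this
  refine ⟨g.right, ?_, rfl⟩
  rw [MonoidHom.mem_ker]
  ext a
  have := hg' a
  rw [hsm, h1, one_mul] at this
  exact this

lemma isFull_inf_centralizer (h : MinCx X φ) {H A : Subgroup G} (hH : IsFull φ H)
    (hA : H ≤ normalizer (A : Set G)) (hc : Nat.card A < Nat.card X) :
    IsFull φ (H ⊓ centralizer (A : Set G)) := by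
  have := h.isFull_ker_mulAut (φ.comp H.subtype) hH.surjective_restrict
    (A.normalizerMonoidHom.comp (inclusion hA)) hc
  intro s
  obtain ⟨g, hg, e⟩ := this s
  refine ⟨g, mem_inf.2 ⟨g.2, ?_⟩, e⟩
  have h1 : inclusion hA g ∈ A.normalizerMonoidHom.ker := hg
  rw [normalizerMonoidHom_ker] at h1
  exact h1

lemma semiregular (h : MinCx X φ) {x : X} {L : Subgroup G} (hL : L ≤ φ.ker)
    (hc : (Nat.card L).Coprime (Nat.card ↥(MulAction.stabilizer G x ⊓ φ.ker)))
    {g : G} (hg : g ∈ L) {y : X} (hy : g • y = y) : g = 1 := by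
  rw [h.card_stabilizer_eq x y] at hc
  have h1 : orderOf g ∣ Nat.card L := by
    rw [← L.orderOf_mk g hg]; exact orderOf_dvd_natCard _
  have h2 : orderOf g ∣ Nat.card ↥(MulAction.stabilizer G y ⊓ φ.ker) := by
    have hm : g ∈ MulAction.stabilizer G y ⊓ φ.ker := mem_inf.2 ⟨hy, hL hg⟩
    rw [← (MulAction.stabilizer G y ⊓ φ.ker).orderOf_mk g hm]; exact orderOf_dvd_natCard _
  exact orderOf_eq_one_iff.1 (Nat.eq_one_of_dvd_coprimes hc h1 h2)

lemma smul_injective (h : MinCx X φ) {x : X} {L : Subgroup G} (hL : L ≤ φ.ker)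
    (hc : (Nat.card L).Coprime (Nat.card ↥(MulAction.stabilizer G x ⊓ φ.ker))) (y : X) :
    Function.Injective fun g : L => (g : G) • y := by
  intro a b hab
  have := h.semiregular hL hc (mul_mem (inv_mem b.2) a.2) (y := y) (by
    rw [mul_smul, show (a : G) • y = (b : G) • y from hab, inv_smul_smul])
  exact Subtype.ext (inv_mul_eq_one.1 this).symm

lemma exists_smul_of_card (h : MinCx X φ) {x : X} {L : Subgroup G} (hL : L ≤ φ.ker)
    (hc : (Nat.card L).Coprime (Nat.card ↥(MulAction.stabilizer G x ⊓ φ.ker)))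
    (hn : Nat.card L = Nat.card X) (y z : X) : ∃ g ∈ L, g • y = z := by
  obtain ⟨g, hg⟩ := ((Nat.bijective_iff_injective_and_card _).2
    ⟨h.smul_injective hL hc y, hn⟩).2 z
  exact ⟨g, g.2, hg⟩

lemma isFull_inf_stabilizer {H L : Subgroup G} (hH : IsFull φ H) (hL : L ≤ φ.ker) (hLH : L ≤ H)
    (ht : ∀ y z : X, ∃ g ∈ L, g • y = z) (x : X) : IsFull φ (H ⊓ MulAction.stabilizer G x) := by
  intro s
  obtain ⟨g, hg, rfl⟩ := hH s
  obtain ⟨l, hl, e⟩ := ht x (g • x)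
  refine ⟨l⁻¹ * g, mem_inf.2 ⟨mul_mem (inv_mem (hLH hl)) hg, ?_⟩, ?_⟩
  · rw [MulAction.mem_stabilizer_iff, mul_smul, ← e, inv_smul_smul]
  · rw [map_mul, map_inv, show φ l = 1 from hL hl, inv_one, one_mul]

lemma normal_of_card (h : MinCx X φ) {x : X} {L : Subgroup G} (hL : L ≤ φ.ker)
    (hc : (Nat.card L).Coprime (Nat.card ↥(MulAction.stabilizer G x ⊓ φ.ker)))
    (hn : Nat.card L = Nat.card X) (hN : IsFull φ (normalizer (L : Set G))) : L.Normal := by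
  rw [← normalizer_eq_top_iff]
  by_contra hne
  refine h.not_fix_all hN fun g hg y => ?_
  exact h.le_stabilizer hne (isFull_inf_stabilizer hN hL le_normalizer
    (h.exists_smul_of_card hL hc hn) y) hg

lemma card_eq_of_central (h : MinCx X φ) {x : X} {L A : Subgroup G} (hL : L ≤ φ.ker)
    (hc : (Nat.card L).Coprime (Nat.card ↥(MulAction.stabilizer G x ⊓ φ.ker)))
    (hn : Nat.card L = Nat.card X) (hAL : A ≤ L) (hA : A.Normal) (hne : A ≠ ⊥)
    (hcomm : ∀ a ∈ A, ∀ l ∈ L, a * l = l * a) : A = L := by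
  refine eq_of_le_of_card_ge hAL ?_
  by_contra hlt
  rw [not_le, hn] at hlt
  have h1 := h.isFull_inf_centralizer (IsFull.top h.surj)
    (normalizer_eq_top_iff.2 hA).ge hlt
  rw [top_inf_eq] at h1
  have hLC : L ≤ centralizer (A : Set G) := fun l hl => mem_centralizer_iff.2 fun a ha =>
    hcomm a ha l hl
  have h2 := isFull_inf_stabilizer h1 hL hLC (h.exists_smul_of_card hL hc hn) x
  obtain ⟨a, ha, ha1⟩ := A.bot_or_exists_ne_one.resolve_left hne
  refine ha1 (h.semiregular hL hc (hAL ha) (y := x) (h.two_point (h2.mono fun g hg =>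
    mem_inf.2 ⟨?_, hg.2⟩)))
  rw [MulAction.mem_stabilizer_iff, ← mul_smul, ← mem_centralizer_iff.1 hg.1 a ha, mul_smul,
    show g • x = x from hg.2]

end MinCx

/-- The kernel of `φ` contains a regular elementary abelian normal subgroup. -/
def HasAffine {G S : Type} [Group G] [Group S] (X : Type) (φ : G →* S) : Prop :=
  ∃ V : Subgroup G, V.Normal ∧ V ≤ φ.ker ∧ Nat.card V = Nat.card X ∧
    (∀ a ∈ V, ∀ b ∈ V, a * b = b * a) ∧ ∃ r : ℕ, r.Prime ∧ ∀ a ∈ V, a ^ r = 1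

/-- `U` is full, perfect, and meets the kernel in a central subgroup. -/
structure IsQuasi {G S : Type} [Group G] [Group S] (φ : G →* S) (U : Subgroup G) : Prop where
  full : IsFull φ U
  perfect : ⁅U, U⁆ = U
  central : ∀ a ∈ U, a ∈ φ.ker → ∀ u ∈ U, a * u = u * a

namespace IsQuasi

variable {G S : Type} [Group G] [Group S] {φ : G →* S}

/-- A full subgroup contains all commutators of a central extension. -/
lemma commutator_le_of_central {E M : Subgroup G} (hE : ∀ a ∈ E, a ∈ φ.ker → ∀ u ∈ E, a * u = u * a)
    (hM : IsFull φ M) (hME : M ≤ E) : ⁅E, E⁆ ≤ ⁅M, M⁆ := by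
  have key : ∀ u ∈ E, ∃ m ∈ M, ∃ z : G, (∀ v ∈ E, z * v = v * z) ∧ u = z * m := by
    intro u hu
    obtain ⟨m, hm, e⟩ := hM (φ u)
    refine ⟨m, hm, u * m⁻¹, hE _ (mul_mem hu (inv_mem (hME hm))) ?_, by group⟩
    simp [MonoidHom.mem_ker, e]
  rw [commutator_le]
  intro u hu v hv
  obtain ⟨m, hm, z, hz, rfl⟩ := key u hu
  obtain ⟨n, hn, w, hw, rfl⟩ := key v hv
  have hwz : w * z = z * w := by
    have h1 := hw _ hu
    have h2 := hw m (hME hm)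
    have : w * z * m = z * w * m := by rw [mul_assoc, h1, mul_assoc, ← h2, mul_assoc]
    exact mul_right_cancel this
  have : ⁅z * m, w * n⁆ = ⁅m, n⁆ := by
    have e1 : z * m * (w * n) = z * w * (m * n) := by
      rw [mul_assoc, ← mul_assoc m, ← hw m (hME hm)]; group
    have e2 : w * n * (z * m) = z * w * (n * m) := by
      rw [mul_assoc, ← mul_assoc n, ← hz n (hME hn), ← hwz]; group
    rw [commutatorElement_def, commutatorElement_def]
    calc z * m * (w * n) * (z * m)⁻¹ * (w * n)⁻¹
        = z * m * (w * n) * (w * n * (z * m))⁻¹ := by group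
      _ = z * w * ((m * n) * (n * m)⁻¹) * (z * w)⁻¹ := by rw [e1, e2]; group
      _ = m * n * m⁻¹ * n⁻¹ := by
          have hmn : (m * n) * (n * m)⁻¹ ∈ E :=
            mul_mem (mul_mem (hME hm) (hME hn)) (inv_mem (mul_mem (hME hn) (hME hm)))
          rw [mul_assoc z, hw _ hmn, ← mul_assoc, hz _ hmn]; group
  rw [this]
  exact commutator_mem_commutator hm hn

lemma commutator_of_central [Group.IsPerfect S] {E : Subgroup G} (hEf : IsFull φ E)
    (hE : ∀ a ∈ E, a ∈ φ.ker → ∀ u ∈ E, a * u = u * a) : IsQuasi φ ⁅E, E⁆ := by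
  have hle : ⁅E, E⁆ ≤ E := commutator_le.2 fun a ha b hb =>
    mul_mem (mul_mem (mul_mem ha hb) (inv_mem ha)) (inv_mem hb)
  exact ⟨hEf.commutator hEf, le_antisymm (commutator_mono hle hle)
      (commutator_le_of_central hE (hEf.commutator hEf) hle),
    fun a ha hk u hu => hE a (hle ha) hk u (hle hu)⟩

lemma le_of_full {U M : Subgroup G} (hU : IsQuasi φ U) (hM : IsFull φ M) (hMU : M ≤ U) :
    U ≤ M := by
  have h1 := commutator_le_of_central hU.central hM hMU
  rw [hU.perfect] at h1
  exact h1.trans (commutator_le.2 fun a ha b hb =>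
    mul_mem (mul_mem (mul_mem ha hb) (inv_mem ha)) (inv_mem hb))

lemma conj {U : Subgroup G} (hU : IsQuasi φ U) (g : G) :
    IsQuasi φ (U.map (MulAut.conj g).toMonoidHom) where
  full := hU.full.conj g fun x hx => ⟨x, hx, rfl⟩
  perfect := by rw [← map_commutator, hU.perfect]
  central := by
    rintro _ ⟨a, ha, rfl⟩ hk _ ⟨u, hu, rfl⟩
    rw [← map_mul, ← map_mul, hU.central a ha _ u hu]
    simpa [MonoidHom.mem_ker] using hk

/-- An element of the kernel which normalizes `U` centralizes `U`. -/
lemma commute_of_normalizes {U : Subgroup G} (hU : IsQuasi φ U) {g : G} (hg : g ∈ φ.ker)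
    (hn : ∀ u ∈ U, g * u * g⁻¹ ∈ U) : ∀ u ∈ U, g * u = u * g := by
  have key : ∀ u ∈ U, ∃ z : G, (∀ v ∈ U, z * v = v * z) ∧ z ∈ U ∧ g * u * g⁻¹ = z * u := by
    intro u hu
    refine ⟨g * u * g⁻¹ * u⁻¹, ?_, ?_, by group⟩
    · refine hU.central _ (mul_mem (hn u hu) (inv_mem hu)) ?_
      simp [MonoidHom.mem_ker, show φ g = 1 from hg]
    · exact mul_mem (hn u hu) (inv_mem hu)
  have h1 : ⁅U, U⁆ ≤ centralizer {g} := by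
    rw [commutator_le]
    intro u hu v hv
    obtain ⟨z, hz, hzU, e⟩ := key u hu
    obtain ⟨w, hw, hwU, f⟩ := key v hv
    rw [mem_centralizer_singleton_iff]
    have h2 : g * ⁅u, v⁆ * g⁻¹ = ⁅u, v⁆ := by
      have h3 : g * ⁅u, v⁆ * g⁻¹ = ⁅g * u * g⁻¹, g * v * g⁻¹⁆ := by
        rw [commutatorElement_def, commutatorElement_def]; group
      rw [h3, e, f, commutatorElement_def, commutatorElement_def]
      have e1 : z * u * (w * v) = z * w * (u * v) := by
        rw [mul_assoc, ← mul_assoc u, ← hw u hu]; group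
      have e2 : w * v * (z * u) = z * w * (v * u) := by
        rw [mul_assoc, ← mul_assoc v, ← hz v hv, hz w hwU]; group
      have hmn : (u * v) * (v * u)⁻¹ ∈ U :=
        mul_mem (mul_mem hu hv) (inv_mem (mul_mem hv hu))
      calc z * u * (w * v) * (z * u)⁻¹ * (w * v)⁻¹
          = z * u * (w * v) * (w * v * (z * u))⁻¹ := by group
        _ = z * w * ((u * v) * (v * u)⁻¹) * (z * w)⁻¹ := by rw [e1, e2]; group
        _ = u * v * u⁻¹ * v⁻¹ := by
          rw [mul_assoc z, hw _ hmn, ← mul_assoc, hz _ hmn]; group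
    exact (mul_inv_eq_iff_eq_mul.1 h2).symm
  rw [hU.perfect] at h1
  intro u hu
  have := mem_centralizer_singleton_iff.1 (h1 hu)
  exact this.symm

end IsQuasi

namespace MinCx

variable {G S X : Type} [Group G] [Group S] [MulAction G X] {φ : G →* S}
variable [Finite G] [Finite X] [IsSimpleGroup S] [Group.IsPerfect S]

lemma hasAffine_of_card (h : MinCx X φ) {x : X} {L : Subgroup G} (hL : L ≤ φ.ker)
    (hc : (Nat.card L).Coprime (Nat.card ↥(MulAction.stabilizer G x ⊓ φ.ker)))
    (hn : Nat.card L = Nat.card X) (hN : IsFull φ (normalizer (L : Set G))) {z : G} (hz : z ∈ L)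
    (hz1 : z ≠ 1) (hcz : ∀ l ∈ L, z * l = l * z) : HasAffine X φ := by
  have hLn := h.normal_of_card hL hc hn hN
  have hAL : L ⊓ centralizer (L : Set G) = L := by
    refine h.card_eq_of_central hL hc hn inf_le_left ?_ ?_ ?_
    · exact inferInstance
    · intro hb
      have : z ∈ L ⊓ centralizer (L : Set G) := mem_inf.2 ⟨hz, mem_centralizer_iff.2 fun l hl =>
        (hcz l hl).symm⟩
      rw [hb] at this
      exact hz1 (mem_bot.1 this)
    · exact fun a ha l hl => (mem_centralizer_iff.1 ha.2 l hl).symm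
  have hcomm : ∀ a ∈ L, ∀ b ∈ L, a * b = b * a := fun a ha b hb =>
    (mem_centralizer_iff.1 (hAL.ge ha).2 b hb).symm
  have hL1 : Nat.card L ≠ 1 := by
    intro h1
    rw [card_eq_one] at h1
    rw [h1] at hz
    exact hz1 (mem_bot.1 hz)
  obtain ⟨r, hr, hd⟩ := Nat.exists_prime_and_dvd hL1
  have := Fact.mk hr
  let V : Subgroup G :=
    { carrier := {a | a ∈ L ∧ a ^ r = 1}
      mul_mem' := fun {a b} ha hb => ⟨mul_mem ha.1 hb.1, by
        rw [(show Commute a b from hcomm a ha.1 b hb.1).mul_pow, ha.2, hb.2, one_mul]⟩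
      one_mem' := ⟨one_mem _, one_pow _⟩
      inv_mem' := fun {a} ha => ⟨inv_mem ha.1, by rw [inv_pow, ha.2, inv_one]⟩ }
  have hV : V = L := by
    refine h.card_eq_of_central hL hc hn (fun a ha => ha.1) ⟨fun a ha g => ?_⟩ ?_
      fun a ha l hl => hcomm a ha.1 l hl
    · exact ⟨hLn.conj_mem a ha.1 g, by rw [conj_pow, ha.2]; group⟩
    · intro hb
      obtain ⟨a, ha⟩ := exists_prime_orderOf_dvd_card' r hd
      have h1 : (a : G) ∈ V := ⟨a.2, by
        rw [← ha, ← Subgroup.coe_pow, pow_orderOf_eq_one, Subgroup.coe_one]⟩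
      rw [hb, mem_bot] at h1
      have h2 : a = 1 := Subtype.ext h1
      rw [h2, orderOf_one] at ha
      exact hr.one_lt.ne ha
  exact ⟨L, hLn, hL, hn, hcomm, r, hr, fun a ha => (hV.ge ha).2⟩

lemma card_lt_of_not_affine (h : MinCx X φ) (hna : ¬ HasAffine X φ) {x : X} {L : Subgroup G}
    (hL : L ≤ φ.ker)
    (hc : (Nat.card L).Coprime (Nat.card ↥(MulAction.stabilizer G x ⊓ φ.ker)))
    (hN : IsFull φ (normalizer (L : Set G))) {z : G} (hz : z ∈ L)
    (hz1 : z ≠ 1) (hcz : ∀ l ∈ L, z * l = l * z) : Nat.card L < Nat.card X := by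
  refine lt_of_le_of_ne (Nat.card_le_card_of_injective _ (h.smul_injective hL hc x)) fun he => ?_
  exact hna (h.hasAffine_of_card hL hc he hN hz hz1 hcz)

lemma centralizer_coprime (h : MinCx X φ) {x : X} {g : G} (hg : g ∈ φ.ker) (hg1 : g ≠ 1)
    (hc : (orderOf g).Coprime (Nat.card ↥(MulAction.stabilizer G x ⊓ φ.ker))) {H : Subgroup G}
    (hH : IsFull φ H) (hne : H ≠ ⊤) (hgH : g ∈ H) :
    (Nat.card ↥(H ⊓ φ.ker)).Coprime (Nat.card ↥(MulAction.stabilizer G x ⊓ φ.ker)) := by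
  refine (h.le_stabilizer_or_coprime x hH hne).resolve_left ?_
  rintro ⟨y, hy⟩
  refine hg1 (h.semiregular (x := x) (L := zpowers g) (by rwa [zpowers_le]) ?_ (mem_zpowers g) (hy hgH))
  rwa [Nat.card_zpowers]

lemma centralizer_ne_top (h : MinCx X φ) {x : X} {g : G} (hg : g ∈ φ.ker) (hg1 : g ≠ 1)
    (hc : (orderOf g).Coprime (Nat.card ↥(MulAction.stabilizer G x ⊓ φ.ker))) :
    centralizer {g} ≠ ⊤ := by
  intro ht
  refine hg1 (h.semiregular (L := zpowers g) (by rwa [zpowers_le]) (by rwa [Nat.card_zpowers])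
    (mem_zpowers g) (y := x) (h.fix_eq fun k hk => ?_).symm)
  have h1 := mem_centralizer_singleton_iff.1 (ht ▸ mem_top k : k ∈ centralizer {g})
  rw [← mul_smul, h1, mul_smul, hk]

lemma isFull_centralizer_aux (h : MinCx X φ) (hna : ¬ HasAffine X φ) {x : X} {g : G}
    (hg : g ∈ φ.ker) (hg1 : g ≠ 1)
    (hc : (orderOf g).Coprime (Nat.card ↥(MulAction.stabilizer G x ⊓ φ.ker)))
    (hC : IsFull φ (centralizer {g})) {H : Subgroup G} (hH : IsFull φ H)
    (hHC : H ≤ centralizer {g}) :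
    IsFull φ (H ⊓ centralizer ((centralizer {g} ⊓ φ.ker : Subgroup G) : Set G)) := by
  have hgC : g ∈ centralizer {g} := mem_centralizer_singleton_iff.2 rfl
  have hNC : centralizer {g} ≤ normalizer ((centralizer {g} ⊓ φ.ker : Subgroup G) : Set G) := by
    intro k hk
    refine mem_normalizer_of_forall fun y hy => mem_inf.2 ⟨?_, ?_⟩
    · exact mul_mem (mul_mem hk hy.1) (inv_mem hk)
    · exact (MonoidHom.normal_ker φ).conj_mem y hy.2 k
  refine h.isFull_inf_centralizer hH (hHC.trans hNC) ?_
  refine h.card_lt_of_not_affine hna inf_le_right (h.centralizer_coprime hg hg1 hc hC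
    (h.centralizer_ne_top hg hg1 hc) hgC) (hC.mono hNC) (mem_inf.2 ⟨hgC, hg⟩) hg1 ?_
  intro l hl
  have := mem_centralizer_singleton_iff.1 hl.1
  exact this.symm

lemma isFull_centralizer_sylow (h : MinCx X φ) (hna : ¬ HasAffine X φ) (x : X) {r : ℕ}
    [Fact r.Prime] (hr : r ∣ Nat.card X) {R : Subgroup G} (hR : R ≤ φ.ker)
    (hc : Nat.card R = r ^ (Nat.card φ.ker).factorization r) :
    IsFull φ (centralizer (R : Set G)) ∧ ∃ z ∈ R, z ≠ 1 ∧ (∀ l ∈ R, z * l = l * z) ∧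
      (Nat.card R).Coprime (Nat.card ↥(MulAction.stabilizer G x ⊓ φ.ker)) := by
  have hrp : r.Prime := Fact.out
  have hN : IsFull φ (normalizer (R : Set G)) :=
    ((IsFull.top h.surj).normalizer (p := r) (Q := R) (by rwa [top_inf_eq])
      (by rwa [top_inf_eq])).mono inf_le_left
  have hcop : (Nat.card R).Coprime (Nat.card ↥(MulAction.stabilizer G x ⊓ φ.ker)) := by
    rw [hc]
    exact (Nat.Coprime.coprime_dvd_left hr (h.coprime_card x)).pow_left _
  have hpos : 0 < (Nat.card φ.ker).factorization r :=
    hrp.factorization_pos_of_dvd Nat.card_pos.ne'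
      (hr.trans (Dvd.intro _ (h.card_mul_card_stabilizer x)))
  have hRn : Nontrivial R := by
    rw [← Finite.one_lt_card_iff_nontrivial, hc]
    exact Nat.one_lt_pow hpos.ne' hrp.one_lt
  have := (isPGroup_of_card hc).center_nontrivial
  obtain ⟨⟨z, hz⟩, hz1⟩ := exists_ne (1 : center R)
  have hcz : ∀ l ∈ R, (z : G) * l = l * z := fun l hl => by
    have := mem_center_iff.1 hz ⟨l, hl⟩
    exact (congrArg Subtype.val this).symm
  have hz1' : (z : G) ≠ 1 := fun e => hz1 (Subtype.ext (Subtype.ext e))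
  refine ⟨?_, z, z.2, hz1', hcz, hcop⟩
  exact (h.isFull_inf_centralizer hN le_rfl
    (h.card_lt_of_not_affine hna hR hcop hN z.2 hz1' hcz)).mono inf_le_right

lemma isFull_centralizer (h : MinCx X φ) (hna : ¬ HasAffine X φ) {x : X} {g : G}
    (hg : g ∈ φ.ker) (hg1 : g ≠ 1)
    (hc : (orderOf g).Coprime (Nat.card ↥(MulAction.stabilizer G x ⊓ φ.ker))) :
    IsFull φ (centralizer {g}) := by
  obtain ⟨r, hr, hd⟩ := Nat.exists_prime_and_dvd (mt orderOf_eq_one_iff.1 hg1)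
  have := Fact.mk hr
  obtain ⟨m, hm⟩ := hd
  have hy : orderOf (g ^ m) = r := by
    rw [orderOf_pow_of_dvd (by rintro rfl; exact (orderOf_pos g).ne' (by simpa using hm))
      (hm ▸ dvd_mul_left m r), hm]
    exact Nat.mul_div_cancel _ (Nat.pos_of_ne_zero (by
      rintro rfl; exact (orderOf_pos g).ne' (by simpa using hm)))
  set y := g ^ m with hydef
  have hyK : y ∈ φ.ker := pow_mem hg m
  have hrd : r ∣ orderOf g := hm ▸ dvd_mul_right r m
  have hrX : r ∣ Nat.card X := by
    have h1 : r ∣ Nat.card X * Nat.card ↥(MulAction.stabilizer G x ⊓ φ.ker) := by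
      rw [h.card_mul_card_stabilizer x, ← hy, ← φ.ker.orderOf_mk y hyK]
      exact orderOf_dvd_natCard _
    exact (Nat.Coprime.coprime_dvd_left hrd hc).dvd_of_dvd_mul_right h1
  have hy1 : y ≠ 1 := fun e => by
    rw [e, orderOf_one] at hy
    exact hr.one_lt.ne hy
  obtain ⟨R, hyR, hRK, hcR⟩ := exists_sylow_ge (p := r) (L := φ.ker) (P := zpowers y)
    (by rwa [zpowers_le]) (IsPGroup.of_card (n := 1) (by rw [Nat.card_zpowers, hy, pow_one]))
  have h1 := (h.isFull_centralizer_sylow hna x hrX hRK hcR).1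
  have hCy : IsFull φ (centralizer {y}) := h1.mono (centralizer_le (by
    rw [Set.singleton_subset_iff]; exact hyR (mem_zpowers y)))
  have h2 := h.isFull_centralizer_aux hna hyK hy1
    (by rw [hy]; exact Nat.Coprime.coprime_dvd_left hrd hc) hCy hCy le_rfl
  refine h2.mono (inf_le_right.trans (centralizer_le ?_))
  rw [Set.singleton_subset_iff]
  refine mem_inf.2 ⟨mem_centralizer_singleton_iff.2 ?_, hg⟩
  rw [hydef]
  exact (Commute.refl g).pow_right m

end MinCx

/-- The conjugates of a nontrivial self-normalizing trivial intersection subgroup cover at least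
half of the group. -/
lemma Subgroup.card_le_two_mul_card_conj {K : Type*} [Group K] [Finite K] {L : Subgroup K}
    (hL : L ≠ ⊥) (h : ∀ a b : K, ∀ l ∈ L, ∀ l' ∈ L, l ≠ 1 → a * l * a⁻¹ = b * l' * b⁻¹ →
      a⁻¹ * b ∈ L) :
    Nat.card K ≤ 2 * Nat.card {g : K // g ≠ 1 ∧ ∃ a, ∃ l ∈ L, g = a * l * a⁻¹} := by
  let f : (K ⧸ L) × {l : L // l ≠ 1} → {g : K // g ≠ 1 ∧ ∃ a, ∃ l ∈ L, g = a * l * a⁻¹} :=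
    fun q => ⟨q.1.out * q.2.1 * q.1.out⁻¹, by
      intro e
      refine q.2.2 (Subtype.ext ?_)
      have := (mul_inv_eq_one.1 e)
      simpa using this, q.1.out, q.2.1, q.2.1.2, rfl⟩
  have hf : Function.Injective f := by
    rintro ⟨a, l, hl⟩ ⟨b, m, hm⟩ e
    have e' : a.out * l * a.out⁻¹ = b.out * m * b.out⁻¹ := congrArg Subtype.val e
    have h1 := h _ _ l l.2 m m.2 (fun e => hl (Subtype.ext e)) e'
    have hab : a = b := by
      rw [← a.out_eq', ← b.out_eq']
      exact QuotientGroup.eq.2 h1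
    subst hab
    have : (l : K) = m := mul_left_cancel (mul_right_cancel e')
    simp [Subtype.ext_iff, this]
  have h1 := Nat.card_le_card_of_injective f hf
  rw [Nat.card_prod] at h1
  have h2 : Nat.card {l : L // l ≠ 1} + 1 = Nat.card L := by
    classical
    have := Fintype.ofFinite L
    rw [Nat.card_eq_fintype_card, Nat.card_eq_fintype_card, Fintype.card_subtype_compl]
    have : 0 < Fintype.card L := Fintype.card_pos
    simp
    omega
  have h3 := L.index_mul_card
  have h4 : 1 < Nat.card L := by
    rw [Finite.one_lt_card_iff_nontrivial]
    exact (nontrivial_iff_ne_bot L).2 hL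
  have h5 : Nat.card (K ⧸ L) = L.index := rfl
  rw [h5] at h1
  rw [← h2] at h3 h4
  have h6 : 1 ≤ Nat.card {l : L // l ≠ 1} := by omega
  have h7 : L.index ≤ L.index * Nat.card {l : L // l ≠ 1} := Nat.le_mul_of_pos_right _ h6
  rw [mul_add, mul_one] at h3
  omega

lemma Subgroup.exists_conj_eq {K : Type*} [Group K] [Finite K] {L M : Subgroup K}
    (hL : L ≠ ⊥) (h : ∀ a b : K, ∀ l ∈ L, ∀ l' ∈ L, l ≠ 1 → a * l * a⁻¹ = b * l' * b⁻¹ →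
      a⁻¹ * b ∈ L)
    (hM : M ≠ ⊥) (h' : ∀ a b : K, ∀ l ∈ M, ∀ l' ∈ M, l ≠ 1 → a * l * a⁻¹ = b * l' * b⁻¹ →
      a⁻¹ * b ∈ M) :
    ∃ a b : K, ∃ l ∈ L, ∃ m ∈ M, l ≠ 1 ∧ a * l * a⁻¹ = b * m * b⁻¹ := by
  by_contra hno
  push Not at hno
  have h1 := card_le_two_mul_card_conj hL h
  have h2 := card_le_two_mul_card_conj hM h'
  set A := {g : K // g ≠ 1 ∧ ∃ a, ∃ l ∈ L, g = a * l * a⁻¹}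
  set B := {g : K // g ≠ 1 ∧ ∃ a, ∃ l ∈ M, g = a * l * a⁻¹}
  let f : Option (A ⊕ B) → K := fun o => o.elim 1 (Sum.elim (fun a => a.1) (fun b => b.1))
  have hf : Function.Injective f := by
    have key : ∀ (a : A) (b : B), a.1 ≠ b.1 := by
      rintro ⟨c, h1, a, l, hl, e1⟩ ⟨d, h2, b, m, hm, e2⟩ e
      refine hno a b l hl m hm ?_ (e1.symm.trans (e.trans e2))
      rintro rfl
      exact h1 (by simpa using e1)
    rintro (_ | a | b) (_ | a' | b') e
    · rfl
    · exact absurd e.symm a'.2.1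
    · exact absurd e.symm b'.2.1
    · exact absurd e a.2.1
    · exact congrArg _ (congrArg _ (Subtype.ext e))
    · exact absurd e (key a b')
    · exact absurd e b.2.1
    · exact absurd e.symm (key a' b)
    · exact congrArg _ (congrArg _ (Subtype.ext e))
  have h3 := Nat.card_le_card_of_injective f hf
  rw [Finite.card_option, Nat.card_sum] at h3
  omega

/-- A nontrivial element of the kernel whose order is prime to the order of the point stabilizers
of the kernel. -/
structure IsRegElt {G S X : Type} [Group G] [Group S] [MulAction G X] (φ : G →* S) (x : X)
    (g : G) : Prop where
  mem : g ∈ φ.ker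
  ne_one : g ≠ 1
  coprime : (orderOf g).Coprime (Nat.card ↥(MulAction.stabilizer G x ⊓ φ.ker))

namespace MinCx

variable {G S X : Type} [Group G] [Group S] [MulAction G X] {φ : G →* S}
variable [Finite G] [Finite X] [IsSimpleGroup S] [Group.IsPerfect S]

lemma exists_isQuasi (h : MinCx X φ) (hna : ¬ HasAffine X φ) {x : X} {g : G}
    (hg : IsRegElt φ x g) :
    ∃ U, IsQuasi φ U ∧ U ≤ centralizer ((centralizer {g} ⊓ φ.ker : Subgroup G) : Set G) ∧
      ∀ U', IsQuasi φ U' → U' ≤ centralizer {g} → U' = U := by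
  have hC := h.isFull_centralizer hna hg.mem hg.ne_one hg.coprime
  set E := centralizer ((centralizer {g} ⊓ φ.ker : Subgroup G) : Set G)
  have hE : IsFull φ E := (h.isFull_centralizer_aux hna hg.mem hg.ne_one hg.coprime hC hC
    le_rfl).mono inf_le_right
  have hgL : g ∈ centralizer {g} ⊓ φ.ker :=
    mem_inf.2 ⟨mem_centralizer_singleton_iff.2 rfl, hg.mem⟩
  have hEg : E ≤ centralizer {g} := centralizer_le (by rwa [Set.singleton_subset_iff])
  have hcen : ∀ a ∈ E, a ∈ φ.ker → ∀ u ∈ E, a * u = u * a := fun a ha hk u hu =>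
    mem_centralizer_iff.1 hu a (mem_inf.2 ⟨hEg ha, hk⟩)
  have hle : ⁅E, E⁆ ≤ E := commutator_le.2 fun a ha b hb =>
    mul_mem (mul_mem (mul_mem ha hb) (inv_mem ha)) (inv_mem hb)
  refine ⟨⁅E, E⁆, IsQuasi.commutator_of_central hE hcen, hle, fun U hU hUC => ?_⟩
  have hUE : U ≤ E := (hU.le_of_full (h.isFull_centralizer_aux hna hg.mem hg.ne_one hg.coprime hC
    hU.full hUC) inf_le_left).trans inf_le_right
  have h1 := IsQuasi.commutator_le_of_central hcen hU.full hUE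
  have h2 := commutator_mono hUE hUE
  rw [hU.perfect] at h1 h2
  exact le_antisymm h2 h1

lemma isQuasi_unique (h : MinCx X φ) (hna : ¬ HasAffine X φ) {x : X} {g : G}
    (hg : IsRegElt φ x g) {U U' : Subgroup G} (hU : IsQuasi φ U) (hU' : IsQuasi φ U')
    (hc : U ≤ centralizer {g}) (hc' : U' ≤ centralizer {g}) : U = U' := by
  obtain ⟨W, -, -, hW⟩ := h.exists_isQuasi hna hg
  rw [hW U hU hc, hW U' hU' hc']

lemma not_ker_le_centralizer (h : MinCx X φ) (hcard : Nat.card X < Nat.card S) (x : X)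
    {U : Subgroup G} (hU : IsFull φ U) : ¬ ∀ g ∈ φ.ker, ∀ u ∈ U, g * u = u * g := by
  intro hc
  have h1 : Function.Injective fun u : U => (u : G) • x := by
    intro a b hab
    have h2 : ((b : G)⁻¹ * a) • x = x := by
      rw [mul_smul, show (a : G) • x = (b : G) • x from hab, inv_smul_smul]
    refine Subtype.ext (inv_mul_eq_one.1 (h.eq_one (g := (b : G)⁻¹ * a) fun y => ?_)).symm
    obtain ⟨k, hk, rfl⟩ := h.exists_ker_smul_eq x y
    rw [← mul_smul, ← hc k hk _ (mul_mem (inv_mem b.2) a.2), mul_smul, h2]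
  have h2 := Nat.card_le_card_of_injective _ h1
  have h3 := Nat.card_le_card_of_surjective _ hU.surjective_restrict
  omega

lemma le_normalizer_of_conj {U : Subgroup G} {g : G}
    (hg : U.map (MulAut.conj g).toMonoidHom = U) : ∀ u ∈ U, g * u * g⁻¹ ∈ U := fun u hu => by
  have : (MulAut.conj g).toMonoidHom u ∈ U.map (MulAut.conj g).toMonoidHom := mem_map_of_mem _ hu
  rw [hg] at this
  exact this

lemma coprime_ker_inf_centralizer (h : MinCx X φ) (hcard : Nat.card X < Nat.card S) {x : X} {g : G}
    (hg : IsRegElt φ x g) {U : Subgroup G} (hU : IsQuasi φ U) (hc : U ≤ centralizer {g}) :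
    (Nat.card ↥(centralizer (U : Set G) ⊓ φ.ker)).Coprime
      (Nat.card ↥(MulAction.stabilizer G x ⊓ φ.ker)) := by
  have hcen : centralizer (U : Set G) ≤ normalizer (U : Set G) := fun a ha =>
    mem_normalizer_of_forall fun u hu => by
      rw [← mem_centralizer_iff.1 ha u hu]; simpa using hu
  have hgU : g ∈ centralizer (U : Set G) := mem_centralizer_iff.2 fun u hu =>
    mem_centralizer_singleton_iff.1 (hc hu)
  refine Nat.Coprime.coprime_dvd_left (card_dvd_of_le (inf_le_inf_right φ.ker hcen))
    (h.centralizer_coprime hg.mem hg.ne_one hg.coprime (hU.full.mono le_normalizer) ?_ (hcen hgU))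
  intro ht
  refine h.not_ker_le_centralizer hcard x hU.full fun k hk => hU.commute_of_normalizes hk ?_
  exact fun u hu => conj_mem_of_mem_normalizer (ht ▸ mem_top k) hu

lemma isRegElt_of_mem {x : X} {L : Subgroup G} (hL : L ≤ φ.ker)
    (hc : (Nat.card L).Coprime (Nat.card ↥(MulAction.stabilizer G x ⊓ φ.ker))) {y : G}
    (hy : y ∈ L) (hy1 : y ≠ 1) : IsRegElt φ x y :=
  ⟨hL hy, hy1, Nat.Coprime.coprime_dvd_left (by
    rw [← L.orderOf_mk y hy]; exact orderOf_dvd_natCard _) hc⟩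

lemma map_conj_le_centralizer {U : Subgroup G} {y : G} (k : G)
    (hy : y ∈ centralizer (U : Set G)) :
    U.map (MulAut.conj k).toMonoidHom ≤ centralizer {k * y * k⁻¹} := by
  rintro _ ⟨u, hu, rfl⟩
  rw [mem_centralizer_singleton_iff]
  have := mem_centralizer_iff.1 hy u hu
  show k * u * k⁻¹ * (k * y * k⁻¹) = k * y * k⁻¹ * (k * u * k⁻¹)
  calc k * u * k⁻¹ * (k * y * k⁻¹) = k * (u * y) * k⁻¹ := by group
    _ = _ := by rw [this]; group

lemma map_conj_eq_of_conj_eq (h : MinCx X φ) (hna : ¬ HasAffine X φ)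
    (hcard : Nat.card X < Nat.card S) {x : X} {g : G}
    (hg : IsRegElt φ x g) {U U' : Subgroup G} (hU : IsQuasi φ U) (hc : U ≤ centralizer {g})
    (hU' : IsQuasi φ U') {a b l m : G} (hl : l ∈ centralizer (U : Set G) ⊓ φ.ker)
    (hm : m ∈ centralizer (U' : Set G) ⊓ φ.ker) (hl1 : l ≠ 1)
    (e : a * l * a⁻¹ = b * m * b⁻¹) :
    U.map (MulAut.conj a).toMonoidHom = U'.map (MulAut.conj b).toMonoidHom := by
  have hreg := isRegElt_of_mem inf_le_right (h.coprime_ker_inf_centralizer hcard hg hU hc) hl hl1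
  have hreg' : IsRegElt φ x (a * l * a⁻¹) :=
    ⟨(MonoidHom.normal_ker φ).conj_mem _ hreg.mem a, fun e => hl1 (by simpa using e), by
      have : orderOf (a * l * a⁻¹) = orderOf l :=
        orderOf_injective (MulAut.conj a).toMonoidHom (MulAut.conj a).injective l
      rw [this]; exact hreg.coprime⟩
  refine h.isQuasi_unique hna hreg' (hU.conj a) (hU'.conj b) (map_conj_le_centralizer a hl.1) ?_
  rw [e]
  exact map_conj_le_centralizer b hm.1

lemma trivial_intersection (h : MinCx X φ) (hna : ¬ HasAffine X φ)
    (hcard : Nat.card X < Nat.card S) {x : X} {g : G}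
    (hg : IsRegElt φ x g) {U : Subgroup G} (hU : IsQuasi φ U) (hc : U ≤ centralizer {g})
    {a b l m : G} (hl : l ∈ centralizer (U : Set G) ⊓ φ.ker)
    (hm : m ∈ centralizer (U : Set G) ⊓ φ.ker) (hl1 : l ≠ 1) (ha : a ∈ φ.ker) (hb : b ∈ φ.ker)
    (e : a * l * a⁻¹ = b * m * b⁻¹) : a⁻¹ * b ∈ centralizer (U : Set G) ⊓ φ.ker := by
  have h1 := h.map_conj_eq_of_conj_eq hna hcard hg hU hc hU hl hm hl1 e
  have hk : a⁻¹ * b ∈ φ.ker := mul_mem (inv_mem ha) hb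
  refine mem_inf.2 ⟨mem_centralizer_iff.2 fun u hu => ?_, hk⟩
  refine (hU.commute_of_normalizes hk (fun u hu => ?_) u hu).symm
  have h2 : (MulAut.conj b).toMonoidHom u ∈ U.map (MulAut.conj a).toMonoidHom := by
    rw [h1]; exact mem_map_of_mem _ hu
  obtain ⟨v, hv, ev⟩ := h2
  have ev' : a * v * a⁻¹ = b * u * b⁻¹ := ev
  have : a⁻¹ * b * u * (a⁻¹ * b)⁻¹ = v := by
    calc a⁻¹ * b * u * (a⁻¹ * b)⁻¹ = a⁻¹ * (b * u * b⁻¹) * a := by group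
      _ = v := by rw [← ev']; group
  rw [this]; exact hv

lemma exists_map_conj_eq (h : MinCx X φ) (hna : ¬ HasAffine X φ)
    (hcard : Nat.card X < Nat.card S) {x : X} {g g' : G}
    (hg : IsRegElt φ x g) {U U' : Subgroup G} (hU : IsQuasi φ U) (hc : U ≤ centralizer {g})
    (hg' : IsRegElt φ x g') (hU' : IsQuasi φ U') (hc' : U' ≤ centralizer {g'}) :
    ∃ a b : G, U.map (MulAut.conj a).toMonoidHom = U'.map (MulAut.conj b).toMonoidHom := by
  have hbot : ∀ {g : G} {U : Subgroup G}, IsRegElt φ x g → U ≤ centralizer {g} →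
      (centralizer (U : Set G) ⊓ φ.ker).subgroupOf φ.ker ≠ ⊥ := by
    intro g U hg hc hb
    have h1 : (⟨g, hg.mem⟩ : φ.ker) ∈ (centralizer (U : Set G) ⊓ φ.ker).subgroupOf φ.ker :=
      mem_subgroupOf.2 (mem_inf.2 ⟨mem_centralizer_iff.2 fun u hu =>
        mem_centralizer_singleton_iff.1 (hc hu), hg.mem⟩)
    rw [hb, mem_bot] at h1
    exact hg.ne_one (congrArg Subtype.val h1)
  obtain ⟨a, b, l, hl, m, hm, hl1, e⟩ := exists_conj_eq (hbot hg hc)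
    (fun a b l hl l' hl' hl1 e => h.trivial_intersection hna hcard hg hU hc hl hl'
      (fun e => hl1 (Subtype.ext e)) a.2 b.2 (congrArg Subtype.val e))
    (hbot hg' hc')
    (fun a b l hl l' hl' hl1 e => h.trivial_intersection hna hcard hg' hU' hc' hl hl'
      (fun e => hl1 (Subtype.ext e)) a.2 b.2 (congrArg Subtype.val e))
  exact ⟨a, b, h.map_conj_eq_of_conj_eq hna hcard hg hU hc hU' hl hm
    (fun e => hl1 (Subtype.ext e)) (congrArg Subtype.val e)⟩

/-- A minimal situation is of affine type. -/
theorem hasAffine (h : MinCx X φ) (hcard : Nat.card X < Nat.card S) : HasAffine X φ := by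
  by_contra hna
  have hne : Nonempty X := by
    by_contra hX
    rw [not_nonempty_iff] at hX
    exact h.not_fix_all (IsFull.top h.surj) fun g _ x => (hX.false x).elim
  obtain ⟨x⟩ := hne
  have hX1 : Nat.card X ≠ 1 := by
    intro h1
    obtain ⟨h2, -⟩ := Nat.card_eq_one_iff_unique.1 h1
    exact h.not_fix_all (IsFull.top h.surj) fun g _ x => Subsingleton.elim _ _
  have hsyl : ∀ r : ℕ, r.Prime → r ∣ Nat.card X → ∃ g U, IsRegElt φ x g ∧ IsQuasi φ U ∧
      U ≤ centralizer {g} ∧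
      r ^ (Nat.card φ.ker).factorization r ∣ Nat.card ↥(centralizer (U : Set G) ⊓ φ.ker) := by
    intro r hr hd
    have := Fact.mk hr
    obtain ⟨R, hRK, hcR⟩ := exists_sylow r φ.ker
    obtain ⟨-, z, hz, hz1, hcz, hcop⟩ := h.isFull_centralizer_sylow hna x hd hRK hcR
    have hreg := isRegElt_of_mem hRK hcop hz hz1
    obtain ⟨U, hU, hUc, -⟩ := h.exists_isQuasi hna hreg
    have hRz : R ≤ centralizer {z} ⊓ φ.ker := fun l hl =>
      mem_inf.2 ⟨mem_centralizer_singleton_iff.2 (hcz l hl).symm, hRK hl⟩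
    refine ⟨z, U, hreg, hU, hUc.trans (centralizer_le ?_), ?_⟩
    · rw [Set.singleton_subset_iff]; exact hRz hz
    · rw [← hcR]
      refine card_dvd_of_le fun l hl => mem_inf.2 ⟨mem_centralizer_iff.2 fun u hu => ?_, hRK hl⟩
      exact (mem_centralizer_iff.1 (hUc hu) l (hRz hl)).symm
  obtain ⟨r, hr, hrd⟩ := Nat.exists_prime_and_dvd hX1
  obtain ⟨g, U, hg, hU, hc, -⟩ := hsyl r hr hrd
  have hcop := h.coprime_ker_inf_centralizer hcard hg hU hc
  set L := centralizer (U : Set G) ⊓ φ.ker with hL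
  have hLK : L ≤ φ.ker := inf_le_right
  have hdvd : Nat.card X ∣ Nat.card L := by
    rw [Nat.dvd_iff_prime_pow_dvd_dvd]
    intro p k hp hk
    rcases Nat.eq_zero_or_pos k with rfl | hk0
    · simp
    obtain ⟨g', U', hg', hU', hc', hd'⟩ := hsyl p hp ((dvd_pow_self p hk0.ne').trans hk)
    have h1 : p ^ k ∣ p ^ (Nat.card φ.ker).factorization p := by
      refine pow_dvd_pow p ((hp.pow_dvd_iff_le_factorization Nat.card_pos.ne').1 ?_)
      exact hk.trans (Dvd.intro _ (h.card_mul_card_stabilizer x))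
    refine h1.trans (hd'.trans (dvd_of_eq ?_))
    obtain ⟨a, b, e⟩ := h.exists_map_conj_eq hna hcard hg' hU' hc' hg hU hc
    have key : ∀ (a : G) (U : Subgroup G),
        Nat.card ↥(centralizer ((U.map (MulAut.conj a).toMonoidHom : Subgroup G) : Set G) ⊓ φ.ker)
          = Nat.card ↥(centralizer (U : Set G) ⊓ φ.ker) := by
      intro a U
      have : centralizer ((U.map (MulAut.conj a).toMonoidHom : Subgroup G) : Set G) ⊓ φ.ker
          = (centralizer (U : Set G) ⊓ φ.ker).map (MulAut.conj a).toMonoidHom := by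
        ext y
        constructor
        · intro hy
          refine ⟨a⁻¹ * y * a, mem_inf.2 ⟨mem_centralizer_iff.2 fun u hu => ?_, ?_⟩, ?_⟩
          · have : a * u * a⁻¹ * y = y * (a * u * a⁻¹) :=
              mem_centralizer_iff.1 hy.1 _ (mem_map_of_mem (MulAut.conj a).toMonoidHom hu)
            calc u * (a⁻¹ * y * a) = a⁻¹ * (a * u * a⁻¹ * y) * a := by group
              _ = _ := by rw [this]; group
          · simpa using (MonoidHom.normal_ker φ).conj_mem y hy.2 a⁻¹
          · show a * (a⁻¹ * y * a) * a⁻¹ = y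
            group
        · rintro ⟨y, hy, rfl⟩
          refine mem_inf.2 ⟨mem_centralizer_iff.2 ?_, (MonoidHom.normal_ker φ).conj_mem y hy.2 a⟩
          intro u hu
          exact mem_centralizer_singleton_iff.1 (map_conj_le_centralizer a hy.1 hu)
      rw [this]
      exact (Nat.card_congr (equivMapOfInjective _ _ (MulAut.conj a).injective).toEquiv).symm
    rw [← key a U', e, key b U]
  have hcL : Nat.card L = Nat.card X :=
    le_antisymm (Nat.card_le_card_of_injective _ (h.smul_injective hLK hcop x))
      (Nat.le_of_dvd Nat.card_pos hdvd)
  have hUN : U ≤ normalizer (L : Set G) := fun u hu => mem_normalizer_of_forall fun l hl => by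
    rw [mem_centralizer_iff.1 hl.1 u hu]; simpa using hl
  have hLn := h.normal_of_card hLK hcop hcL (hU.full.mono hUN)
  have hgL : g ∈ L := mem_inf.2 ⟨mem_centralizer_iff.2 fun u hu =>
    mem_centralizer_singleton_iff.1 (hc hu), hg.mem⟩
  refine h.not_ker_le_centralizer hcard x hU.full fun k hk => hU.commute_of_normalizes hk ?_
  refine le_normalizer_of_conj (h.isQuasi_unique hna hg (hU.conj k) hU ?_ hc)
  have h1 := map_conj_le_centralizer k (hLn.conj_mem g hgL k⁻¹).1
  have h2 : k * (k⁻¹ * g * k⁻¹⁻¹) * k⁻¹ = g := by group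
  rwa [h2] at h1

end MinCx

/-- A faithful action of `H` on an elementary abelian group `V`, minimal in that `H` has no proper
subgroup mapped onto `S` and no nontrivial action on a group smaller than `V`. -/
structure IsMinAction {H S : Type} [Group H] [Group S] (π : H →* S) (V : Type) [AddCommGroup V]
    [DistribMulAction H V] : Prop where
  surj : Function.Surjective π
  nontrivial : Nontrivial V
  faithful : ∀ g : H, (∀ v : V, g • v = v) → g = 1
  min : ∀ F : Subgroup H, IsFull π F → F = ⊤
  triv : ∀ (A : Type) [Group A] [Finite A] (ψ : H →* MulAut A), Nat.card A < Nat.card V →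
    ∀ g, ψ g = 1
  coprime : (Nat.card V).Coprime (Nat.card π.ker)
  exponent : ∃ r : ℕ, r.Prime ∧ ∀ v : V, r • v = 0

namespace IsMinAction

variable {H S V : Type} [Group H] [Group S] [AddCommGroup V] [DistribMulAction H V] {π : H →* S}
variable [Finite H] [Finite V] [IsSimpleGroup S] [Group.IsPerfect S]

lemma commutator_top (h : IsMinAction π V) : ⁅(⊤ : Subgroup H), (⊤ : Subgroup H)⁆ = ⊤ :=
  h.min _ (IsFull.commutator (IsFull.top h.surj) (IsFull.top h.surj))

lemma smul_eq_of_card (h : IsMinAction π V) {A : Type} [AddCommGroup A] [Finite A]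
    [DistribMulAction H A] (hA : Nat.card A < Nat.card V) (g : H) (a : A) : g • a = a := by
  have := h.triv (Multiplicative A)
    ((MulAutMultiplicative A).symm.toMonoidHom.comp (DistribMulAction.toAddAut H A)) hA g
  exact congrArg (fun e : MulAut (Multiplicative A) => (e (Multiplicative.ofAdd a)).toAdd) this

lemma smul_eq_of_invariant (h : IsMinAction π V) {W : AddSubgroup V}
    (hW : ∀ g : H, ∀ w ∈ W, g • w ∈ W) (hne : W ≠ ⊤) (g : H) {w : V} (hw : w ∈ W) :
    g • w = w := by
  let _ : DistribMulAction H W :=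
    { smul := fun g w => ⟨g • (w : V), hW g w w.2⟩
      one_smul := fun w => Subtype.ext (one_smul H (w : V))
      mul_smul := fun a b w => Subtype.ext (mul_smul a b (w : V))
      smul_zero := fun g => Subtype.ext (smul_zero g)
      smul_add := fun g a b => Subtype.ext (smul_add g (a : V) (b : V)) }
  have hc : Nat.card W < Nat.card V := by
    refine lt_of_le_of_ne (Nat.card_le_card_of_injective _ W.subtype_injective) fun e => hne ?_
    exact AddSubgroup.eq_top_of_card_eq W e
  exact congrArg Subtype.val (h.smul_eq_of_card hc g (⟨w, hw⟩ : W))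

lemma smul_sub_mem_of_invariant (h : IsMinAction π V) {W : AddSubgroup V}
    (hW : ∀ g : H, ∀ w ∈ W, g • w ∈ W) (hne : W ≠ ⊥) (g : H) (v : V) : g • v - v ∈ W := by
  let f : H → (V ⧸ W →+ V ⧸ W) := fun g =>
    QuotientAddGroup.map W W (DistribSMul.toAddMonoidHom V g) (fun w hw => hW g w hw)
  let _ : DistribMulAction H (V ⧸ W) :=
    { smul := fun g q => f g q
      one_smul := by
        rintro ⟨v⟩
        exact congrArg (QuotientAddGroup.mk' W) (one_smul H v)
      mul_smul := by
        rintro a b ⟨v⟩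
        exact congrArg (QuotientAddGroup.mk' W) (mul_smul a b v)
      smul_zero := fun g => map_zero (f g)
      smul_add := fun g => map_add (f g) }
  have hc : Nat.card (V ⧸ W) < Nat.card V := by
    rw [AddSubgroup.card_eq_card_quotient_mul_card_addSubgroup W]
    refine lt_mul_of_one_lt_right Nat.card_pos ?_
    have := (AddSubgroup.nontrivial_iff_ne_bot W).2 hne
    exact Finite.one_lt_card
  have : ((g • v : V) : V ⧸ W) = (v : V ⧸ W) := h.smul_eq_of_card hc g (v : V ⧸ W)
  have h2 := (QuotientAddGroup.eq_iff_sub_mem).1 this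
  exact h2

lemma irreducible (h : IsMinAction π V) {W : AddSubgroup V}
    (hW : ∀ g : H, ∀ w ∈ W, g • w ∈ W) (hne : W ≠ ⊥) : W = ⊤ := by
  by_contra hnt
  have key : ∀ a b : H, a * b = b * a := by
    have key2 : ∀ (a b : H) (v : V), a • b • v = a • v + b • v - v := fun a b v => by
      have := h.smul_eq_of_invariant hW hnt a (h.smul_sub_mem_of_invariant hW hne b v)
      rw [smul_sub] at this
      rw [← sub_eq_zero] at this ⊢
      rw [← this]; abel
    intro a b
    have : (b * a)⁻¹ * (a * b) = 1 := h.faithful _ fun v => by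
      rw [mul_smul, mul_smul, inv_smul_eq_iff, mul_smul, key2, key2, add_comm]
    rw [inv_mul_eq_one] at this
    exact this.symm
  have h1 : ⁅(⊤ : Subgroup H), (⊤ : Subgroup H)⁆ ≤ ⊥ := commutator_le.2 fun a _ b _ => by
    rw [mem_bot, commutatorElement_eq_one_iff_mul_comm, key]
  rw [h.commutator_top] at h1
  obtain ⟨s, hs⟩ := exists_ne (1 : S)
  obtain ⟨g, rfl⟩ := h.surj s
  have : g = 1 := mem_bot.1 (h1 (mem_top g))
  exact hs (by rw [this, map_one])

lemma injective_of_commute (h : IsMinAction π V) {d : V →+ V} (hd : ∀ (g : H) v, d (g • v) = g • d v)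
    (hne : d ≠ 0) : Function.Injective d := by
  rw [injective_iff_map_eq_zero]
  by_contra hno
  push Not at hno
  obtain ⟨v, hv, hv0⟩ := hno
  refine hne ?_
  have := h.irreducible (W := d.ker) (fun g w hw => by
    rw [AddMonoidHom.mem_ker] at hw ⊢
    rw [hd, hw, smul_zero]) (by
      intro hb
      exact hv0 ((AddSubgroup.mem_bot).1 (hb ▸ hv)))
  ext w
  exact AddMonoidHom.mem_ker.1 (this ▸ AddSubgroup.mem_top w)

lemma eq_zero_of_nsmul (h : IsMinAction π V) {B : Subgroup H} (hB : B ≤ π.ker) {v : V}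
    (hv : Nat.card B • v = 0) : v = 0 := by
  have h1 := addOrderOf_dvd_of_nsmul_eq_zero hv
  have h2 : addOrderOf v ∣ Nat.card V := addOrderOf_dvd_natCard v
  exact AddMonoid.addOrderOf_eq_one_iff.1
    (Nat.eq_one_of_dvd_coprimes h.coprime h2 (h1.trans (card_dvd_of_le hB)))

/-- An abelian subgroup of the kernel has a regular orbit. -/
lemma card_lt_of_comm (h : IsMinAction π V) {B : Subgroup H} (hB : B ≤ π.ker)
    (hc : ∀ a ∈ B, ∀ b ∈ B, a * b = b * a) : Nat.card B < Nat.card V := by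
  classical
  have := h.nontrivial
  obtain ⟨v, hv⟩ := Finite.exists_min
    (fun v : V => Nat.card ↥(B ⊓ MulAction.stabilizer H v))
  set B1 := B ⊓ MulAction.stabilizer H v with hB1
  have hB1K : B1 ≤ π.ker := inf_le_left.trans hB
  have hbot : B1 = ⊥ := by
    by_contra hne
    obtain ⟨b, hb, hb1⟩ := B1.bot_or_exists_ne_one.resolve_left hne
    obtain ⟨u, hu⟩ : ∃ u : V, b • u ≠ u := by
      by_contra hno
      push Not at hno
      exact hb1 (h.faithful b hno)
    have := Fintype.ofFinite B1
    let N : V → V := fun w => ∑ c : B1, (c : H) • w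
    have hNfix : ∀ w, (∀ c ∈ B1, c • w = w) → N w = (Nat.card B1) • w := by
      intro w hw
      show ∑ c : B1, (c : H) • w = _
      rw [Finset.sum_congr rfl fun (c : B1) _ => hw (c : H) c.2, Finset.sum_const, Finset.card_univ,
        Nat.card_eq_fintype_card]
    have hfixN : ∀ w, ∀ c ∈ B1, c • N w = N w := by
      intro w c hcc
      show c • ∑ e : B1, (e : H) • w = _
      rw [Finset.smul_sum]
      refine Fintype.sum_equiv (Equiv.mulLeft (⟨c, hcc⟩ : B1)) _ _ fun e => ?_
      simp [mul_smul]
    have hNadd : ∀ w w', N (w + w') = N w + N w' := fun w w' => by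
      show ∑ c : B1, (c : H) • (w + w') = _
      simp only [smul_add, Finset.sum_add_distrib]; rfl
    let Nh : V →+ V := AddMonoidHom.mk' N hNadd
    have hNh : ∀ w, Nh w = N w := fun _ => rfl
    have hNb : ∀ c ∈ B, ∀ w, N (c • w) = c • N w := by
      intro c hcB w
      show ∑ e : B1, (e : H) • c • w = c • ∑ e : B1, (e : H) • w
      rw [Finset.smul_sum]
      refine Finset.sum_congr rfl fun e _ => ?_
      rw [← mul_smul, ← mul_smul, hc _ e.2.1 _ hcB]
    set m := Nat.card B1
    set v' := m • u - N u
    have hNv' : N v' = 0 := by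
      rw [← hNh, map_sub, map_nsmul, hNh, hNh, hNfix _ (hfixN u), sub_self]
    have hbv' : b • v' ≠ v' := by
      intro e
      rw [smul_sub, hfixN u b hb, sub_left_inj, smul_comm b m u] at e
      rw [← sub_eq_zero, ← smul_sub] at e
      exact hu (sub_eq_zero.1 (h.eq_zero_of_nsmul hB1K e))
    have hle : B ⊓ MulAction.stabilizer H (v + v') ≤ B1 ⊓ MulAction.stabilizer H v' := by
      intro c hcm
      have hcB : c ∈ B := hcm.1
      have hcs : c • (v + v') = v + v' := hcm.2
      have h1 : N (v + v') = m • v := by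
        rw [hNadd, hNv', add_zero, hNfix v fun c hc => hc.2]
      have h2 : c • (m • v) = m • v := by
        rw [← h1, ← hNb c hcB, hcs]
      rw [smul_comm c m v, ← sub_eq_zero, ← smul_sub] at h2
      have h3 := sub_eq_zero.1 (h.eq_zero_of_nsmul hB1K h2)
      refine mem_inf.2 ⟨mem_inf.2 ⟨hcB, h3⟩, ?_⟩
      rw [smul_add, h3] at hcs
      exact add_left_cancel hcs
    have hlt : Nat.card ↥(B ⊓ MulAction.stabilizer H (v + v')) < Nat.card B1 := by
      refine lt_of_le_of_lt (Nat.card_le_card_of_injective _ (inclusion_injective hle)) ?_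
      refine lt_of_le_of_ne (Nat.card_le_card_of_injective _ (inclusion_injective inf_le_left)) ?_
      intro e
      have := eq_of_le_of_card_ge (inf_le_left : B1 ⊓ MulAction.stabilizer H v' ≤ B1) e.ge
      exact hbv' (this.ge hb).2
    exact absurd (hv (v + v')) (not_le.2 hlt)
  by_cases hv0 : v = 0
  · have : B = ⊥ := by
      rw [← hbot, hB1, hv0]
      exact (inf_eq_left.2 fun b _ => smul_zero b).symm
    rw [this, card_bot]
    exact Finite.one_lt_card
  · have hinj : Function.Injective (fun o : Option B => o.elim (0 : V) fun b => (b : H) • v) := by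
      rintro (_ | a) (_ | b) e
      · rfl
      · exact absurd (smul_eq_zero_iff_eq (b : H) |>.1 e.symm) hv0
      · exact absurd (smul_eq_zero_iff_eq (a : H) |>.1 e) hv0
      · have e : (a : H) • v = (b : H) • v := e
        have : (b : H)⁻¹ * a ∈ B1 := mem_inf.2 ⟨mul_mem (inv_mem b.2) a.2, by
          rw [MulAction.mem_stabilizer_iff, mul_smul, e, inv_smul_smul]⟩
        rw [hbot, mem_bot, inv_mul_eq_one] at this
        exact congrArg some (Subtype.ext this.symm)
    have := Nat.card_le_card_of_injective _ hinj
    rw [Finite.card_option] at this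
    omega

lemma le_center_of_card (h : IsMinAction π V) {B : Subgroup H} [B.Normal]
    (hc : Nat.card B < Nat.card V) : B ≤ center H := by
  intro b hb
  rw [mem_center_iff]
  intro g
  have := congrArg (fun e : MulAut B => (e ⟨b, hb⟩ : H)) (h.triv B MulAut.conjNormal hc g)
  simp only [MulAut.conjNormal_apply, MulAut.one_apply] at this
  exact mul_inv_eq_iff_eq_mul.1 this

lemma isNilpotent_ker (h : IsMinAction π V) : Group.IsNilpotent π.ker := by
  refine ((Group.isNilpotent_of_finite_tfae (G := π.ker)).out 0 3).2 ?_
  intro p hp P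
  have hQ : (P : Subgroup π.ker).map π.ker.subtype ≤ ⊤ ⊓ π.ker :=
    le_inf le_top (map_subtype_le _)
  have hc : Nat.card ↥((P : Subgroup π.ker).map π.ker.subtype)
      = p ^ (Nat.card ↥((⊤ : Subgroup H) ⊓ π.ker)).factorization p := by
    rw [top_inf_eq, ← P.card_eq_multiplicity]
    exact Nat.card_congr (equivMapOfInjective _ _ π.ker.subtype_injective).symm.toEquiv
  have := h.min _ (((IsFull.top h.surj).normalizer hQ hc).mono inf_le_left)
  rw [normalizer_eq_top_iff] at this
  have h2 := this.comap π.ker.subtype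
  rwa [comap_map_eq_self_of_injective π.ker.subtype_injective] at h2

end IsMinAction

lemma Subgroup.exists_commutator_le_of_isNilpotent {H : Type*} [Group H] {K Z : Subgroup H}
    [Group.IsNilpotent K] (hZ : ¬ K ≤ Z) :
    ∃ x ∈ K, x ∉ Z ∧ ∀ y ∈ K, ⁅x, y⁆ ∈ Z := by
  classical
  have hex : ∃ n, (⊤ : Subgroup K).lowerCentralSeries n ≤ Z.subgroupOf K := by
    obtain ⟨n, hn⟩ := nilpotent_iff_lowerCentralSeries.1 (inferInstance : Group.IsNilpotent K)
    exact ⟨n, hn ▸ bot_le⟩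
  have hn0 : Nat.find hex ≠ 0 := by
    intro e
    have := Nat.find_spec hex
    rw [e, lowerCentralSeries_zero] at this
    exact hZ fun k hk => mem_subgroupOf.1 (this (mem_top (⟨k, hk⟩ : K)))
  obtain ⟨m, hm⟩ := Nat.exists_eq_succ_of_ne_zero hn0
  have h1 := Nat.find_min hex (m := m) (by omega)
  have h2 := Nat.find_spec hex
  rw [hm] at h2
  obtain ⟨x, hx, hxZ⟩ := SetLike.not_le_iff_exists.1 h1
  refine ⟨x, x.2, fun hh => hxZ (mem_subgroupOf.2 hh), fun y hy => ?_⟩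
  exact mem_subgroupOf.1 (h2 (commutator_mem_commutator hx (mem_top (⟨y, hy⟩ : K))))

namespace IsMinAction

variable {H S V : Type} [Group H] [Group S] [AddCommGroup V] [DistribMulAction H V] {π : H →* S}
variable [Finite H] [Finite V] [IsSimpleGroup S] [Group.IsPerfect S]

lemma eq_of_smul_eq (h : IsMinAction π V) {a b : H} (hab : ∀ v : V, a • v = b • v) : a = b := by
  have := h.faithful (b⁻¹ * a) fun v => by rw [mul_smul, hab, inv_smul_smul]
  exact (inv_mul_eq_one.1 this).symm

/-- Representatives of elements separated by a central commutator pairing are linearly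
independent over the commuting ring of the action. -/
lemma eq_zero_of_sum (h : IsMinAction π V) {ι : Type} {Q : Subgroup H} (x : ι → H)
    (hx : ∀ i, x i ∈ Q) (hcen : ∀ a ∈ Q, ∀ b ∈ Q, ⁅a, b⁆ ∈ center H)
    (hsep : ∀ i j, (∀ y ∈ Q, ⁅y, x i⁆ = ⁅y, x j⁆) → i = j) (s : Finset ι) :
    ∀ d : ι → V →+ V, (∀ i (g : H) v, d i (g • v) = g • d i v) →
      (∀ v, ∑ i ∈ s, d i (x i • v) = 0) → ∀ i ∈ s, d i = 0 := by
  classical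
  induction s using Finset.induction_on with
  | empty => simp
  | insert j s hj ih =>
    intro d hd hsum
    simp only [Finset.sum_insert hj] at hsum
    have hconj : ∀ y ∈ Q, ∀ i (v : V), y • x i • y⁻¹ • v = ⁅y, x i⁆ • x i • v := by
      intro y _ i v
      simp only [← mul_smul]
      congr 1
      rw [commutatorElement_def]; group
    have hd0 : ∀ i ∈ s, d i = 0 := by
      intro i hi
      by_contra hne
      refine hj ((hsep i j fun y hy => h.eq_of_smul_eq fun v => ?_) ▸ hi)
      have hc : ∀ k (g : H), g * ⁅y, x k⁆ = ⁅y, x k⁆ * g := fun k g =>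
        mem_center_iff.1 (hcen y hy _ (hx k)) g
      let d' : ι → V →+ V := fun k => (d k).comp
        (DistribSMul.toAddMonoidHom V ⁅y, x k⁆ - DistribSMul.toAddMonoidHom V ⁅y, x j⁆)
      have hd' : ∀ k v, d' k v = ⁅y, x k⁆ • d k v - ⁅y, x j⁆ • d k v := fun k v => by
        show d k (⁅y, x k⁆ • v - ⁅y, x j⁆ • v) = _
        rw [map_sub, hd, hd]
      have h0 := ih d' (fun k g v => by
        rw [hd', hd', hd, smul_sub, ← mul_smul, ← mul_smul, ← mul_smul, ← mul_smul, hc, hc])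
        (fun v => by
          have e1 := hsum (y⁻¹ • v)
          have e2 := hsum v
          have e1' : y • (d j (x j • y⁻¹ • v) + ∑ i ∈ s, d i (x i • y⁻¹ • v)) = 0 := by
            rw [e1, smul_zero]
          rw [smul_add, Finset.smul_sum] at e1'
          simp only [← hd, hconj y hy] at e1'
          have e2' : ⁅y, x j⁆ • (d j (x j • v) + ∑ i ∈ s, d i (x i • v)) = 0 := by
            rw [e2, smul_zero]
          rw [smul_add, Finset.smul_sum] at e2'
          simp only [← hd] at e2'
          have e3 := e1'.trans e2'.symm
          rw [add_right_inj, ← sub_eq_zero, ← Finset.sum_sub_distrib] at e3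
          rw [← e3]
          refine Finset.sum_congr rfl fun k _ => ?_
          rw [hd', hd k ⁅y, x k⁆, hd k ⁅y, x j⁆]) i hi
      have h1 : d i (⁅y, x i⁆ • v) = d i (⁅y, x j⁆ • v) := by
        have := congrArg (fun f : V →+ V => f v) h0
        simp only [hd', AddMonoidHom.zero_apply] at this
        rw [hd, hd]
        exact sub_eq_zero.1 this
      exact h.injective_of_commute (hd i) hne h1
    intro i hi
    rcases Finset.mem_insert.1 hi with rfl | hi
    · ext v
      have := hsum ((x i)⁻¹ • v)
      rw [Finset.sum_eq_zero fun k hk => by rw [hd0 k hk]; rfl, add_zero, smul_inv_smul] at this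
      exact this
    · exact hd0 i hi

/-- If the separated family is as large as `V`, then `H` is small. -/
lemma card_le_of_card_le (h : IsMinAction π V) {ι : Type} [Finite ι] {Q : Subgroup H} (x : ι → H)
    (hx : ∀ i, x i ∈ Q) (hcen : ∀ a ∈ Q, ∀ b ∈ Q, ⁅a, b⁆ ∈ center H)
    (hsep : ∀ i j, (∀ y ∈ Q, ⁅y, x i⁆ = ⁅y, x j⁆) → i = j) (hι : Nat.card V ≤ Nat.card ι) :
    Nat.card H ≤ 65536 := by
  classical
  obtain ⟨r, hr, hrV⟩ := h.exponent
  have := Fact.mk hr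
  have := Fintype.ofFinite ι
  have : Module (ZMod r) V := AddCommGroup.zmodModule hrV
  let e : H → (V →ₗ[ZMod r] V) := fun g =>
    (DistribSMul.toAddMonoidHom V g).toZModLinearMap r
  have he : ∀ (g : H) (v : V), e g v = g • v := fun _ _ => rfl
  have hli : LinearIndependent (ZMod r) fun i => e (x i) := by
    rw [Fintype.linearIndependent_iff]
    intro c hc i
    have h0 := h.eq_zero_of_sum x hx hcen hsep Finset.univ
      (fun i => ((c i • LinearMap.id : V →ₗ[ZMod r] V) : V →+ V)) (fun i g v => by
        show c i • g • v = g • c i • v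
        rw [← he, ← he, map_smul]) (fun v => by
        have := congrArg (fun f : V →ₗ[ZMod r] V => f v) hc
        simpa [he, LinearMap.sum_apply] using this) i (Finset.mem_univ i)
    have := h.nontrivial
    obtain ⟨v, hv⟩ := exists_ne (0 : V)
    have h1 : c i • v = 0 := congrArg (fun f : V →+ V => f v) h0
    exact (smul_eq_zero.1 h1).resolve_right hv
  have h1 := hli.fintype_card_le_finrank
  rw [Module.finrank_linearMap] at h1
  set d := Module.finrank (ZMod r) V with hd
  have h2 : Nat.card V = r ^ d := by
    rw [Module.natCard_eq_pow_finrank (K := ZMod r), Nat.card_zmod]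
  rw [← Nat.card_eq_fintype_card] at h1
  have h3 : 2 ^ d ≤ r ^ d := Nat.pow_le_pow_left hr.two_le d
  have h4 : d ≤ 4 := by
    by_contra hlt
    push Not at hlt
    have : d * d < 2 ^ d := by
      clear_value d
      clear h3 h2 h1 hd
      induction d, hlt using Nat.le_induction with
      | base => norm_num
      | succ n hn ih => rw [pow_succ]; nlinarith
    omega
  have h5 : r ^ d ≤ 16 := by nlinarith
  have : Finite (V →ₗ[ZMod r] V) := Module.finite_of_finite (ZMod r)
  have h6 : Nat.card H ≤ Nat.card (V →ₗ[ZMod r] V) :=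
    Nat.card_le_card_of_injective e fun a b hab => h.eq_of_smul_eq fun v => by
      rw [← he, ← he, hab]
  rw [Module.natCard_eq_pow_finrank (K := ZMod r) (V := V →ₗ[ZMod r] V), Nat.card_zmod,
    Module.finrank_linearMap, ← hd,
    pow_mul] at h6
  calc Nat.card H ≤ (r ^ d) ^ d := h6
    _ ≤ 16 ^ 4 := (Nat.pow_le_pow_left h5 d).trans (Nat.pow_le_pow_right (by norm_num) h4)
    _ = 65536 := by norm_num

theorem ker_le_center (h : IsMinAction π V) (hS : 65536 < Nat.card S) : π.ker ≤ center H := by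
  by_contra hK
  have := h.isNilpotent_ker
  set Z := π.ker ⊓ center H with hZ
  obtain ⟨x₀, hx₀K, hx₀Z, hx₀⟩ := exists_commutator_le_of_isNilpotent (K := π.ker) (Z := Z)
    fun hle => hK (hle.trans inf_le_right)
  set q := QuotientGroup.mk' Z
  set M := π.ker.map q with hM
  have : M.Normal := (inferInstance : π.ker.Normal).map q (QuotientGroup.mk'_surjective Z)
  set W := M ⊓ centralizer (M : Set (H ⧸ Z)) with hW
  set Q := W.comap q with hQ
  have hZq : ∀ g, q g = 1 ↔ g ∈ Z := fun g => QuotientGroup.eq_one_iff g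
  have hQK : Q ≤ π.ker := by
    intro g hg
    obtain ⟨k, hk, e⟩ := mem_map.1 (mem_inf.1 (mem_comap.1 hg)).1
    have : k⁻¹ * g ∈ Z := by
      rw [← hZq, map_mul, map_inv, e, inv_mul_cancel]
    have h2 := mul_mem hk this.1
    rwa [mul_inv_cancel_left] at h2
  have hQZ : ∀ a ∈ Q, ∀ b ∈ π.ker, ⁅b, a⁆ ∈ Z := by
    intro a ha b hb
    rw [← hZq, map_commutatorElement, commutatorElement_eq_one_iff_mul_comm]
    exact mem_centralizer_iff.1 (mem_inf.1 (mem_comap.1 ha)).2 _ (mem_map_of_mem q hb)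
  have hx₀Q : x₀ ∈ Q := by
    refine mem_comap.2 (mem_inf.2 ⟨mem_map_of_mem q hx₀K, mem_centralizer_iff.2 ?_⟩)
    rintro _ ⟨y, hy, rfl⟩
    have := (hZq _).2 (hx₀ y hy)
    rw [map_commutatorElement, commutatorElement_eq_one_iff_mul_comm] at this
    exact this.symm
  have hWcard : Nat.card V ≤ Nat.card W := by
    by_contra hlt
    rw [not_le] at hlt
    have h1 : ⁅Q, (⊤ : Subgroup H)⁆ ≤ center H := by
      refine commutator_le.2 fun a ha g _ => ?_
      have := congrArg (fun e : MulAut W => (e ⟨q a, ha⟩ : H ⧸ Z))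
        (h.triv W (MulAut.conjNormal.comp q) hlt g)
      simp only [MonoidHom.comp_apply, MulAut.conjNormal_apply, MulAut.one_apply] at this
      refine ((hZq _).1 ?_).2
      rw [map_commutatorElement, commutatorElement_eq_one_iff_mul_comm]
      exact (mul_inv_eq_iff_eq_mul.1 this).symm
    have h2 : ⁅⁅Q, (⊤ : Subgroup H)⁆, (⊤ : Subgroup H)⁆ = ⊥ := by
      rw [commutator_eq_bot_iff_le_centralizer, coe_top]
      simpa [centralizer_univ] using h1
    have h3 : ⁅⁅(⊤ : Subgroup H), (⊤ : Subgroup H)⁆, Q⁆ = ⊥ :=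
      commutator_commutator_eq_bot_of_rotate (by rw [commutator_comm ⊤ Q]; exact h2) h2
    rw [h.commutator_top, commutator_comm, commutator_eq_bot_iff_le_centralizer, coe_top,
      centralizer_univ] at h3
    exact hx₀Z (mem_inf.2 ⟨hx₀K, h3 hx₀Q⟩)
  have hcent : Q ⊓ centralizer (Q : Set H) ≤ Z := by
    have : Q.Normal := inferInstance
    refine le_inf (inf_le_left.trans hQK) (h.le_center_of_card (h.card_lt_of_comm
      (inf_le_left.trans hQK) fun a ha b hb => ?_))
    exact (mem_centralizer_iff.1 ha.2 b hb.1).symm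
  have hout : ∀ w : W, ∃ g : H, q g = w := fun w => QuotientGroup.mk'_surjective Z w
  choose x hx using hout
  have hxQ : ∀ w, x w ∈ Q := fun w => mem_comap.2 (by rw [hx]; exact w.2)
  have := h.card_le_of_card_le x hxQ (fun a ha b hb => (hQZ b hb a (hQK ha)).2)
    (fun i j hij => by
      refine Subtype.ext ?_
      rw [← hx, ← hx, ← inv_mul_eq_one, ← map_inv, ← map_mul, hZq]
      refine hcent (mem_inf.2 ⟨mul_mem (inv_mem (hxQ i)) (hxQ j), ?_⟩)
      rw [mem_centralizer_iff]
      intro y hy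
      have e1 := hij y hy
      have ei : y * x i * y⁻¹ = ⁅y, x i⁆ * x i := by rw [commutatorElement_def]; group
      have ej : y * x j * y⁻¹ = ⁅y, x i⁆ * x j := by rw [e1, commutatorElement_def]; group
      rw [← mul_inv_eq_iff_eq_mul]
      calc y * ((x i)⁻¹ * x j) * y⁻¹ = (y * x i * y⁻¹)⁻¹ * (y * x j * y⁻¹) := by group
        _ = (x i)⁻¹ * x j := by rw [ei, ej]; group) hWcard
  have h2 := Nat.card_le_card_of_surjective π h.surj
  omega

end IsMinAction

namespace MinCx

variable {G S X : Type} [Group G] [Group S] [MulAction G X] {φ : G →* S}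
variable [Finite G] [Finite X] [IsSimpleGroup S] [Group.IsPerfect S]

lemma nonempty (h : MinCx X φ) : Nonempty X := by
  by_contra hX
  rw [not_nonempty_iff] at hX
  exact h.not_fix_all (IsFull.top h.surj) fun _ _ x => hX.elim x

/-- The point stabilizer acting on a regular elementary abelian normal subgroup. -/
lemma exists_isMinAction (h : MinCx X φ) (hV : HasAffine X φ) :
    ∃ (H : Type) (_ : Group H) (_ : Finite H) (V : Type) (_ : AddCommGroup V) (_ : Finite V)
      (_ : DistribMulAction H V) (π : H →* S), IsMinAction π V ∧ Nat.card V = Nat.card X := by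
  obtain ⟨V, hVn, hVk, hVc, hcomm, r, hr, hrV⟩ := hV
  obtain ⟨x⟩ := h.nonempty
  set H := MulAction.stabilizer G x
  have hcop : (Nat.card V).Coprime (Nat.card ↥(H ⊓ φ.ker)) := hVc ▸ h.coprime_card x
  have htrans := h.exists_smul_of_card hVk hcop hVc
  have hnt : Nontrivial V := by
    by_contra hno
    rw [not_nontrivial_iff_subsingleton] at hno
    refine h.not_fix_all (IsFull.top h.surj) fun g _ y => ?_
    obtain ⟨v, hv, e⟩ := htrans y (g • y)
    have : v = 1 := congrArg Subtype.val (Subsingleton.elim (⟨v, hv⟩ : V) 1)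
    rw [← e, this, one_smul]
  let _ : CommGroup V :=
    { (inferInstance : Group V) with
      mul_comm := fun a b => Subtype.ext (hcomm a a.2 b b.2) }
  let ρ : H →* MulAut V := (MulAut.conjNormal (H := V)).comp H.subtype
  have hρ : ∀ (g : H) (v : V), ((ρ g v : V) : G) = g * v * (g : G)⁻¹ := fun g v =>
    MulAut.conjNormal_apply (g : G) v
  let _ : DistribMulAction H (Additive V) :=
    { smul := fun g v => Additive.ofMul (ρ g v.toMul)
      one_smul := fun v => by
        show Additive.ofMul (ρ 1 v.toMul) = v
        rw [map_one]; rfl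
      mul_smul := fun a b v => by
        show Additive.ofMul (ρ (a * b) v.toMul) = Additive.ofMul (ρ a (ρ b v.toMul))
        rw [map_mul]; rfl
      smul_zero := fun g => map_one (ρ g)
      smul_add := fun g => map_mul (ρ g) }
  have hmin : ∀ F : Subgroup H, IsFull (φ.comp H.subtype) F → F = ⊤ := by
    intro F hF
    have hF' : IsFull φ (F.map H.subtype) := fun s => by
      obtain ⟨f, hf, e⟩ := hF s
      exact ⟨f, mem_map_of_mem _ hf, e⟩
    have hFH : F.map H.subtype ≤ H := map_subtype_le _
    have htop : V ⊔ F.map H.subtype = ⊤ := by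
      by_contra hne
      have hle := h.le_stabilizer hne (x := x) (hF'.mono (le_inf le_sup_right hFH))
      obtain ⟨v, hv⟩ := exists_ne (1 : V)
      exact hv (Subtype.ext (h.semiregular hVk hcop v.2 (y := x)
        (le_sup_left.trans hle v.2)))
    rw [eq_top_iff]
    rintro g -
    have hg : (g : G) ∈ V ⊔ F.map H.subtype := htop ▸ mem_top _
    obtain ⟨v, hv, f, hf, e⟩ := mem_sup_of_normal_left.1 hg
    have hv1 : v = 1 := h.semiregular hVk hcop hv (y := x) (by
      have : v ∈ H := by
        rw [eq_mul_inv_of_mul_eq e]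
        exact mul_mem g.2 (inv_mem (hFH hf))
      exact this)
    rw [hv1, one_mul] at e
    obtain ⟨f', hf', e'⟩ := hf
    have : f' = g := Subtype.ext (e'.trans e)
    exact this ▸ hf'
  refine ⟨H, inferInstance, inferInstance, Additive V, inferInstance, inferInstance, inferInstance,
    φ.comp H.subtype, ⟨(h.stab x).surjective_restrict, hnt, ?_, hmin, ?_, ?_, r, hr, ?_⟩, hVc⟩
  · intro g hg
    refine Subtype.ext (h.eq_one fun y => ?_)
    obtain ⟨v, hv, rfl⟩ := htrans x y
    have h1 : (g : G) * v * (g : G)⁻¹ = v := by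
      rw [← hρ g ⟨v, hv⟩]
      exact congrArg (fun w : Additive V => (w.toMul : G)) (hg (Additive.ofMul ⟨v, hv⟩))
    rw [← mul_smul, mul_inv_eq_iff_eq_mul.1 h1, mul_smul, show (g : G) • x = x from g.2]
  · intro A _ _ ψ hA g
    have := hmin _ (h.isFull_ker_mulAut (φ.comp H.subtype) (h.stab x).surjective_restrict ψ
      (hVc ▸ hA))
    exact MonoidHom.mem_ker.1 (this ▸ mem_top g)
  · have : Nat.card ↥(H ⊓ φ.ker) = Nat.card (φ.comp H.subtype).ker := by
      rw [← MonoidHom.comap_ker, ← subgroupOf, ← inf_subgroupOf_left]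
      exact (Nat.card_congr (subgroupOfEquivOfLe inf_le_left).toEquiv).symm
    rw [← this]
    exact hcop
  · intro v
    exact Subtype.ext (hrV v.toMul v.toMul.2)

end MinCx

end

section

open Subgroup Equiv.Perm
open scoped commutatorElement

namespace CentralLift

variable {H Y : Type} [Group H] [Fintype Y] [DecidableEq Y] {π : H →* alternatingGroup Y}

lemma comm_of_mem_ker (hc : π.ker ≤ center H) {z : H} (hz : π z = 1) (g : H) : g * z = z * g :=
  mem_center_iff.1 (hc (MonoidHom.mem_ker.2 hz)) g

/-- An element of order three inverted by conjugation lifts to such an element. -/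
lemma exists_lift_order_three (hπ : Function.Surjective π) (hc : π.ker ≤ center H)
    {c : alternatingGroup Y} (hc3 : c ^ 3 = 1) {g : H} (hg : π g * c * (π g)⁻¹ = c⁻¹) :
    ∃ t : H, π t = c ∧ t ^ 3 = 1 ∧ g * t * g⁻¹ = t⁻¹ := by
  obtain ⟨a, ha⟩ := hπ c
  obtain ⟨z, hz⟩ : ∃ z, z = a * (g * a * g⁻¹) := ⟨_, rfl⟩
  have hπz : π z = 1 := by
    rw [hz, map_mul, map_mul, map_mul, map_inv, ha, hg, mul_inv_cancel]
  have hzc : ∀ x, x * z = z * x := comm_of_mem_ker hc hπz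
  have hga : g * a * g⁻¹ = a⁻¹ * z := by rw [hz]; group
  -- `s = a² z⁻¹` is inverted by `g`
  have hcz : Commute a z := hzc a
  have hgz : g * z * g⁻¹ = z := by rw [hzc g]; group
  have hs : g * (a ^ 2 * z⁻¹) * g⁻¹ = (a ^ 2 * z⁻¹)⁻¹ := by
    have e : g * (a ^ 2 * z⁻¹) * g⁻¹ = (g * a * g⁻¹) ^ 2 * (g * z * g⁻¹)⁻¹ := by
      rw [conj_pow]; group
    have hca : Commute a⁻¹ z := hcz.inv_left
    rw [e, hga, hgz, hca.mul_pow, mul_inv_rev, inv_inv, ← inv_pow, pow_two z, mul_assoc,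
      mul_inv_cancel_right, (hca.pow_left 2).eq]
  obtain ⟨s, hsdef⟩ : ∃ s, s = a ^ 2 * z⁻¹ := ⟨_, rfl⟩
  rw [← hsdef] at hs
  have hπs : π s = c ^ 2 := by rw [hsdef, map_mul, map_pow, map_inv, hπz, ha, inv_one, mul_one]
  have h3 : π (s ^ 3) = 1 := by
    rw [map_pow, hπs, ← pow_mul, mul_comm, pow_mul, hc3, one_pow]
  have h6 : s ^ 6 = 1 := by
    have e : g * s ^ 3 * g⁻¹ = (s ^ 3)⁻¹ := by rw [← conj_pow, hs, inv_pow]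
    rw [comm_of_mem_ker hc h3 g, mul_inv_cancel_right] at e
    calc s ^ 6 = s ^ 3 * s ^ 3 := by rw [← pow_add]
      _ = 1 := by nth_rewrite 2 [e]; rw [mul_inv_cancel]
  refine ⟨s ^ 2, ?_, ?_, ?_⟩
  · rw [map_pow, hπs, ← pow_mul, show 2 * 2 = 3 + 1 from rfl, pow_succ, hc3, one_mul]
  · rw [← pow_mul, h6]
  · rw [← conj_pow, hs, inv_pow]

lemma isPerfect_alternatingGroup {X : Type} [Fintype X] [DecidableEq X] (h : 5 ≤ Nat.card X) :
    Group.IsPerfect (alternatingGroup X) := ⟨commutator_alternatingGroup_eq_top h⟩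

/-- A perfect group which commutes with `t` modulo a central kernel commutes with `t`. -/
lemma commute_of_range {A : Type} [Group A] [Group.IsPerfect A] (f : A →* alternatingGroup Y)
    (hπ : Function.Surjective π) (hc : π.ker ≤ center H) {t : H}
    (hf : ∀ a, f a * π t = π t * f a) {h : H} (hh : π h ∈ f.range) : h * t = t * h := by
  choose l hl using hπ
  have hmem : ∀ x : H, π x * π t = π t * π x → π ⁅x, t⁆ = 1 := by
    intro x hx
    rw [map_commutatorElement, commutatorElement_eq_one_iff_mul_comm]
    exact hx
  have hmul : ∀ x y : H, π ⁅y, t⁆ = 1 → ⁅x * y, t⁆ = ⁅x, t⁆ * ⁅y, t⁆ := by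
    intro x y hy
    have : ⁅x * y, t⁆ = x * ⁅y, t⁆ * x⁻¹ * ⁅x, t⁆ := by simp only [commutatorElement_def]; group
    rw [this, comm_of_mem_ker hc hy, mul_inv_cancel_right, comm_of_mem_ker hc hy]
  have hker : ∀ x y : H, π x = π y → ⁅x, t⁆ = ⁅y, t⁆ := by
    intro x y hxy
    have h1 : π (y⁻¹ * x) = 1 := by rw [map_mul, map_inv, hxy, inv_mul_cancel]
    have h2 : ⁅y⁻¹ * x, t⁆ = 1 := by
      rw [commutatorElement_eq_one_iff_mul_comm]
      exact (comm_of_mem_ker hc h1 t).symm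
    have h3 := hmul y (y⁻¹ * x) (by rw [h2, map_one])
    rwa [mul_inv_cancel_left, h2, mul_one] at h3
  let ψ : A →* center H := MonoidHom.mk' (fun a => ⟨⁅l (f a), t⁆, hc (MonoidHom.mem_ker.2
    (hmem _ (by rw [hl]; exact hf a)))⟩) (by
      intro a b
      refine Subtype.ext (?_ : ⁅l (f (a * b)), t⁆ = ⁅l (f a), t⁆ * ⁅l (f b), t⁆)
      rw [← hmul _ _ (hmem _ (by rw [hl]; exact hf b))]
      exact hker _ _ (by rw [hl, map_mul, map_mul, hl, hl]))
  obtain ⟨a, ha⟩ := hh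
  have h1 : ψ a = 1 := by
    have : a ∈ commutator A := by rw [Group.IsPerfect.commutator_eq_top]; trivial
    let _ : CommGroup (center H) :=
      { (center H).toGroup with mul_comm := fun a b => Subtype.ext (mem_center_iff.1 b.2 a) }
    exact Abelianization.commutator_subset_ker ψ this
  have h2 : ⁅l (f a), t⁆ = 1 := congrArg Subtype.val h1
  rw [hker _ h (by rw [hl, ha])] at h2
  exact commutatorElement_eq_one_iff_mul_comm.1 h2

lemma commute_of_commute (hπ : Function.Surjective π) (hc : π.ker ≤ center H)
    (h8 : 8 ≤ Nat.card Y) {t : H} (ht : IsThreeCycle (π t : Equiv.Perm Y)) {h : H}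
    (hh : π h * π t = π t * π h) : h * t = t * h := by
  have hsc : 5 ≤ Nat.card ((π t : Equiv.Perm Y).supportᶜ : Finset Y) := by
    rw [Nat.card_eq_fintype_card, Fintype.card_coe, Finset.card_compl, ht.card_support,
      ← Nat.card_eq_fintype_card]
    omega
  have := isPerfect_alternatingGroup hsc
  have key : ∀ x : H, Disjoint (π x : Equiv.Perm Y).support (π t : Equiv.Perm Y).support →
      x * t = t * x := by
    intro x hx
    refine commute_of_range (alternatingGroup.ofSubtype (π t : Equiv.Perm Y).supportᶜ) hπ hc ?_ ?_
    · intro a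
      have ha := (alternatingGroup.mem_range_ofSubtype_iff
        (π t : Equiv.Perm Y).supportᶜ (alternatingGroup.ofSubtype _ a)).1 ⟨a, rfl⟩
      ext1
      exact (disjoint_iff_disjoint_support.2
        (Finset.disjoint_left.2 fun y hy hy' => Finset.mem_compl.1 (ha hy) hy')).commute
    · rw [alternatingGroup.mem_range_ofSubtype_iff]
      exact fun y hy => Finset.mem_compl.2 (Finset.disjoint_left.1 hx hy)
  have hcy := ht.isCycle
  obtain ⟨hs, n, hn⟩ := (IsCycle.commute_iff (g := (π h : Equiv.Perm Y)) hcy).1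
    (congrArg Subtype.val hh)
  have h1 := key (h * t ^ (-n)) (by
    refine Finset.disjoint_left.2 fun y hy hy' => mem_support.1 hy ?_
    have e : ((π t : Equiv.Perm Y) ^ (-n)) y ∈ (π t : Equiv.Perm Y).support := by
      rwa [zpow_apply_mem_support]
    have e2 := DFunLike.congr_fun hn (((π t : Equiv.Perm Y) ^ (-n)) y)
    rw [ofSubtype_apply_of_mem (p := (· ∈ (π t : Equiv.Perm Y).support)) _ e,
      subtypePerm_apply] at e2
    simp only [map_mul, map_zpow, Subgroup.coe_mul, SubgroupClass.coe_zpow, Equiv.Perm.mul_apply]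
    refine Eq.trans e2.symm ?_
    rw [← Equiv.Perm.mul_apply, ← zpow_add, add_neg_cancel, zpow_zero, one_apply])
  have h2 : Commute (t ^ n) t := (Commute.refl t).zpow_left n
  have h3 : Commute (h * t ^ (-n) * t ^ n) t := Commute.mul_left h1 h2
  rw [mul_assoc, ← zpow_add, neg_add_cancel, zpow_zero, mul_one] at h3
  exact h3

/-- Three-cycles have canonical lifts to a central extension of the alternating group. -/
theorem exists_threeCycle_lift (hπ : Function.Surjective π) (hc : π.ker ≤ center H)
    (h8 : 8 ≤ Nat.card Y) : ∃ t : Equiv.Perm Y → H, ∀ c : Equiv.Perm Y, c.IsThreeCycle →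
      (π (t c) : Equiv.Perm Y) = c ∧ t c ^ 3 = 1 ∧ t c⁻¹ = (t c)⁻¹ ∧
        ∀ g, g * t c * g⁻¹ = t (π g * c * (π g : Equiv.Perm Y)⁻¹) := by
  classical
  have hfin : 3 ≤ Fintype.card Y := by rw [← Nat.card_eq_fintype_card]; omega
  by_cases hex : ∃ c : Equiv.Perm Y, c.IsThreeCycle
  swap
  · exact ⟨fun _ => 1, fun c h => absurd ⟨c, h⟩ hex⟩
  obtain ⟨c₀, h₀⟩ := hex
  have hconj : ∀ c : Equiv.Perm Y, c.IsThreeCycle →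
      ∃ g : H, (π g : Equiv.Perm Y) * c₀ * (π g : Equiv.Perm Y)⁻¹ = c := by
    intro c h
    obtain ⟨u, hu⟩ := isConj_iff.1 (alternatingGroup.isThreeCycle_isConj (α := Y) (by omega)
      (σ := ⟨c₀, h₀.mem_alternatingGroup⟩) (τ := ⟨c, h.mem_alternatingGroup⟩) h₀ h)
    obtain ⟨g, rfl⟩ := hπ u
    exact ⟨g, congrArg Subtype.val hu⟩
  obtain ⟨g₀, hg₀⟩ := hconj c₀⁻¹ h₀.inv
  obtain ⟨t₀, ht₀, ht3, htg⟩ := exists_lift_order_three hπ hc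
    (c := ⟨c₀, h₀.mem_alternatingGroup⟩)
    (by ext1; simpa [h₀.orderOf] using pow_orderOf_eq_one c₀) (g := g₀) (by ext1; exact hg₀)
  have ht₀' : (π t₀ : Equiv.Perm Y) = c₀ := congrArg Subtype.val ht₀
  have hwd : ∀ g g' : H, (π g : Equiv.Perm Y) * c₀ * (π g : Equiv.Perm Y)⁻¹ =
      (π g' : Equiv.Perm Y) * c₀ * (π g' : Equiv.Perm Y)⁻¹ → g * t₀ * g⁻¹ = g' * t₀ * g'⁻¹ := by
    intro g g' e
    have h1 := commute_of_commute hπ hc h8 (t := t₀) (by rw [ht₀']; exact h₀) (h := g'⁻¹ * g) (by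
      ext1
      simp only [map_mul, map_inv, Subgroup.coe_mul, InvMemClass.coe_inv, ht₀']
      rw [mul_inv_eq_iff_eq_mul] at e
      rw [mul_assoc, e]; group)
    calc g * t₀ * g⁻¹ = g' * (g'⁻¹ * g * t₀) * g⁻¹ := by group
      _ = g' * t₀ * g'⁻¹ := by rw [h1]; group
  choose! l hl using hconj
  refine ⟨fun c => l c * t₀ * (l c)⁻¹, fun c h => ⟨?_, ?_, ?_, ?_⟩⟩
  · simp only [map_mul, map_inv, Subgroup.coe_mul, InvMemClass.coe_inv, ht₀']
    exact hl c h
  · simp [conj_pow, ht3]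
  · have : l c⁻¹ * t₀ * (l c⁻¹)⁻¹ = (l c * g₀) * t₀ * (l c * g₀)⁻¹ := by
      apply hwd
      rw [hl _ h.inv]
      simp only [map_mul, Subgroup.coe_mul, mul_inv_rev]
      rw [show (π (l c) : Equiv.Perm Y) * (π g₀) * c₀ * ((π g₀ : Equiv.Perm Y)⁻¹ *
        (π (l c) : Equiv.Perm Y)⁻¹) = π (l c) * (π g₀ * c₀ * (π g₀ : Equiv.Perm Y)⁻¹) *
        (π (l c) : Equiv.Perm Y)⁻¹ by group, hg₀]
      conv_lhs => rw [← hl c h]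
      group
    simp only [this]
    rw [show l c * g₀ * t₀ * (l c * g₀)⁻¹ = l c * (g₀ * t₀ * g₀⁻¹) * (l c)⁻¹ by group, htg]
    group
  · intro g
    have h' : ((π g : Equiv.Perm Y) * c * (π g : Equiv.Perm Y)⁻¹).IsThreeCycle := by
      rw [IsThreeCycle, cycleType_conj]; exact h
    have : (g * l c) * t₀ * (g * l c)⁻¹ = _ := hwd (g * l c) (l (π g * c * (π g : Equiv.Perm Y)⁻¹)) (by
      rw [hl _ h']
      simp only [map_mul, Subgroup.coe_mul, mul_inv_rev]
      conv_rhs => rw [← hl c h]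
      group)
    refine Eq.trans ?_ this
    group

end CentralLift

end

section

open Equiv.Perm

/-- An action of three-cycles: elements of exponent three acting on `V`, indexed
by the three-cycles of `Y`, and permuted under conjugation as the three-cycles are. -/
structure ThreeCycleRep {Y V : Type} [Fintype Y] [DecidableEq Y] [AddCommGroup V]
    (τ : Equiv.Perm Y → (AddMonoid.End V)ˣ) : Prop where
  cube : ∀ c : Equiv.Perm Y, c.IsThreeCycle → τ c ^ 3 = 1
  inv : ∀ c : Equiv.Perm Y, c.IsThreeCycle → τ c⁻¹ = (τ c)⁻¹
  conj : ∀ c d : Equiv.Perm Y, c.IsThreeCycle → d.IsThreeCycle →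
    τ c * τ d * (τ c)⁻¹ = τ (c * d * c⁻¹)

/-- All three-cycles act trivially. -/
def IsTrivialRep {Y V : Type} [Fintype Y] [DecidableEq Y] [AddCommGroup V]
    (τ : Equiv.Perm Y → (AddMonoid.End V)ˣ) : Prop :=
  ∀ c : Equiv.Perm Y, c.IsThreeCycle → τ c = 1

lemma Equiv.Perm.IsThreeCycle.conj {Y : Type} [Fintype Y] [DecidableEq Y] {c : Equiv.Perm Y}
    (h : c.IsThreeCycle) (σ : Equiv.Perm Y) : (σ * c * σ⁻¹).IsThreeCycle := by
  rw [IsThreeCycle, cycleType_conj]; exact h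

lemma AddMonoid.End.units_ext {V : Type} [AddCommGroup V] {u w : (AddMonoid.End V)ˣ}
    (h : ∀ v : V, u • v = w • v) : u = w :=
  Units.ext (AddMonoidHom.ext h)

namespace ThreeCycleRep

variable {Y V : Type} [Fintype Y] [DecidableEq Y] [AddCommGroup V]
  {τ : Equiv.Perm Y → (AddMonoid.End V)ˣ}

lemma exists_lift (h : ThreeCycleRep τ) {σ : Equiv.Perm Y} (hσ : σ ∈ alternatingGroup Y) :
    ∃ g ∈ Subgroup.closure (τ '' {c | c.IsThreeCycle}),
      ∀ d : Equiv.Perm Y, d.IsThreeCycle → g * τ d * g⁻¹ = τ (σ * d * σ⁻¹) := by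
  rw [← closure_three_cycles_eq_alternating] at hσ
  induction hσ using Subgroup.closure_induction with
  | mem c hc => exact ⟨τ c, Subgroup.subset_closure ⟨c, hc, rfl⟩, fun d hd => h.conj c d hc hd⟩
  | one => exact ⟨1, one_mem _, fun d _ => by simp⟩
  | mul a b _ _ iha ihb =>
    obtain ⟨x, hx, hx'⟩ := iha
    obtain ⟨y, hy, hy'⟩ := ihb
    refine ⟨x * y, mul_mem hx hy, fun d hd => ?_⟩
    rw [show x * y * τ d * (x * y)⁻¹ = x * (y * τ d * y⁻¹) * x⁻¹ by group, hy' d hd,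
      hx' _ (hd.conj b), mul_inv_rev]
    simp only [mul_assoc]
  | inv a _ iha =>
    obtain ⟨x, hx, hx'⟩ := iha
    refine ⟨x⁻¹, inv_mem hx, fun d hd => ?_⟩
    have := hx' (a⁻¹ * d * a⁻¹⁻¹) (hd.conj a⁻¹)
    rw [show a * (a⁻¹ * d * a⁻¹⁻¹) * a⁻¹ = d by group] at this
    rw [← this]; group

lemma isTrivialRep_of_forall_eq (h : ThreeCycleRep τ)
    (he : ∀ c d : Equiv.Perm Y, c.IsThreeCycle → d.IsThreeCycle → τ c = τ d) :
    IsTrivialRep τ := by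
  intro c hc
  have h1 := he c⁻¹ c hc.inv hc
  rw [h.inv c hc] at h1
  have h3 := h.cube c hc
  have h2 : τ c * τ c = 1 := by nth_rewrite 1 [← h1]; rw [inv_mul_cancel]
  rwa [pow_succ, pow_two, h2, one_mul] at h3

lemma exists_conj (h5 : 5 ≤ Nat.card Y) {c d : Equiv.Perm Y} (hc : c.IsThreeCycle)
    (hd : d.IsThreeCycle) : ∃ σ ∈ alternatingGroup Y, σ * c * σ⁻¹ = d := by
  obtain ⟨u, hu⟩ := isConj_iff.1 (alternatingGroup.isThreeCycle_isConj h5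
      (σ := ⟨c, hc.mem_alternatingGroup⟩) (τ := ⟨d, hd.mem_alternatingGroup⟩) hc hd)
  exact ⟨u, u.2, congrArg Subtype.val hu⟩

/-- If some nontrivial even permutation preserves `τ`, then `τ` is trivial. -/
lemma isTrivialRep_of_conj_eq (h : ThreeCycleRep τ) (h5 : 5 ≤ Nat.card Y) {σ : Equiv.Perm Y}
    (hσ : σ ∈ alternatingGroup Y) (hne : σ ≠ 1)
    (hs : ∀ d : Equiv.Perm Y, d.IsThreeCycle → τ (σ * d * σ⁻¹) = τ d) : IsTrivialRep τ := by
  have := alternatingGroup.isSimpleGroup h5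
  let N : Subgroup (alternatingGroup Y) :=
    { carrier := {s | ∀ d : Equiv.Perm Y, d.IsThreeCycle →
        τ (s * d * (s : Equiv.Perm Y)⁻¹) = τ d}
      one_mem' := fun d _ => by simp
      mul_mem' := fun {a b} ha hb d hd => by
        have e : ((a * b : alternatingGroup Y) : Equiv.Perm Y) * d *
          ((a * b : alternatingGroup Y) : Equiv.Perm Y)⁻¹ =
          a * ((b : Equiv.Perm Y) * d * (b : Equiv.Perm Y)⁻¹) * (a : Equiv.Perm Y)⁻¹ := by
          simp only [Subgroup.coe_mul]; group
        rw [e, ha _ (hd.conj _), hb _ hd]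
      inv_mem' := fun {a} ha d hd => by
        rw [← ha _ (hd.conj _)]
        congr 1
        simp only [Subgroup.coe_inv]; group }
  have hN : N.Normal := ⟨fun a ha b d hd => by
    obtain ⟨g, -, hg⟩ := h.exists_lift b.2
    have e : ((b * a * b⁻¹ : alternatingGroup Y) : Equiv.Perm Y) * d *
        ((b * a * b⁻¹ : alternatingGroup Y) : Equiv.Perm Y)⁻¹ =
        b * (a * ((b : Equiv.Perm Y)⁻¹ * d * (b : Equiv.Perm Y)⁻¹⁻¹) * (a : Equiv.Perm Y)⁻¹)
          * (b : Equiv.Perm Y)⁻¹ := by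
      simp only [Subgroup.coe_mul, Subgroup.coe_inv]; group
    rw [e, ← hg _ ((hd.conj _).conj _), ha _ (hd.conj _), hg _ (hd.conj _)]
    congr 1; group⟩
  have htop : N = ⊤ := by
    refine (IsSimpleGroup.eq_bot_or_eq_top_of_normal N hN).resolve_left fun hb => hne ?_
    have : (⟨σ, hσ⟩ : alternatingGroup Y) ∈ N := hs
    rw [hb, Subgroup.mem_bot] at this
    exact congrArg Subtype.val this
  refine h.isTrivialRep_of_forall_eq fun c d hc hd => ?_
  obtain ⟨s, hs, rfl⟩ := exists_conj h5 hd hc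
  have : (⟨s, hs⟩ : alternatingGroup Y) ∈ N := htop ▸ trivial
  exact this d hd

lemma isTrivialRep_of_eq_one (h : ThreeCycleRep τ) (h5 : 5 ≤ Nat.card Y) {c : Equiv.Perm Y}
    (hc : c.IsThreeCycle) (h1 : τ c = 1) : IsTrivialRep τ :=
  h.isTrivialRep_of_conj_eq h5 hc.mem_alternatingGroup (by
    rintro rfl; exact hc.isCycle.ne_one rfl) fun d hd => by
      rw [← h.conj c d hc hd, h1]; simp

lemma exists_isThreeCycle (h5 : 5 ≤ Nat.card Y) : ∃ c : Equiv.Perm Y, c.IsThreeCycle := by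
  rw [Nat.card_eq_fintype_card] at h5
  obtain ⟨a, b, c, hab, hac, hbc⟩ := Fintype.two_lt_card_iff.1 (by omega : 2 < Fintype.card Y)
  exact ⟨_, isThreeCycle_swap_mul_swap_same hab hac hbc⟩

lemma isTrivialRep_of_commute (h : ThreeCycleRep τ) (h5 : 5 ≤ Nat.card Y)
    (hcomm : ∀ c d : Equiv.Perm Y, c.IsThreeCycle → d.IsThreeCycle → τ c * τ d = τ d * τ c) :
    IsTrivialRep τ := by
  obtain ⟨c, hc⟩ := exists_isThreeCycle h5
  exact h.isTrivialRep_of_conj_eq h5 hc.mem_alternatingGroup (by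
    rintro rfl; exact hc.isCycle.ne_one rfl) fun d hd => by
      rw [← h.conj c d hc hd, hcomm c d hc hd, mul_inv_cancel_right]

/-- The action on an invariant subgroup. -/
lemma exists_restrict (h : ThreeCycleRep τ) (W : AddSubgroup V)
    (hW : ∀ c : Equiv.Perm Y, c.IsThreeCycle → ∀ w ∈ W, τ c • w ∈ W) :
    ∃ τ' : Equiv.Perm Y → (AddMonoid.End W)ˣ, ThreeCycleRep τ' ∧
      ∀ c : Equiv.Perm Y, c.IsThreeCycle → ∀ w : W, ((τ' c • w : W) : V) = τ c • (w : V) := by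
  classical
  have hex : ∀ c : Equiv.Perm Y, c.IsThreeCycle →
      ∃ u : (AddMonoid.End W)ˣ, ∀ w : W, ((u • w : W) : V) = τ c • (w : V) := by
    intro c hc
    refine ⟨⟨AddMonoidHom.mk' (fun w : W => (⟨τ c • (w : V), hW c hc w w.2⟩ : W)) ?_,
      AddMonoidHom.mk' (fun w : W => (⟨τ c⁻¹ • (w : V), hW _ hc.inv w w.2⟩ : W)) ?_, ?_, ?_⟩, ?_⟩
    · exact fun a b => Subtype.ext (smul_add _ _ _)
    · exact fun a b => Subtype.ext (smul_add _ _ _)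
    · ext w
      change τ c • τ c⁻¹ • (w : V) = w
      rw [h.inv c hc, smul_inv_smul]
    · ext w
      change τ c⁻¹ • τ c • (w : V) = w
      rw [h.inv c hc, inv_smul_smul]
    · exact fun w => rfl
  choose! τ' hτ' using hex
  refine ⟨τ', ⟨fun c hc => ?_, fun c hc => ?_, fun c d hc hd => ?_⟩, hτ'⟩
  · refine AddMonoid.End.units_ext fun w => Subtype.ext ?_
    rw [pow_succ, pow_two, mul_smul, mul_smul, hτ' c hc, hτ' c hc, hτ' c hc, one_smul,
      ← mul_smul, ← mul_smul, ← pow_two, ← pow_succ, h.cube c hc, one_smul]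
  · rw [eq_inv_iff_mul_eq_one]
    refine AddMonoid.End.units_ext fun w => Subtype.ext ?_
    rw [mul_smul, hτ' _ hc.inv, hτ' c hc, h.inv c hc, inv_smul_smul, one_smul]
  · rw [mul_inv_eq_iff_eq_mul]
    refine AddMonoid.End.units_ext fun w => Subtype.ext ?_
    rw [mul_smul, mul_smul, hτ' c hc, hτ' d hd, hτ' _ (hd.conj c), hτ' c hc, ← mul_smul,
      ← mul_smul, ← h.conj c d hc hd, inv_mul_cancel_right]

/-- The action on the quotient by an invariant subgroup. -/
lemma exists_quotient (h : ThreeCycleRep τ) (W : AddSubgroup V)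
    (hW : ∀ c : Equiv.Perm Y, c.IsThreeCycle → ∀ w ∈ W, τ c • w ∈ W) :
    ∃ τ' : Equiv.Perm Y → (AddMonoid.End (V ⧸ W))ˣ, ThreeCycleRep τ' ∧
      ∀ c : Equiv.Perm Y, c.IsThreeCycle →
        ∀ v : V, τ' c • (QuotientAddGroup.mk v : V ⧸ W) = QuotientAddGroup.mk (τ c • v) := by
  classical
  have hex : ∀ c : Equiv.Perm Y, c.IsThreeCycle → ∃ u : (AddMonoid.End (V ⧸ W))ˣ,
        ∀ v : V, u • (QuotientAddGroup.mk v : V ⧸ W) = QuotientAddGroup.mk (τ c • v) := by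
    intro c hc
    refine ⟨⟨QuotientAddGroup.map W W (τ c : AddMonoid.End V) (hW c hc),
      QuotientAddGroup.map W W (τ c⁻¹ : AddMonoid.End V) (hW _ hc.inv), ?_, ?_⟩, ?_⟩
    · refine AddMonoidHom.ext fun v => ?_
      obtain ⟨v, rfl⟩ := QuotientAddGroup.mk_surjective v
      change QuotientAddGroup.mk (τ c • τ c⁻¹ • v) = (v : V ⧸ W)
      rw [h.inv c hc, smul_inv_smul]
    · refine AddMonoidHom.ext fun v => ?_
      obtain ⟨v, rfl⟩ := QuotientAddGroup.mk_surjective v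
      change QuotientAddGroup.mk (τ c⁻¹ • τ c • v) = (v : V ⧸ W)
      rw [h.inv c hc, inv_smul_smul]
    · exact fun v => rfl
  choose! τ' hτ' using hex
  have ext' : ∀ u w : (AddMonoid.End (V ⧸ W))ˣ,
      (∀ v : V, u • (v : V ⧸ W) = w • (v : V ⧸ W)) → u = w := fun u w hu =>
    AddMonoid.End.units_ext fun v => by
      obtain ⟨v, rfl⟩ := QuotientAddGroup.mk_surjective v; exact hu v
  refine ⟨τ', ⟨fun c hc => ?_, fun c hc => ?_, fun c d hc hd => ?_⟩, hτ'⟩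
  · refine ext' _ _ fun w => ?_
    rw [pow_succ, pow_two, mul_smul, mul_smul, hτ' c hc, hτ' c hc, hτ' c hc, one_smul,
      ← mul_smul, ← mul_smul, ← pow_two, ← pow_succ, h.cube c hc, one_smul]
  · rw [eq_inv_iff_mul_eq_one]
    refine ext' _ _ fun w => ?_
    rw [mul_smul, hτ' c hc, hτ' _ hc.inv, h.inv c hc, inv_smul_smul, one_smul]
  · rw [mul_inv_eq_iff_eq_mul]
    refine ext' _ _ fun w => ?_
    rw [mul_smul, mul_smul, hτ' d hd, hτ' c hc, hτ' c hc, hτ' _ (hd.conj c), ← mul_smul,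
      ← mul_smul, ← h.conj c d hc hd, inv_mul_cancel_right]

lemma extendDomain (h : ThreeCycleRep τ) {X : Type} [Fintype X] [DecidableEq X] {p : Y → Prop}
    [DecidablePred p] (f : X ≃ Subtype p) :
    ThreeCycleRep (fun c : Equiv.Perm X => τ (extendDomainHom f c)) := by
  have h3 : ∀ c : Equiv.Perm X, c.IsThreeCycle → (extendDomainHom f c).IsThreeCycle := by
    intro c hc
    rw [IsThreeCycle, extendDomainHom_apply, cycleType_extendDomain]; exact hc
  refine ⟨fun c hc => h.cube _ (h3 c hc), fun c hc => ?_, fun c d hc hd => ?_⟩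
  · rw [map_inv]; exact h.inv _ (h3 c hc)
  · rw [map_mul, map_mul, map_inv]; exact h.conj _ _ (h3 c hc) (h3 d hd)

/-- A three-cycle action trivial on a subgroup and on its quotient is trivial. -/
lemma isTrivialRep_of_unipotent (h : ThreeCycleRep τ) (h5 : 5 ≤ Nat.card Y) (W : AddSubgroup V)
    (h1 : ∀ c : Equiv.Perm Y, c.IsThreeCycle → ∀ w ∈ W, τ c • w = w)
    (h2 : ∀ c : Equiv.Perm Y, c.IsThreeCycle → ∀ v : V, τ c • v - v ∈ W) : IsTrivialRep τ := by
  refine h.isTrivialRep_of_commute h5 fun c d hc hd => AddMonoid.End.units_ext fun v => ?_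
  have a1 := h1 c hc _ (h2 d hd v)
  have a2 := h1 d hd _ (h2 c hc v)
  rw [smul_sub] at a1 a2
  rw [mul_smul, mul_smul, eq_add_of_sub_eq a1, eq_add_of_sub_eq a2]
  abel

variable (τ) in
/-- The common fixed points of the three-cycles. -/
def fixed : AddSubgroup V where
  carrier := {v | ∀ c : Equiv.Perm Y, c.IsThreeCycle → τ c • v = v}
  add_mem' := fun ha hb c hc => by rw [smul_add, ha c hc, hb c hc]
  zero_mem' := fun c _ => smul_zero _
  neg_mem' := fun ha c hc => by rw [smul_neg, ha c hc]

/-- To bound `|V|` from below we may assume that there are no fixed points. -/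
lemma exists_fixed_eq_bot (h5 : 5 ≤ Nat.card Y) (r : ℕ) (n : ℕ) : ∀ (V : Type) [AddCommGroup V]
    [Finite V] (τ : Equiv.Perm Y → (AddMonoid.End V)ˣ), Nat.card V ≤ n → ThreeCycleRep τ →
    ¬ IsTrivialRep τ → (∀ v : V, r • v = 0) →
    ∃ (V' : Type) (_ : AddCommGroup V') (_ : Finite V') (τ' : Equiv.Perm Y → (AddMonoid.End V')ˣ),
      Nat.card V' ≤ Nat.card V ∧ ThreeCycleRep τ' ∧ ¬ IsTrivialRep τ' ∧ (∀ v : V', r • v = 0) ∧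
        fixed τ' = ⊥ := by
  induction n with
  | zero => intro V _ _ τ hV; exact absurd (Nat.card_pos (α := V)) (by omega)
  | succ n ih =>
    intro V _ _ τ hV h hn hr
    by_cases hF : fixed τ = ⊥
    · exact ⟨V, _, inferInstance, τ, le_rfl, h, hn, hr, hF⟩
    have hlt : Nat.card (V ⧸ fixed τ) < Nat.card V := by
      rw [(fixed τ).card_eq_card_quotient_mul_card_addSubgroup]
      have h1 : 1 < Nat.card (fixed τ) := by
        rw [Finite.one_lt_card_iff_nontrivial]
        exact (AddSubgroup.nontrivial_iff_ne_bot _).2 hF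
      have h2 : 0 < Nat.card (V ⧸ fixed τ) := Nat.card_pos
      nlinarith
    obtain ⟨τ', h', hτ'⟩ := h.exists_quotient (fixed τ) (by
      intro c hc w hw
      rwa [hw c hc])
    obtain ⟨V', i1, i2, τ'', a, b⟩ := ih (V ⧸ fixed τ) τ' (by omega) h' (by
      intro ht
      refine hn (h.isTrivialRep_of_unipotent h5 (fixed τ) (fun c hc w hw => hw c hc) ?_)
      intro c hc v
      have := hτ' c hc v
      rw [ht c hc, one_smul, QuotientAddGroup.eq] at this
      rwa [sub_eq_neg_add]) (by
      intro v
      obtain ⟨v, rfl⟩ := QuotientAddGroup.mk_surjective v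
      rw [← QuotientAddGroup.mk_nsmul, hr]; rfl)
    exact ⟨V', i1, i2, τ'', a.trans hlt.le, b⟩

end ThreeCycleRep

lemma AddCommGroup.exists_card_eq_pow {V : Type} [AddCommGroup V] [Finite V] {r : ℕ}
    (hr : r.Prime) (hV : ∀ v : V, r • v = 0) : ∃ m, Nat.card V = r ^ m := by
  have : Fact r.Prime := ⟨hr⟩
  have : Module (ZMod r) V := AddCommGroup.zmodModule hV
  have := Module.finite_of_finite (ZMod r) (M := V)
  exact ⟨_, by rw [Module.natCard_eq_pow_finrank (K := ZMod r), Nat.card_zmod]⟩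

lemma AddMonoidHom.card_ker_mul_card_range {V W : Type} [AddCommGroup V] [AddCommGroup W]
    (f : V →+ W) : Nat.card f.ker * Nat.card f.range = Nat.card V := by
  rw [← AddSubgroup.index_ker, AddSubgroup.card_mul_index]

instance {V : Type} [AddCommGroup V] [Finite V] : Finite (AddMonoid.End V)ˣ :=
  Finite.of_injective (fun u => fun v : V => u • v) fun _ _ h =>
    AddMonoid.End.units_ext fun v => congrFun h v

lemma alternatingGroup.exists_orderOf_eq {Y : Type} [Fintype Y] [DecidableEq Y] {p : ℕ}
    [hp : Fact p.Prime] (hp2 : p ≠ 2) (hY : p ≤ Nat.card Y) :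
    ∃ σ ∈ alternatingGroup Y, orderOf σ = p := by
  have h2 := hp.out.two_le
  have : Nontrivial Y := Finite.one_lt_card_iff_nontrivial.1 (by omega)
  have hd : p ∣ Nat.card (alternatingGroup Y) := by
    have h1 : p ∣ 2 * Nat.card (alternatingGroup Y) := by
      rw [two_mul_nat_card_alternatingGroup, Nat.card_perm]
      exact Nat.dvd_factorial (by omega) hY
    refine (Nat.Coprime.dvd_mul_left ?_).1 h1
    exact (Nat.coprime_primes hp.out Nat.prime_two).2 hp2
  obtain ⟨x, hx⟩ := exists_prime_orderOf_dvd_card' p hd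
  exact ⟨x, x.2, by rw [Subgroup.orderOf_coe, hx]⟩

namespace ThreeCycleRep

variable {Y V : Type} [Fintype Y] [DecidableEq Y] [AddCommGroup V] [Finite V]
  {τ : Equiv.Perm Y → (AddMonoid.End V)ˣ}

lemma conj_pow {σ : Equiv.Perm Y} {g : (AddMonoid.End V)ˣ}
    (hg : ∀ d : Equiv.Perm Y, d.IsThreeCycle → g * τ d * g⁻¹ = τ (σ * d * σ⁻¹)) (m : ℕ) :
    ∀ d : Equiv.Perm Y, d.IsThreeCycle →
      g ^ m * τ d * (g ^ m)⁻¹ = τ (σ ^ m * d * (σ ^ m)⁻¹) := by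
  induction m with
  | zero => intro d _; simp
  | succ m ih =>
    intro d hd
    rw [pow_succ', pow_succ', show g * g ^ m * τ d * (g * g ^ m)⁻¹ =
      g * (g ^ m * τ d * (g ^ m)⁻¹) * g⁻¹ by simp only [mul_inv_rev, mul_assoc], ih d hd,
      hg _ (hd.conj _)]
    simp only [mul_inv_rev, mul_assoc]

/-- Counting fixed points of an element of `p`-power order. -/
lemma exists_modEq (h : ThreeCycleRep τ) (h5 : 5 ≤ Nat.card Y) (hn : ¬ IsTrivialRep τ)
    {p : ℕ} [hp : Fact p.Prime] (hp2 : p ≠ 2) (hY : p ≤ Nat.card Y) :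
    ∃ F, F ∣ Nat.card V ∧ F ≠ Nat.card V ∧ Nat.card V ≡ F [MOD p] := by
  obtain ⟨σ, hσ, hσp⟩ := alternatingGroup.exists_orderOf_eq hp2 hY
  obtain ⟨g, -, hg⟩ := h.exists_lift hσ
  obtain ⟨e, m, hm, hN⟩ := Nat.exists_eq_pow_mul_and_not_dvd (orderOf_pos g).ne' p hp.out.ne_one
  obtain ⟨g', hg'⟩ : ∃ g', g' = g ^ m := ⟨_, rfl⟩
  have hpow : g' ^ p ^ e = 1 := by rw [hg', ← pow_mul, mul_comm, ← hN, pow_orderOf_eq_one]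
  have hne : g' ≠ 1 := by
    intro h1
    refine hn (h.isTrivialRep_of_conj_eq h5 (pow_mem hσ m) (fun hs => hm ?_) fun d hd => ?_)
    · rw [← hσp]; exact orderOf_dvd_of_pow_eq_one hs
    · rw [← conj_pow hg m d hd, ← hg', h1]; simp
  have hP : IsPGroup p (Subgroup.zpowers g') := by
    rintro ⟨x, hx⟩
    obtain ⟨k, rfl⟩ := Subgroup.mem_zpowers_iff.1 hx
    refine ⟨e, Subtype.ext ?_⟩
    change (g' ^ k) ^ p ^ e = 1
    rw [← zpow_natCast, ← zpow_mul, mul_comm, zpow_mul, zpow_natCast, hpow, one_zpow]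
  let F : AddSubgroup V :=
    { carrier := MulAction.fixedPoints (Subgroup.zpowers g') V
      add_mem' := fun {a b} ha hb x => by rw [smul_add, ha x, hb x]
      zero_mem' := fun x => smul_zero _
      neg_mem' := fun {a} ha x => by rw [smul_neg, ha x] }
  refine ⟨Nat.card F, F.card_addSubgroup_dvd_card, fun hc => hne ?_, ?_⟩
  · have htop : F = ⊤ := AddSubgroup.eq_top_of_card_eq F hc
    refine AddMonoid.End.units_ext fun v => ?_
    have : v ∈ F := htop ▸ trivial
    rw [one_smul]
    exact this ⟨g', Subgroup.mem_zpowers g'⟩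
  · exact hP.card_modEq_card_fixedPoints V

lemma card_ne_prime (h : ThreeCycleRep τ) (h5 : 5 ≤ Nat.card Y) (hn : ¬ IsTrivialRep τ) {r : ℕ}
    [Fact r.Prime] : Nat.card V ≠ r := by
  intro hc
  have : IsAddCyclic V := isAddCyclic_of_prime_card hc
  obtain ⟨x, hx⟩ := IsAddCyclic.exists_generator (α := V)
  refine hn (h.isTrivialRep_of_commute h5 fun c d _ _ => AddMonoid.End.units_ext fun v => ?_)
  obtain ⟨n, rfl⟩ := AddSubgroup.mem_zmultiples_iff.1 (hx v)
  obtain ⟨a, ha⟩ := AddSubgroup.mem_zmultiples_iff.1 (hx (τ c • x))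
  obtain ⟨b, hb⟩ := AddSubgroup.mem_zmultiples_iff.1 (hx (τ d • x))
  have key : ∀ (u : (AddMonoid.End V)ˣ) (n : ℤ) (y : V), u • n • y = n • u • y :=
    fun u n y => smul_comm u n y
  simp only [mul_smul, key, ← ha, ← hb]
  rw [smul_comm a b x]

lemma card_ne_of_forall (h : ThreeCycleRep τ) (h5 : 5 ≤ Nat.card Y) (hn : ¬ IsTrivialRep τ)
    {p : ℕ} [hp : Fact p.Prime] (hp2 : p ≠ 2) (hY : p ≤ Nat.card Y) {r m : ℕ} (hr : r.Prime)
    (hall : ∀ j < m, ¬ r ^ m ≡ r ^ j [MOD p]) : Nat.card V ≠ r ^ m := by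
  intro hc
  obtain ⟨F, h1, h2, h3⟩ := h.exists_modEq h5 hn hp2 hY
  rw [hc] at h1 h2 h3
  obtain ⟨j, hj, rfl⟩ := (Nat.dvd_prime_pow hr).1 h1
  exact hall j (lt_of_le_of_ne hj fun e => h2 (by rw [e])) h3

lemma le_card_of_two (h : ThreeCycleRep τ) (h5 : 5 ≤ Nat.card Y) (hn : ¬ IsTrivialRep τ)
    (hV : ∀ v : V, 2 • v = 0) : 16 ≤ Nat.card V := by
  obtain ⟨m, hm⟩ := AddCommGroup.exists_card_eq_pow Nat.prime_two hV
  have : Fact (Nat.Prime 5) := ⟨by norm_num⟩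
  by_cases h4 : 4 ≤ m
  · rw [hm]; exact Nat.pow_le_pow_right (n := 2) (by norm_num) h4
  · refine absurd hm (h.card_ne_of_forall h5 hn (p := 5) (by norm_num) h5 Nat.prime_two ?_)
    interval_cases m <;> decide

lemma le_card_of_three (h : ThreeCycleRep τ) (h5 : 5 ≤ Nat.card Y) (hn : ¬ IsTrivialRep τ)
    (hV : ∀ v : V, 3 • v = 0) : 81 ≤ Nat.card V := by
  obtain ⟨m, hm⟩ := AddCommGroup.exists_card_eq_pow Nat.prime_three hV
  have : Fact (Nat.Prime 5) := ⟨by norm_num⟩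
  by_cases h4 : 4 ≤ m
  · rw [hm]; exact Nat.pow_le_pow_right (n := 3) (by norm_num) h4
  · refine absurd hm (h.card_ne_of_forall h5 hn (p := 5) (by norm_num) h5 Nat.prime_three ?_)
    interval_cases m <;> decide

lemma le_card_of_five_le (h : ThreeCycleRep τ) (h5 : 5 ≤ Nat.card Y) (hn : ¬ IsTrivialRep τ)
    {r : ℕ} (hr : r.Prime) (hr5 : 5 ≤ r) (hV : ∀ v : V, r • v = 0) : 25 ≤ Nat.card V := by
  obtain ⟨m, hm⟩ := AddCommGroup.exists_card_eq_pow hr hV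
  have : Fact r.Prime := ⟨hr⟩
  have : Fact (Nat.Prime 5) := ⟨by norm_num⟩
  match m, hm with
  | 0, hm => exact absurd hm (h.card_ne_of_forall h5 hn (p := 5) (by norm_num) h5 hr (by simp))
  | 1, hm => exact absurd (by rw [hm, pow_one]) (h.card_ne_prime h5 hn (r := r))
  | m + 2, hm =>
    rw [hm]
    calc 25 = 5 ^ 2 := by norm_num
      _ ≤ r ^ 2 := Nat.pow_le_pow_left hr5 2
      _ ≤ r ^ (m + 2) := Nat.pow_le_pow_right hr.pos (by omega)

end ThreeCycleRep

namespace Equiv.Perm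

variable {Y : Type} [DecidableEq Y]

/-- The three-cycle `a ↦ b ↦ c ↦ a`. -/
def tri (a b c : Y) : Equiv.Perm Y := swap a b * swap b c

lemma tri_isThreeCycle [Fintype Y] {a b c : Y} (hab : a ≠ b) (hac : a ≠ c) (hbc : b ≠ c) :
    (tri a b c).IsThreeCycle := by
  rw [tri, swap_comm a b]; exact isThreeCycle_swap_mul_swap_same hab.symm hbc hac

lemma tri_apply_left {a b c : Y} (hab : a ≠ b) (hac : a ≠ c) : tri a b c a = b := by
  simp [tri, swap_apply_of_ne_of_ne hab hac]

lemma tri_apply_mid {a b c : Y} (hac : a ≠ c) (hbc : b ≠ c) : tri a b c b = c := by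
  simp [tri, swap_apply_of_ne_of_ne hac.symm hbc.symm]

lemma tri_apply_right {a b c : Y} : tri a b c c = a := by simp [tri]

lemma tri_apply_of_ne {a b c x : Y} (ha : x ≠ a) (hb : x ≠ b) (hc : x ≠ c) : tri a b c x = x := by
  simp [tri, swap_apply_of_ne_of_ne hb hc, swap_apply_of_ne_of_ne ha hb]

lemma conj_tri (σ : Equiv.Perm Y) (a b c : Y) :
    σ * tri a b c * σ⁻¹ = tri (σ a) (σ b) (σ c) := by
  simp only [tri, swap_apply_apply]; group

lemma tri_rotate {a b c : Y} (hab : a ≠ b) (hac : a ≠ c) (hbc : b ≠ c) :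
    tri a b c = tri b c a := by
  ext x
  by_cases h1 : x = a
  · rw [h1, tri_apply_left hab hac, tri_apply_right]
  by_cases h2 : x = b
  · rw [h2, tri_apply_mid hac hbc, tri_apply_left hbc hab.symm]
  by_cases h3 : x = c
  · rw [h3, tri_apply_right, tri_apply_mid hab.symm hac.symm]
  · rw [tri_apply_of_ne h1 h2 h3, tri_apply_of_ne h2 h3 h1]

lemma tri_inv (a b c : Y) : (tri a b c)⁻¹ = tri c b a := by
  rw [tri, tri, mul_inv_rev, swap_inv, swap_inv, swap_comm b c, swap_comm a b]

lemma IsThreeCycle.exists_eq_tri [Fintype Y] {g : Equiv.Perm Y} (h : g.IsThreeCycle) :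
    ∃ a b c : Y, a ≠ b ∧ a ≠ c ∧ b ≠ c ∧ g = tri a b c := by
  obtain ⟨a, ha⟩ := h.isCycle.nonempty_support
  have h3 : g ^ 3 = 1 := h.orderOf ▸ pow_orderOf_eq_one g
  have h3' : ∀ x, g (g (g x)) = x := fun x => by
    have := DFunLike.congr_fun h3 x
    simpa [pow_succ] using this
  have e1 : a ≠ g a := (mem_support.1 ha).symm
  have e2 : g a ≠ g (g a) := fun e => e1 (g.injective e)
  have e3 : a ≠ g (g a) := fun e => e2 (by nth_rewrite 1 [e]; rw [h3', ← e])
  exact ⟨a, g a, g (g a), e1, e3, e2, h.eq_swap_mul_swap_iff_mem_support.2 ha⟩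

/-- A class of three-cycles closed under conjugation and containing all `(a b z)` is everything. -/
lemma IsThreeCycle.induction_tri [Fintype Y] (Q : Equiv.Perm Y → Prop)
    (hinv : ∀ c : Equiv.Perm Y, c.IsThreeCycle → Q c → Q c⁻¹)
    (hconj : ∀ c d : Equiv.Perm Y, c.IsThreeCycle → d.IsThreeCycle → Q c → Q d →
      Q (c * d * c⁻¹)) {a b : Y} (hab : a ≠ b) (h0 : ∀ z, a ≠ z → b ≠ z → Q (tri a b z))
    {c : Equiv.Perm Y} (hc : c.IsThreeCycle) : Q c := by
  have rot : ∀ {x y z : Y}, x ≠ y → x ≠ z → y ≠ z → Q (tri y z x) → Q (tri x y z) :=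
    fun h1 h2 h3 h => by rwa [tri_rotate h1 h2 h3]
  have h2 : ∀ p y : Y, a ≠ p → b ≠ p → a ≠ y → b ≠ y → p ≠ y → Q (tri b p y) := by
    intro p y ap bp ay yb py
    have := hconj _ _ (tri_isThreeCycle hab ap bp) (tri_isThreeCycle hab ay yb) (h0 p ap bp)
      (h0 y ay yb)
    rwa [conj_tri, tri_apply_left hab ap, tri_apply_mid ap bp,
      tri_apply_of_ne ay.symm yb.symm py.symm] at this
  have h3 : ∀ p y : Y, a ≠ p → b ≠ p → a ≠ y → b ≠ y → p ≠ y → Q (tri p a y) := by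
    intro p y ap bp ay yb py
    have := hconj _ _ (tri_isThreeCycle hab ap bp).inv (tri_isThreeCycle hab ay yb)
      (hinv _ (tri_isThreeCycle hab ap bp) (h0 p ap bp)) (h0 y ay yb)
    rwa [conj_tri, tri_inv, tri_apply_right, tri_apply_mid ap.symm hab.symm,
      tri_apply_of_ne py.symm yb.symm ay.symm] at this
  have h4 : ∀ p s y : Y, a ≠ p → b ≠ p → a ≠ s → b ≠ s → a ≠ y → b ≠ y → p ≠ s → p ≠ y → s ≠ y →
      Q (tri p s y) := by
    intro p s y ap bp as bs ay yb ps py sy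
    have := hconj _ _ (tri_isThreeCycle bp bs ps) (tri_isThreeCycle bp yb py)
      (h2 p s ap bp as bs ps) (h2 p y ap bp ay yb py)
    rwa [conj_tri, tri_apply_left bp bs, tri_apply_mid bs ps,
      tri_apply_of_ne yb.symm py.symm sy.symm] at this
  have hba : ∀ z, a ≠ z → b ≠ z → Q (tri z b a) := fun z az bz => by
    rw [← tri_inv]; exact hinv _ (tri_isThreeCycle hab az bz) (h0 z az bz)
  obtain ⟨x, y, z, xy, xz, yz, rfl⟩ := hc.exists_eq_tri
  by_cases xa : a = x
  · subst xa
    by_cases yb : b = y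
    · subst yb; exact h0 z xz yz
    by_cases zb : b = z
    · subst zb; exact rot xy xz yz (hba y xy yb)
    exact rot xy xz yz (rot yz xy.symm xz.symm (h3 z y xz zb xy yb yz.symm))
  by_cases xb : b = x
  · subst xb
    by_cases ya : a = y
    · subst ya; exact rot xy xz yz (rot yz xy.symm xz.symm (hba z yz xz))
    by_cases za : a = z
    · subst za; exact rot xy xz yz (rot yz xy.symm xz.symm (h0 y ya xy))
    exact h2 y z ya xy za xz yz
  by_cases ya : a = y
  · subst ya
    by_cases zb : b = z
    · subst zb; exact rot xy xz yz (h0 x xy.symm xz.symm)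
    exact h3 x z xa xb yz zb xz
  by_cases yb : b = y
  · subst yb
    by_cases za : a = z
    · subst za; exact hba x xa xb
    exact rot xy xz yz (h2 z x za yz xa xb xz.symm)
  by_cases za : a = z
  · subst za; exact rot xy xz yz (h3 y x ya yb xa xb xy.symm)
  by_cases zb : b = z
  · subst zb; exact rot xy xz yz (rot yz xy.symm xz.symm (h2 x y xa xb ya yb xy))
  exact h4 x y z xa xb ya yb za zb xy xz yz

/-- Two three-cycles are disjoint or have a common disjoint three-cycle. -/
lemma IsThreeCycle.induction_disjoint [Fintype Y] (h9 : 8 ≤ Nat.card Y)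
    (R : Equiv.Perm Y → Equiv.Perm Y → Prop)
    (htrans : ∀ a b c, R a b → R b c → R a c)
    (hR : ∀ c d : Equiv.Perm Y, c.IsThreeCycle → d.IsThreeCycle → Disjoint c d → R c d)
    {c d : Equiv.Perm Y} (hc : c.IsThreeCycle) (hd : d.IsThreeCycle) : R c d := by
  by_cases hdis : Disjoint c d
  · exact hR c d hc hd hdis
  have hcard : (c.support ∪ d.support).card ≤ 5 := by
    rw [disjoint_iff_disjoint_support, Finset.not_disjoint_iff] at hdis
    obtain ⟨x, hx1, hx2⟩ := hdis
    have h1 := Finset.card_union_add_card_inter c.support d.support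
    have h2 : 0 < (c.support ∩ d.support).card :=
      Finset.card_pos.2 ⟨x, Finset.mem_inter.2 ⟨hx1, hx2⟩⟩
    rw [hc.card_support, hd.card_support] at h1
    omega
  have h3 : 2 < (c.support ∪ d.support)ᶜ.card := by
    rw [Finset.card_compl, ← Nat.card_eq_fintype_card]; omega
  obtain ⟨x, y, z, hx, hy, hz, xy, xz, yz⟩ := Finset.two_lt_card_iff.1 h3
  simp only [Finset.mem_compl, Finset.mem_union, not_or, notMem_support] at hx hy hz
  have he := tri_isThreeCycle xy xz yz
  have hdj : ∀ f : Equiv.Perm Y, f x = x → f y = y → f z = z → Disjoint f (tri x y z) := by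
    intro f fx fy fz t
    by_cases tx : t = x
    · left; rw [tx, fx]
    by_cases ty : t = y
    · left; rw [ty, fy]
    by_cases tz : t = z
    · left; rw [tz, fz]
    · right; exact tri_apply_of_ne tx ty tz
  exact htrans _ _ _ (hR c _ hc he (hdj c hx.1 hy.1 hz.1))
    (hR _ d he hd (hdj d hx.2 hy.2 hz.2).symm)

end Equiv.Perm

lemma AddSubgroup.mul_card_le_of_lt {V : Type} [AddCommGroup V] [Finite V] {r : ℕ}
    (hr : r.Prime) (hV : ∀ v : V, r • v = 0) {W W' : AddSubgroup V} (h : W < W') :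
    r * Nat.card W ≤ Nat.card W' := by
  have h1 : ∀ U : AddSubgroup V, ∃ m, Nat.card U = r ^ m := fun U =>
    AddCommGroup.exists_card_eq_pow hr fun v => Subtype.ext (hV v)
  obtain ⟨m, hm⟩ := h1 W
  obtain ⟨m', hm'⟩ := h1 W'
  have hlt : Nat.card W < Nat.card W' := by
    have := Set.ncard_lt_ncard (SetLike.coe_ssubset_coe.2 h)
    rwa [← Nat.card_coe_set_eq, ← Nat.card_coe_set_eq] at this
  rw [hm, hm'] at hlt ⊢
  rw [← pow_succ']
  exact Nat.pow_le_pow_right hr.pos ((Nat.pow_lt_pow_iff_right hr.one_lt).1 hlt)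

lemma AddSubgroup.le_card_of_ne_bot {V : Type} [AddCommGroup V] [Finite V] {r : ℕ}
    (hr : r.Prime) (hV : ∀ v : V, r • v = 0) {W : AddSubgroup V} (h : W ≠ ⊥) :
    r ≤ Nat.card W := by
  simpa using AddSubgroup.mul_card_le_of_lt hr hV (bot_lt_iff_ne_bot.2 h)

/-- The endomorphism `u - 1`. -/
def unitsDelta {V : Type} [AddCommGroup V] (u : (AddMonoid.End V)ˣ) : V →+ V :=
  AddMonoidHom.mk' (fun v => u • v - v) fun a b => by rw [smul_add]; abel

lemma unitsDelta_apply {V : Type} [AddCommGroup V] (u : (AddMonoid.End V)ˣ) (v : V) :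
    unitsDelta u v = u • v - v := rfl

lemma mem_ker_unitsDelta {V : Type} [AddCommGroup V] {u : (AddMonoid.End V)ˣ} {v : V} :
    v ∈ (unitsDelta u).ker ↔ u • v = v := by
  rw [AddMonoidHom.mem_ker, unitsDelta_apply, sub_eq_zero]

namespace ThreeCycleRep

variable {Y V : Type} [Fintype Y] [DecidableEq Y] [AddCommGroup V] [Finite V]
  {τ : Equiv.Perm Y → (AddMonoid.End V)ˣ}

lemma card_ker_eq (h : ThreeCycleRep τ) (h5 : 5 ≤ Nat.card Y) {c d : Equiv.Perm Y}
    (hc : c.IsThreeCycle) (hd : d.IsThreeCycle) :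
    Nat.card (unitsDelta (τ c)).ker = Nat.card (unitsDelta (τ d)).ker := by
  obtain ⟨σ, hσ, rfl⟩ := exists_conj h5 hc hd
  obtain ⟨g, -, hg⟩ := h.exists_lift hσ
  refine Nat.card_congr ((MulAction.toPerm g).subtypeEquiv fun v => ?_)
  change v ∈ (unitsDelta (τ c)).ker ↔ g • v ∈ (unitsDelta (τ (σ * c * σ⁻¹))).ker
  rw [mem_ker_unitsDelta, mem_ker_unitsDelta, ← hg c hc, mul_smul, inv_smul_smul, mul_smul]
  exact (smul_left_cancel_iff g).symm

lemma commute_of_disjoint (h : ThreeCycleRep τ) {c d : Equiv.Perm Y} (hc : c.IsThreeCycle)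
    (hd : d.IsThreeCycle) (hcd : Disjoint c d) : τ c * τ d = τ d * τ c := by
  rw [← mul_inv_eq_iff_eq_mul, h.conj c d hc hd, hcd.commute.eq, mul_inv_cancel_right]

lemma smul_mem_of_conj (h : ThreeCycleRep τ) {c d : Equiv.Perm Y} (hc : c.IsThreeCycle)
    (hd : d.IsThreeCycle) {v : V} (hv : τ (c * d * c⁻¹) • v = v) :
    τ d • (τ c)⁻¹ • v = (τ c)⁻¹ • v := by
  rw [← h.conj c d hc hd, mul_smul, mul_smul] at hv
  nth_rewrite 2 [← hv]
  rw [inv_smul_smul]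

lemma mem_fixed_of_tri (h : ThreeCycleRep τ) {a b : Y} (hab : a ≠ b) {v : V}
    (hv : ∀ z, a ≠ z → b ≠ z → τ (tri a b z) • v = v) : v ∈ fixed τ := by
  intro c hc
  refine IsThreeCycle.induction_tri (fun c => τ c • v = v) ?_ ?_ hab hv hc
  · intro c hc hv
    rw [h.inv c hc, inv_smul_eq_iff, hv]
  · intro c d hc hd hv hv'
    rw [← h.conj c d hc hd, mul_smul, mul_smul, inv_smul_eq_iff.2 hv.symm, hv', hv]

variable (τ) in
/-- The common fixed points of the three-cycles `(a b z)`, `z ∈ Z`. -/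
def fixedTri (a b : Y) (Z : Finset Y) : AddSubgroup V :=
  ⨅ z ∈ Z, (unitsDelta (τ (tri a b z))).ker

lemma mem_fixedTri {a b : Y} {Z : Finset Y} {v : V} :
    v ∈ fixedTri τ a b Z ↔ ∀ z ∈ Z, τ (tri a b z) • v = v := by
  simp only [fixedTri, AddSubgroup.mem_iInf, mem_ker_unitsDelta]

lemma fixedTri_le_fixed (h : ThreeCycleRep τ) {a b x : Y} (hab : a ≠ b) {Z : Finset Y}
    (ha : a ∉ Z) (hb : b ∉ Z) (hx : x ∉ Z) (hax : a ≠ x) (hbx : b ≠ x)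
    (hout : ∀ z, ∃ w, w ∉ Z ∧ w ≠ a ∧ w ≠ b ∧ w ≠ x ∧ w ≠ z)
    (hle : fixedTri τ a b Z ≤ fixedTri τ a b (insert x Z)) : fixedTri τ a b Z ≤ fixed τ := by
  intro v hv
  refine h.mem_fixed_of_tri hab fun z az bz => ?_
  rw [mem_fixedTri] at hv
  by_cases hz : z ∈ Z
  · exact hv z hz
  by_cases hzx : z = x
  · exact mem_fixedTri.1 (hle (mem_fixedTri.2 hv)) z (by simp [hzx])
  obtain ⟨w, hwZ, wa, wb, wx, wz⟩ := hout z
  have hs := tri_isThreeCycle (Ne.symm hzx) wx.symm wz.symm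
  have hfix : ∀ y, y ≠ x → y ≠ z → y ≠ w → tri x z w y = y := fun y h1 h2 h3 =>
    tri_apply_of_ne h1 h2 h3
  have h1 : (τ (tri x z w))⁻¹ • v ∈ fixedTri τ a b Z := by
    refine mem_fixedTri.2 fun y hy => ?_
    have hya : a ≠ y := fun e => ha (e ▸ hy)
    have hyb : b ≠ y := fun e => hb (e ▸ hy)
    refine h.smul_mem_of_conj hs (tri_isThreeCycle hab hya hyb) ?_
    rw [conj_tri, hfix a hax az wa.symm, hfix b hbx bz wb.symm,
      hfix y (fun e => hx (e ▸ hy)) (fun e => hz (e ▸ hy)) (fun e => hwZ (e ▸ hy))]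
    exact hv y hy
  have h2 := mem_fixedTri.1 (hle h1) x (Finset.mem_insert_self x Z)
  have h3 := h.conj _ _ hs (tri_isThreeCycle hab hax hbx)
  rw [conj_tri, hfix a hax az wa.symm, hfix b hbx bz wb.symm,
    tri_apply_left (Ne.symm hzx) wx.symm] at h3
  rw [← h3, mul_smul, mul_smul, h2, smul_inv_smul]

lemma pow_mul_card_le (h : ThreeCycleRep τ) {r : ℕ} (hr : r.Prime) (hV : ∀ v : V, r • v = 0)
    (hfix : fixed τ = ⊥) {a b : Y} (hab : a ≠ b) {U S : Finset Y} (ha : a ∉ U) (hb : b ∉ U)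
    (hS : 2 ≤ S.card) (hSU : ∀ s ∈ S, s ∉ U ∧ s ≠ a ∧ s ≠ b)
    (hne : fixedTri τ a b U ≠ ⊥) (n : ℕ) : ∀ Z ⊆ U, (U \ Z).card = n →
      r ^ n * Nat.card (fixedTri τ a b U) ≤ Nat.card (fixedTri τ a b Z) := by
  induction n with
  | zero =>
    intro Z hZ hn
    rw [Finset.card_eq_zero, Finset.sdiff_eq_empty_iff_subset] at hn
    rw [hZ.antisymm hn, pow_zero, one_mul]
  | succ n ih =>
    intro Z hZ hn
    obtain ⟨x, hx⟩ := Finset.card_pos.1 (by omega : 0 < (U \ Z).card)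
    have hxU := (Finset.mem_sdiff.1 hx).1
    have hxZ := (Finset.mem_sdiff.1 hx).2
    have h1 := ih (insert x Z) (Finset.insert_subset hxU hZ) (by
      rw [Finset.sdiff_insert, Finset.card_erase_of_mem hx, hn]; omega)
    have hmono : ∀ Z' : Finset Y, Z ⊆ Z' → fixedTri τ a b Z' ≤ fixedTri τ a b Z :=
      fun Z' hh v hv => mem_fixedTri.2 fun z hz => mem_fixedTri.1 hv z (hh hz)
    have hlt : fixedTri τ a b (insert x Z) < fixedTri τ a b Z := by
      refine lt_of_le_not_ge (hmono _ (Finset.subset_insert x Z)) fun hle => hne ?_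
      refine eq_bot_iff.2 (hfix ▸ (hmono U hZ).trans ?_)
      refine h.fixedTri_le_fixed hab (fun e => ha (hZ e)) (fun e => hb (hZ e)) hxZ
        (fun e => ha (e ▸ hxU)) (fun e => hb (e ▸ hxU)) ?_ hle
      intro z
      obtain ⟨w, hw, hwz⟩ := Finset.exists_mem_ne (by omega : 1 < S.card) z
      obtain ⟨s1, s2, s3⟩ := hSU w hw
      exact ⟨w, fun e => s1 (hZ e), s2, s3, fun e => s1 (e ▸ hxU), hwz⟩
    calc r ^ (n + 1) * Nat.card (fixedTri τ a b U)
        = r * (r ^ n * Nat.card (fixedTri τ a b U)) := by rw [pow_succ']; ring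
      _ ≤ r * Nat.card (fixedTri τ a b (insert x Z)) := Nat.mul_le_mul_left r h1
      _ ≤ _ := AddSubgroup.mul_card_le_of_lt hr hV hlt

/-- The bound when the three-cycles disjoint from `c` centralize the image of `τ c - 1`. -/
theorem le_card_of_trivial_range (h : ThreeCycleRep τ) (h9 : 9 ≤ Nat.card Y)
    (hn : ¬ IsTrivialRep τ) {r : ℕ} (hr : r.Prime) (hV : ∀ v : V, r • v = 0)
    (hfix : fixed τ = ⊥) {c : Equiv.Perm Y} (hc : c.IsThreeCycle)
    (htriv : ∀ d : Equiv.Perm Y, d.IsThreeCycle → Disjoint c d →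
      ∀ w ∈ (unitsDelta (τ c)).range, τ d • w = w) :
    2 ^ (Nat.card Y - 2) ≤ Nat.card V := by
  have hB : (unitsDelta (τ c)).range ≠ ⊥ := by
    intro hb
    refine hn (h.isTrivialRep_of_eq_one (by omega) hc (AddMonoid.End.units_ext fun v => ?_))
    have : unitsDelta (τ c) v ∈ (unitsDelta (τ c)).range := ⟨v, rfl⟩
    rw [hb, AddSubgroup.mem_bot, unitsDelta_apply, sub_eq_zero] at this
    rw [this, one_smul]
  have hcompl : c.supportᶜ.card = Nat.card Y - 3 := by
    rw [Finset.card_compl, hc.card_support, Nat.card_eq_fintype_card]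
  obtain ⟨a, b, y, ha, hb, hy, hab, hay, hby⟩ :=
    Finset.two_lt_card_iff.1 (by omega : 2 < c.supportᶜ.card)
  have hcard : ((c.supportᶜ.erase a).erase b).card = Nat.card Y - 5 := by
    rw [Finset.card_erase_of_mem (Finset.mem_erase.2 ⟨hab.symm, hb⟩),
      Finset.card_erase_of_mem ha, hcompl]
    omega
  obtain ⟨U, hU⟩ : ∃ U, U = (c.supportᶜ.erase a).erase b := ⟨_, rfl⟩
  have hyU : y ∈ U := by
    rw [hU, Finset.mem_erase, Finset.mem_erase]; exact ⟨hby.symm, hay.symm, hy⟩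
  have hBU : (unitsDelta (τ c)).range ≤ fixedTri τ a b U := by
    intro w hw
    refine mem_fixedTri.2 fun z hz => ?_
    rw [hU, Finset.mem_erase, Finset.mem_erase] at hz
    refine htriv _ (tri_isThreeCycle hab hz.2.1.symm hz.1.symm) ?_ w hw
    intro x
    by_cases hx : c x = x
    · exact Or.inl hx
    · have hxs := mem_support.2 hx
      have hne : ∀ t, t ∈ c.supportᶜ → x ≠ t := fun t ht e => Finset.mem_compl.1 ht (e ▸ hxs)
      exact Or.inr (tri_apply_of_ne (hne a ha) (hne b hb) (hne z hz.2.2))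
  have key := h.pow_mul_card_le hr hV hfix hab (U := U) (S := c.support)
    (by simp [hU]) (by simp [hU]) (by rw [hc.card_support]; omega)
    (by
      intro s hs
      have hne : ∀ t, t ∈ c.supportᶜ → s ≠ t := fun t ht e => Finset.mem_compl.1 ht (e ▸ hs)
      exact ⟨by simpa [hU] using fun _ _ => mem_support.1 hs, hne a ha, hne b hb⟩)
    (fun e => hB (eq_bot_iff.2 (e ▸ hBU))) (Nat.card Y - 6) {y} (by simpa using hyU) (by
      rw [Finset.sdiff_singleton_eq_erase, Finset.card_erase_of_mem hyU, hU, hcard]; omega)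
  have hsing : fixedTri τ a b {y} = (unitsDelta (τ (tri a b y))).ker := by
    simp [fixedTri]
  rw [hsing, h.card_ker_eq (by omega) (tri_isThreeCycle hab hay hby) hc] at key
  have hBle : Nat.card (unitsDelta (τ c)).range ≤ Nat.card (fixedTri τ a b U) :=
    AddSubgroup.card_le_of_le hBU
  have hVcard := (unitsDelta (τ c)).card_ker_mul_card_range
  have hrB := AddSubgroup.le_card_of_ne_bot hr hV hB
  obtain ⟨m, hm⟩ : ∃ m, Nat.card Y = m + 9 := ⟨Nat.card Y - 9, by omega⟩
  rw [hm] at key ⊢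
  simp only [show m + 9 - 6 = m + 3 from rfl, show m + 9 - 2 = m + 7 from rfl] at key ⊢
  have hfinal : ∀ s q : ℕ, s ≤ r → q ≤ Nat.card (unitsDelta (τ c)).range →
      s ^ (m + 3) * q * q ≤ Nat.card V := by
    intro s q hs hq
    rw [← hVcard]
    refine Nat.mul_le_mul (le_trans ?_ key) hq
    exact Nat.mul_le_mul (Nat.pow_le_pow_left hs _) (hq.trans hBle)
  rcases hr.two_le.eq_or_lt with h2 | h3
  · have h4 : 4 ≤ Nat.card (unitsDelta (τ c)).range := by
      obtain ⟨e, he⟩ := AddCommGroup.exists_card_eq_pow (V := (unitsDelta (τ c)).range) hr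
        fun v => Subtype.ext (hV v)
      rw [← h2] at he hrB
      match e, he with
      | 0, he => omega
      | 1, he =>
        exfalso
        obtain ⟨w, hw⟩ := AddSubgroup.ne_bot_iff_exists_ne_zero.1 hB
        have hw0 : (w : V) ≠ 0 := fun e => hw (Subtype.ext e)
        obtain ⟨v, hv⟩ := w.2
        have hcw : τ c • (w : V) ∈ (unitsDelta (τ c)).range := by
          rw [← hv, unitsDelta_apply, smul_sub]
          exact ⟨τ c • v, rfl⟩
        have huniq : τ c • (w : V) = w := by
          have h0 : Nat.card (unitsDelta (τ c)).range = 2 := he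
          obtain ⟨p, q, hpq, huniv⟩ := Nat.card_eq_two_iff.1 h0
          have hall : ∀ z : (unitsDelta (τ c)).range, z = p ∨ z = q := fun z => by
            have : z ∈ ({p, q} : Set _) := huniv ▸ Set.mem_univ z
            simpa using this
          by_contra hne
          have n1 : (⟨_, hcw⟩ : (unitsDelta (τ c)).range) ≠ w := fun e => hne (congrArg Subtype.val e)
          have n2 : (⟨_, hcw⟩ : (unitsDelta (τ c)).range) ≠ 0 := fun e => by
            have := congrArg Subtype.val e
            exact hw0 ((smul_eq_zero_iff_eq (τ c)).1 this)
          have n3 : w ≠ 0 := fun e => hw0 (by rw [e]; rfl)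
          rcases hall ⟨_, hcw⟩ with e1 | e1 <;> rcases hall w with e2 | e2 <;>
            rcases hall 0 with e3 | e3 <;> simp_all
        have e1 : τ c • v = v + w := by rw [← hv, unitsDelta_apply]; abel
        have e3 : τ c • τ c • τ c • v = v := by
          rw [← mul_smul, ← mul_smul, ← pow_two, ← pow_succ, h.cube c hc, one_smul]
        simp only [e1, smul_add, huniq] at e3
        have e4 : (2 : ℕ) • (w : V) + w = 0 := by
          rw [two_nsmul]
          have : v + ↑w + ↑w + ↑w = v + (↑w + ↑w + ↑w) := by abel
          rw [this] at e3
          exact add_eq_left.1 e3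
        rw [h2, hV, zero_add] at e4
        exact hw0 e4
      | e + 2, he => rw [he, pow_add]; have := Nat.one_le_two_pow (n := e); omega
    have := hfinal 2 4 hr.two_le h4
    calc 2 ^ (m + 7) = 2 ^ (m + 3) * 4 * 4 := by ring
      _ ≤ _ := this
  · have := hfinal 3 3 h3 (le_trans h3 hrB)
    have hp : 2 ^ m ≤ 3 ^ m := Nat.pow_le_pow_left (by norm_num) m
    calc 2 ^ (m + 7) = 128 * 2 ^ m := by ring
      _ ≤ 243 * 3 ^ m := by omega
      _ = 3 ^ (m + 3) * 3 * 3 := by ring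
      _ ≤ _ := this

end ThreeCycleRep

section FixedPointFree

variable {V : Type} [AddCommGroup V] {u w : (AddMonoid.End V)ˣ}

/-- The subgroup on which two automorphisms agree. -/
def unitsEqLocus (u w : (AddMonoid.End V)ˣ) : AddSubgroup V where
  carrier := {v | w • v = u • v}
  add_mem' := fun ha hb => by
    rw [Set.mem_ofPred_eq] at *; rw [smul_add, smul_add, ha, hb]
  zero_mem' := by rw [Set.mem_ofPred_eq, smul_zero, smul_zero]
  neg_mem' := fun ha => by
    rw [Set.mem_ofPred_eq] at *; rw [smul_neg, smul_neg, ha]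

lemma mem_unitsEqLocus {v : V} : v ∈ unitsEqLocus u w ↔ w • v = u • v := Iff.rfl

lemma inv_smul_of_cube (hu : u ^ 3 = 1) (hfu : ∀ v : V, u • v = v → v = 0) (v : V) :
    u⁻¹ • v = -v - u • v := by
  have h1 : u • u • u • v = v := by
    rw [← mul_smul, ← mul_smul, ← pow_two, ← pow_succ, hu, one_smul]
  have h2 := hfu (u⁻¹ • v + v + u • v) (by
    rw [smul_add, smul_add, smul_inv_smul]
    have : u • u • v = u⁻¹ • v := by rw [eq_inv_smul_iff, h1]
    rw [this]; abel)
  rw [eq_neg_of_add_eq_zero_left (a := u⁻¹ • v) (b := v + u • v) (by rw [← h2]; abel)]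
  abel

lemma eq_zero_of_inv_smul_eq (hu : u ^ 3 = 1) (hfu : ∀ v : V, u • v = v → v = 0) {v : V}
    (hv : u⁻¹ • v = u • v) : v = 0 := by
  refine hfu v ?_
  have h1 : u • u • u • v = v := by
    rw [← mul_smul, ← mul_smul, ← pow_two, ← pow_succ, hu, one_smul]
  have h2 : v = u • u • v := by rw [← hv, smul_inv_smul]
  rw [← h2] at h1
  exact h1

/-- Two commuting fixed-point-free automorphisms of order three split a group into the parts on
which they agree and on which they are inverse to each other. -/
lemma card_eq_card_inf_mul_card_inf [Finite V] (hu : u ^ 3 = 1) (hw : w ^ 3 = 1)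
    (hfu : ∀ v : V, u • v = v → v = 0) (hfw : ∀ v : V, w • v = v → v = 0) (huw : u * w = w * u)
    (W : AddSubgroup V) (hWu : ∀ v ∈ W, u • v ∈ W) (hWw : ∀ v ∈ W, w • v ∈ W) :
    Nat.card W = Nat.card (W ⊓ unitsEqLocus u w : AddSubgroup V) *
      Nat.card (W ⊓ unitsEqLocus u⁻¹ w : AddSubgroup V) := by
  have hcomm : ∀ v : V, u • w • v = w • u • v := fun v => by rw [← mul_smul, huw, mul_smul]
  have hww : ∀ v : V, w • w • v = -v - w • v := fun v => by
    rw [← inv_smul_of_cube hw hfw, eq_inv_smul_iff, ← mul_smul, ← mul_smul, ← pow_two, ← pow_succ,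
      hw, one_smul]
  have huu : ∀ v : V, u • u • v = -v - u • v := fun v => by
    rw [← inv_smul_of_cube hu hfu, eq_inv_smul_iff, ← mul_smul, ← mul_smul, ← pow_two, ← pow_succ,
      hu, one_smul]
  have hui := inv_smul_of_cube hu hfu
  have hzero : ∀ v : V, w • v = u • v → w • v = u⁻¹ • v → v = 0 := fun v h1 h2 =>
    eq_zero_of_inv_smul_eq hu hfu (h2.symm.trans h1)
  rw [← Nat.card_prod]
  refine le_antisymm (Nat.card_le_card_of_injective (fun v : W =>
    (⟨⟨w • (v : V) - u⁻¹ • (v : V), AddSubgroup.mem_inf.2 ⟨?_, ?_⟩⟩,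
      ⟨w • (v : V) - u • (v : V), AddSubgroup.mem_inf.2 ⟨?_, ?_⟩⟩⟩ :
      (W ⊓ unitsEqLocus u w : AddSubgroup V) × (W ⊓ unitsEqLocus u⁻¹ w : AddSubgroup V))) ?_)
    (Nat.card_le_card_of_injective (fun p : (W ⊓ unitsEqLocus u w : AddSubgroup V) ×
      (W ⊓ unitsEqLocus u⁻¹ w : AddSubgroup V) => (⟨p.1 + p.2, W.add_mem
        (AddSubgroup.mem_inf.1 p.1.2).1 (AddSubgroup.mem_inf.1 p.2.2).1⟩ : W)) ?_)
  · rw [hui]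
    exact W.sub_mem (hWw _ v.2) (W.sub_mem (W.neg_mem v.2) (hWu _ v.2))
  · rw [mem_unitsEqLocus, hui]
    simp only [smul_sub, smul_neg, hww, huu, hcomm]
    abel
  · exact W.sub_mem (hWw _ v.2) (hWu _ v.2)
  · rw [mem_unitsEqLocus, hui]
    simp only [smul_sub, hww, huu, hcomm]
    abel
  · intro v v' hvv
    have h1 := congrArg (fun p => (p.1 : V)) hvv
    have h2 := congrArg (fun p => (p.2 : V)) hvv
    simp only at h1 h2
    refine Subtype.ext (sub_eq_zero.1 (hzero _ ?_ ?_))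
    · rw [smul_sub, smul_sub, sub_eq_sub_iff_sub_eq_sub]
      exact h2
    · rw [smul_sub, smul_sub, sub_eq_sub_iff_sub_eq_sub]
      exact h1
  · rintro ⟨a, b⟩ ⟨a', b'⟩ hab
    have h1 : (a : V) + b = a' + b' := congrArg Subtype.val hab
    have ha := mem_unitsEqLocus.1 (AddSubgroup.mem_inf.1 (AddSubgroup.sub_mem _ a.2 a'.2)).2
    have hb := mem_unitsEqLocus.1 (AddSubgroup.mem_inf.1 (AddSubgroup.sub_mem _ b'.2 b.2)).2
    have h2 : (a : V) - a' = b' - b := sub_eq_sub_iff_add_eq_add.2 (by rw [h1, add_comm])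
    have h3 := hzero _ ha (h2 ▸ hb)
    have h4 : (b' : V) - b = 0 := h2 ▸ h3
    exact Prod.ext (Subtype.ext (sub_eq_zero.1 h3)) (Subtype.ext (sub_eq_zero.1 h4).symm)

lemma card_mod_three_eq_one [Finite V] (hu : u ^ 3 = 1) (hfu : ∀ v : V, u • v = v → v = 0)
    (W : AddSubgroup V) (hWu : ∀ v ∈ W, u • v ∈ W) : Nat.card W % 3 = 1 := by
  classical
  have := Fintype.ofFinite W
  have hf : Function.Injective fun v : W => (⟨u • (v : V), hWu _ v.2⟩ : W) := fun a b hab =>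
    Subtype.ext (smul_left_cancel u (congrArg Subtype.val hab))
  have : Fact (Nat.Prime 3) := ⟨Nat.prime_three⟩
  have h1 := Equiv.Perm.card_fixedPoints_modEq (p := 3) (n := 1)
    (f := fun v : W => (⟨u • (v : V), hWu _ v.2⟩ : W)) (by
      funext v
      refine Subtype.ext ?_
      change u • u • u • (v : V) = v
      rw [← mul_smul, ← mul_smul, ← pow_two, ← pow_succ, hu, one_smul])
  have h2 : Fintype.card (Function.fixedPoints
      fun v : W => (⟨u • (v : V), hWu _ v.2⟩ : W)) = 1 := by
    rw [Fintype.card_eq_one_iff]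
    refine ⟨⟨0, Subtype.ext (smul_zero u)⟩, fun v => Subtype.ext (Subtype.ext ?_)⟩
    exact hfu _ (congrArg Subtype.val v.2)
  rw [h2] at h1
  rw [Nat.card_eq_fintype_card]
  exact h1

end FixedPointFree

namespace ThreeCycleRep

variable {Y V : Type} [Fintype Y] [DecidableEq Y] [AddCommGroup V] [Finite V]
  {τ : Equiv.Perm Y → (AddMonoid.End V)ˣ}

lemma eq_zero_of_trivial_ker (h : ThreeCycleRep τ) (h8 : 8 ≤ Nat.card Y) (hfix : fixed τ = ⊥)
    {c : Equiv.Perm Y} (hc : c.IsThreeCycle)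
    (htriv : ∀ d : Equiv.Perm Y, d.IsThreeCycle → Disjoint c d →
      ∀ v : V, τ c • v = v → τ d • v = v) (d : Equiv.Perm Y) (hd : d.IsThreeCycle) (v : V)
    (hv : τ d • v = v) : v = 0 := by
  have hall : ∀ c' d' : Equiv.Perm Y, c'.IsThreeCycle → d'.IsThreeCycle → Disjoint c' d' →
      ∀ v : V, τ c' • v = v → τ d' • v = v := by
    intro c' d' hc' hd' hdis v hv
    obtain ⟨σ, hσ, rfl⟩ := exists_conj (by omega) hc hc'
    obtain ⟨g, -, hg⟩ := h.exists_lift hσ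
    have hd'' : (σ⁻¹ * d' * σ).IsThreeCycle := by simpa using hd'.conj σ⁻¹
    have e1 : σ * (σ⁻¹ * d' * σ) * σ⁻¹ = d' := by group
    have hdis' : Disjoint c (σ⁻¹ * d' * σ) := by
      have := hdis.conj σ⁻¹
      simpa [mul_assoc] using this
    have h1 := htriv _ hd'' hdis' (g⁻¹ • v) (by
      rw [← hg c hc, mul_smul, mul_smul] at hv
      nth_rewrite 2 [← hv]
      rw [inv_smul_smul])
    rw [← e1, ← hg _ hd'', mul_smul, mul_smul, h1, smul_inv_smul]
  have : v ∈ fixed τ := fun c hc => IsThreeCycle.induction_disjoint h8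
    (fun c d => ∀ v : V, τ c • v = v → τ d • v = v) (fun a b c h1 h2 v hv => h2 v (h1 v hv))
    hall hd hc v hv
  rwa [hfix, AddSubgroup.mem_bot] at this

end ThreeCycleRep

section FixedPointFree

variable {V : Type} [AddCommGroup V] [Finite V]

lemma AddSubgroup.card_le_of_forall_smul_mem (g : (AddMonoid.End V)ˣ) {W W' : AddSubgroup V}
    (h : ∀ v ∈ W, g • v ∈ W') : Nat.card W ≤ Nat.card W' :=
  Nat.card_le_card_of_injective (fun v : W => (⟨g • (v : V), h v v.2⟩ : W')) fun _ _ hab =>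
    Subtype.ext (smul_left_cancel g (congrArg Subtype.val hab))

lemma card_unitsEqLocus_inv {u w g : (AddMonoid.End V)ˣ}
    (hgu : ∀ v : V, u • g • v = g • u • v) (hgw : ∀ v : V, w⁻¹ • g • v = g • w • v)
    (hu : u ^ 3 = 1) (hfu : ∀ v : V, u • v = v → v = 0)
    (hw : w ^ 3 = 1) (hfw : ∀ v : V, w • v = v → v = 0) :
    Nat.card (unitsEqLocus u⁻¹ w) = Nat.card (unitsEqLocus u w) := by
  have hgw' : ∀ v : V, w • g • v = -(g • v) - g • w • v := fun v => by
    rw [← hgw, inv_smul_of_cube hw hfw]; abel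
  refine le_antisymm (AddSubgroup.card_le_of_forall_smul_mem g fun v hv => ?_)
    (AddSubgroup.card_le_of_forall_smul_mem g fun v hv => ?_) <;>
  · rw [mem_unitsEqLocus] at hv ⊢
    simp only [inv_smul_of_cube hu hfu, hgw', hgu, hv, smul_sub, smul_neg]
    try abel

/-- A group with three commuting fixed-point-free automorphisms of order three that can be permuted
cyclically, and two of which can be inverted. -/
lemma exists_card_eq_pow_four {u₁ u₂ u₃ g f : (AddMonoid.End V)ˣ}
    (h₁ : u₁ ^ 3 = 1) (h₂ : u₂ ^ 3 = 1) (h₃ : u₃ ^ 3 = 1)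
    (f₁ : ∀ v : V, u₁ • v = v → v = 0) (f₂ : ∀ v : V, u₂ • v = v → v = 0)
    (f₃ : ∀ v : V, u₃ • v = v → v = 0)
    (h₁₂ : u₁ * u₂ = u₂ * u₁) (h₁₃ : u₁ * u₃ = u₃ * u₁) (h₂₃ : u₂ * u₃ = u₃ * u₂)
    (hg₁ : ∀ v : V, u₂ • g • v = g • u₁ • v) (hg₂ : ∀ v : V, u₃ • g • v = g • u₂ • v)
    (hg₃ : ∀ v : V, u₁ • g • v = g • u₃ • v)
    (hf₁ : ∀ v : V, u₁ • f • v = f • u₁ • v) (hf₂ : ∀ v : V, u₂⁻¹ • f • v = f • u₂ • v)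
    (hf₃ : ∀ v : V, u₃⁻¹ • f • v = f • u₃ • v) :
    ∃ W : AddSubgroup V, Nat.card W % 3 = 1 ∧ Nat.card V = Nat.card W ^ 4 := by
  have hf₂' : ∀ v : V, u₂ • f • v = -(f • v) - f • u₂ • v := fun v => by
    rw [← hf₂, inv_smul_of_cube h₂ f₂]; abel
  have hf₃' : ∀ v : V, u₃ • f • v = -(f • v) - f • u₃ • v := fun v => by
    rw [← hf₃, inv_smul_of_cube h₃ f₃]; abel
  have c₁₂ : ∀ v : V, u₁ • u₂ • v = u₂ • u₁ • v := fun v => by rw [← mul_smul, h₁₂, mul_smul]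
  have c₁₃ : ∀ v : V, u₁ • u₃ • v = u₃ • u₁ • v := fun v => by rw [← mul_smul, h₁₃, mul_smul]
  have c₂₃ : ∀ v : V, u₂ • u₃ • v = u₃ • u₂ • v := fun v => by rw [← mul_smul, h₂₃, mul_smul]
  have i₁ := inv_smul_of_cube h₁ f₁
  have hplus₁ : ∀ v ∈ unitsEqLocus u₁ u₂, u₁ • v ∈ unitsEqLocus u₁ u₂ := fun v hv => by
    rw [mem_unitsEqLocus] at *; rw [← c₁₂, hv]
  have hplus₃ : ∀ v ∈ unitsEqLocus u₁ u₂, u₃ • v ∈ unitsEqLocus u₁ u₂ := fun v hv => by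
    rw [mem_unitsEqLocus] at *; rw [c₂₃, c₁₃, hv]
  have hminus₁ : ∀ v ∈ unitsEqLocus u₁⁻¹ u₂, u₁ • v ∈ unitsEqLocus u₁⁻¹ u₂ := fun v hv => by
    rw [mem_unitsEqLocus] at *; rw [← c₁₂, hv, smul_inv_smul, inv_smul_smul]
  have hminus₃ : ∀ v ∈ unitsEqLocus u₁⁻¹ u₂, u₃ • v ∈ unitsEqLocus u₁⁻¹ u₂ := fun v hv => by
    rw [mem_unitsEqLocus, i₁] at *; rw [c₂₃, c₁₃, hv, smul_sub, smul_neg]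
  have e0 := card_eq_card_inf_mul_card_inf h₁ h₂ f₁ f₂ h₁₂ ⊤ (fun _ _ => trivial) (fun _ _ => trivial)
  rw [top_inf_eq, top_inf_eq, AddSubgroup.card_top] at e0
  have e1 := card_eq_card_inf_mul_card_inf h₁ h₃ f₁ f₃ h₁₃ _ hplus₁ hplus₃
  have e2 := card_eq_card_inf_mul_card_inf h₁ h₃ f₁ f₃ h₁₃ _ hminus₁ hminus₃
  have a1 : Nat.card (unitsEqLocus u₁ u₂ ⊓ unitsEqLocus u₁ u₃ : AddSubgroup V) ≤
      Nat.card (unitsEqLocus u₁⁻¹ u₂ ⊓ unitsEqLocus u₁⁻¹ u₃ : AddSubgroup V) := by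
    refine AddSubgroup.card_le_of_forall_smul_mem f fun v hv => ?_
    simp only [AddSubgroup.mem_inf, mem_unitsEqLocus] at hv ⊢
    obtain ⟨hv, hv'⟩ := hv
    constructor <;> simp only [i₁, hf₁, hf₂', hf₃', hv, hv']
  have a2 : Nat.card (unitsEqLocus u₁⁻¹ u₂ ⊓ unitsEqLocus u₁⁻¹ u₃ : AddSubgroup V) ≤
      Nat.card (unitsEqLocus u₁ u₂ ⊓ unitsEqLocus u₁ u₃ : AddSubgroup V) := by
    refine AddSubgroup.card_le_of_forall_smul_mem f fun v hv => ?_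
    simp only [AddSubgroup.mem_inf, mem_unitsEqLocus] at hv ⊢
    obtain ⟨hv, hv'⟩ := hv
    constructor <;>
    · simp only [i₁, hf₁, hf₂', hf₃', hv, hv', smul_sub, smul_neg]
      abel
  have a3 : Nat.card (unitsEqLocus u₁ u₂ ⊓ unitsEqLocus u₁⁻¹ u₃ : AddSubgroup V) ≤
      Nat.card (unitsEqLocus u₁⁻¹ u₂ ⊓ unitsEqLocus u₁⁻¹ u₃ : AddSubgroup V) := by
    refine AddSubgroup.card_le_of_forall_smul_mem g fun v hv => ?_
    simp only [AddSubgroup.mem_inf, mem_unitsEqLocus] at hv ⊢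
    obtain ⟨hv, hv'⟩ := hv
    constructor <;> simp only [i₁, hg₁, hg₂, hg₃, hv, hv', smul_sub, smul_neg] <;> abel
  have a4 : Nat.card (unitsEqLocus u₁⁻¹ u₂ ⊓ unitsEqLocus u₁⁻¹ u₃ : AddSubgroup V) ≤
      Nat.card (unitsEqLocus u₁⁻¹ u₂ ⊓ unitsEqLocus u₁ u₃ : AddSubgroup V) := by
    refine AddSubgroup.card_le_of_forall_smul_mem g fun v hv => ?_
    simp only [AddSubgroup.mem_inf, mem_unitsEqLocus] at hv ⊢
    obtain ⟨hv, hv'⟩ := hv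
    constructor <;> simp only [i₁, hg₁, hg₂, hg₃, hv, hv', smul_sub, smul_neg] <;> abel
  have a5 : Nat.card (unitsEqLocus u₁⁻¹ u₂ ⊓ unitsEqLocus u₁ u₃ : AddSubgroup V) ≤
      Nat.card (unitsEqLocus u₁ u₂ ⊓ unitsEqLocus u₁⁻¹ u₃ : AddSubgroup V) := by
    refine AddSubgroup.card_le_of_forall_smul_mem g fun v hv => ?_
    simp only [AddSubgroup.mem_inf, mem_unitsEqLocus] at hv ⊢
    obtain ⟨hv, hv'⟩ := hv
    constructor <;> simp only [i₁, hg₁, hg₂, hg₃, hv, hv', smul_sub, smul_neg]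
  refine ⟨unitsEqLocus u₁ u₂ ⊓ unitsEqLocus u₁ u₃, card_mod_three_eq_one h₁ f₁ _ ?_, ?_⟩
  · intro v hv
    obtain ⟨hv, hv'⟩ := AddSubgroup.mem_inf.1 hv
    refine AddSubgroup.mem_inf.2 ⟨hplus₁ v hv, ?_⟩
    rw [mem_unitsEqLocus] at *; rw [← c₁₃, hv']
  · have b1 := a1.antisymm a2
    have b2 := a3.antisymm (a4.trans a5)
    have b3 := (a5.trans a3).antisymm a4
    rw [e0, e1, e2, b2, b3, ← b1]
    ring

end FixedPointFree

namespace ThreeCycleRep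

variable {Y V : Type} [Fintype Y] [DecidableEq Y] [AddCommGroup V] [Finite V]
  {τ : Equiv.Perm Y → (AddMonoid.End V)ˣ}

lemma exists_smul_comm (h : ThreeCycleRep τ) {σ : Equiv.Perm Y} (hσ : σ ∈ alternatingGroup Y) :
    ∃ g : (AddMonoid.End V)ˣ, ∀ d : Equiv.Perm Y, d.IsThreeCycle →
      ∀ v : V, τ (σ * d * σ⁻¹) • g • v = g • τ d • v := by
  obtain ⟨g, -, hg⟩ := h.exists_lift hσ
  refine ⟨g, fun d hd v => ?_⟩
  rw [← hg d hd, mul_smul, mul_smul, inv_smul_smul]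

lemma tri_facts : (tri (0 : Fin 9) 1 2).IsThreeCycle ∧ (tri (3 : Fin 9) 4 5).IsThreeCycle ∧
    (tri (6 : Fin 9) 7 8).IsThreeCycle :=
  ⟨tri_isThreeCycle (by decide) (by decide) (by decide),
    tri_isThreeCycle (by decide) (by decide) (by decide),
    tri_isThreeCycle (by decide) (by decide) (by decide)⟩

lemma flip_conj {σ : Equiv.Perm (Fin 9)} (hσ : σ = Equiv.swap 4 5 * Equiv.swap 7 8) :
    σ ∈ alternatingGroup (Fin 9) ∧ σ * tri 0 1 2 * σ⁻¹ = tri 0 1 2 ∧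
      σ * tri 3 4 5 * σ⁻¹ = (tri 3 4 5)⁻¹ ∧ σ * tri 6 7 8 * σ⁻¹ = (tri 6 7 8)⁻¹ := by
  subst hσ
  refine ⟨?_, ?_, ?_, ?_⟩
  · rw [mem_alternatingGroup, map_mul, sign_swap (by decide), sign_swap (by decide)]; rfl
  all_goals decide

lemma rotate_conj {σ : Equiv.Perm (Fin 9)} (hσ : σ = tri 0 3 6 * tri 1 4 7 * tri 2 5 8) :
    σ ∈ alternatingGroup (Fin 9) ∧ σ * tri 0 1 2 * σ⁻¹ = tri 3 4 5 ∧
      σ * tri 3 4 5 * σ⁻¹ = tri 6 7 8 ∧ σ * tri 6 7 8 * σ⁻¹ = tri 0 1 2 := by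
  subst hσ
  refine ⟨?_, ?_, ?_, ?_⟩
  · exact mul_mem (mul_mem (tri_isThreeCycle (by decide) (by decide)
      (by decide)).mem_alternatingGroup (tri_isThreeCycle (by decide) (by decide)
      (by decide)).mem_alternatingGroup) (tri_isThreeCycle (by decide) (by decide)
      (by decide)).mem_alternatingGroup
  all_goals decide

lemma isThreeCycle_extendDomainHom {X : Type} [Fintype X] [DecidableEq X] {p : Y → Prop}
    [DecidablePred p] (f : X ≃ Subtype p) {c : Equiv.Perm X} (hc : c.IsThreeCycle) :
    (extendDomainHom f c).IsThreeCycle := by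
  rw [IsThreeCycle, extendDomainHom_apply, cycleType_extendDomain]; exact hc

lemma exists_card_eq_of_fin_nine {τ : Equiv.Perm (Fin 9) → (AddMonoid.End V)ˣ}
    (h : ThreeCycleRep τ) (hfree : ∀ d, d.IsThreeCycle → ∀ v : V, τ d • v = v → v = 0) :
    Nat.card V = Nat.card (unitsEqLocus (τ (tri 0 1 2)) (τ (tri 3 4 5))) ^ 2 ∧
    ∃ W : AddSubgroup V, Nat.card W % 3 = 1 ∧ Nat.card V = Nat.card W ^ 4 := by
  obtain ⟨t1, t2, t3⟩ := tri_facts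
  obtain ⟨hf, hf1, hf2, hf3⟩ := flip_conj rfl
  obtain ⟨hg, hg1, hg2, hg3⟩ := rotate_conj rfl
  obtain ⟨f, hf⟩ := h.exists_smul_comm hf
  obtain ⟨g, hg⟩ := h.exists_smul_comm hg
  have f1 := hf _ t1
  have f2 := hf _ t2
  have f3 := hf _ t3
  have g1 := hg _ t1
  have g2 := hg _ t2
  have g3 := hg _ t3
  rw [hf1] at f1
  rw [hf2, h.inv _ t2] at f2
  rw [hf3, h.inv _ t3] at f3
  rw [hg1] at g1
  rw [hg2] at g2
  rw [hg3] at g3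
  have h12 := h.commute_of_disjoint t1 t2 (by intro x; revert x; decide)
  have h13 := h.commute_of_disjoint t1 t3 (by intro x; revert x; decide)
  have h23 := h.commute_of_disjoint t2 t3 (by intro x; revert x; decide)
  refine ⟨?_, exists_card_eq_pow_four (h.cube _ t1) (h.cube _ t2) (h.cube _ t3) (hfree _ t1)
    (hfree _ t2) (hfree _ t3) h12 h13 h23 g1 g2 g3 f1 f2 f3⟩
  have e0 := card_eq_card_inf_mul_card_inf (h.cube _ t1) (h.cube _ t2) (hfree _ t1) (hfree _ t2)
    h12 ⊤ (fun _ _ => trivial) (fun _ _ => trivial)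
  rw [top_inf_eq, top_inf_eq, AddSubgroup.card_top, card_unitsEqLocus_inv f1 f2 (h.cube _ t1)
    (hfree _ t1) (h.cube _ t2) (hfree _ t2)] at e0
  rw [e0, pow_two]

/-- The bound when no three-cycle has a nonzero fixed point. -/
lemma le_card_of_free (h : ThreeCycleRep τ) (h9 : 9 ≤ Nat.card Y) (hn : ¬ IsTrivialRep τ)
    {r : ℕ} (hV : ∀ v : V, r • v = 0)
    (hfree : ∀ d, d.IsThreeCycle → ∀ v : V, τ d • v = v → v = 0)
    (ih : ∀ (X W : Type) [Fintype X] [DecidableEq X] [AddCommGroup W] [Finite W]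
      (τ' : Equiv.Perm X → (AddMonoid.End W)ˣ), 9 ≤ Nat.card X → Nat.card X < Nat.card Y →
      ThreeCycleRep τ' → ¬ IsTrivialRep τ' → (∀ w : W, r • w = 0) →
      2 ^ (Nat.card X - 2) ≤ Nat.card W) :
    2 ^ (Nat.card Y - 2) ≤ Nat.card V := by
  have hV1 : Nat.card V ≠ 1 := by
    intro h1
    have := (Nat.card_eq_one_iff_unique.1 h1).1
    exact hn fun c _ => AddMonoid.End.units_ext fun v => Subsingleton.elim _ _
  obtain ⟨e⟩ : Nonempty (Fin 9 ↪ Y) := by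
    rw [Function.Embedding.nonempty_iff_card_le, Fintype.card_fin, ← Nat.card_eq_fintype_card]
    exact h9
  classical
  obtain ⟨f, hf⟩ : ∃ f : Fin 9 ≃ Subtype (· ∈ Set.range e), ∀ x, (f x : Y) = e x :=
    ⟨Equiv.ofInjective e e.injective, fun x => rfl⟩
  have h3 := fun c => isThreeCycle_extendDomainHom (c := c) f
  obtain ⟨hsq, W, hW, hW4⟩ := (h.extendDomain f).exists_card_eq_of_fin_nine
    fun d hd => hfree _ (h3 d hd)
  by_cases h15 : 15 ≤ Nat.card Y
  · obtain ⟨t1, t2, -⟩ := tri_facts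
    set c₁ := extendDomainHom f (tri 0 1 2) with hc₁
    set c₂ := extendDomainHom f (tri 3 4 5) with hc₂
    have k1 := h3 _ t1
    have k2 := h3 _ t2
    let p : Y → Prop := fun y => c₁ y = y ∧ c₂ y = y
    let X := Subtype p
    have hX : Nat.card Y ≤ Nat.card X + 6 := by
      have h1 : Nat.card X = (c₁.support ∪ c₂.support)ᶜ.card := by
        rw [Nat.card_eq_fintype_card, Fintype.card_of_subtype]
        intro y
        simp
      have h2 := Finset.card_union_le c₁.support c₂.support
      rw [k1.card_support, k2.card_support] at h2
      rw [h1, Finset.card_compl, Nat.card_eq_fintype_card]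
      omega
    have hX' : Nat.card X < Nat.card Y := by
      rw [Nat.card_eq_fintype_card, Nat.card_eq_fintype_card]
      obtain ⟨y, hy⟩ := Finset.card_pos.1 (by rw [k1.card_support]; omega : 0 < c₁.support.card)
      exact Fintype.card_subtype_lt (x := y) fun hp => mem_support.1 hy hp.1
    have hdis : ∀ d : Equiv.Perm X, Disjoint c₁ (extendDomainHom (Equiv.refl X) d) ∧
        Disjoint c₂ (extendDomainHom (Equiv.refl X) d) := by
      intro d
      constructor <;> intro y <;> by_cases hy : p y
      · exact Or.inl hy.1
      · exact Or.inr (extendDomain_apply_not_subtype _ _ hy)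
      · exact Or.inl hy.2
      · exact Or.inr (extendDomain_apply_not_subtype _ _ hy)
    have h3X := fun c => isThreeCycle_extendDomainHom (c := c) (Equiv.refl X)
    obtain ⟨τ', h', hτ'⟩ := (h.extendDomain (Equiv.refl X)).exists_restrict
      (unitsEqLocus (τ c₁) (τ c₂)) (by
        intro d hd v hv
        rw [mem_unitsEqLocus] at *
        rw [← mul_smul, ← mul_smul, h.commute_of_disjoint k1 (h3X d hd) (hdis d).1,
          h.commute_of_disjoint k2 (h3X d hd) (hdis d).2, mul_smul, mul_smul, hv])
    have hle := ih X (unitsEqLocus (τ c₁) (τ c₂)) τ' (by omega) hX' h' (by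
      intro ht
      refine hV1 ?_
      have hbot : unitsEqLocus (τ c₁) (τ c₂) = ⊥ := by
        refine (AddSubgroup.eq_bot_iff_forall _).2 fun v hv => ?_
        obtain ⟨d, hd⟩ := exists_isThreeCycle (Y := X) (by omega)
        refine hfree _ (h3X d hd) v ?_
        have := hτ' d hd ⟨v, hv⟩
        rw [ht d hd, one_smul] at this
        exact this.symm
      rw [hsq, hbot, AddSubgroup.card_bot, one_pow]) fun w => Subtype.ext (hV w)
    calc 2 ^ (Nat.card Y - 2) ≤ 2 ^ ((Nat.card X - 2) * 2) :=
          Nat.pow_le_pow_right (by norm_num) (by omega)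
      _ = (2 ^ (Nat.card X - 2)) ^ 2 := pow_mul _ _ _
      _ ≤ _ := Nat.pow_le_pow_left hle 2
      _ = Nat.card V := hsq.symm
  · have hW1 : Nat.card W ≠ 1 := fun e => hV1 (by rw [hW4, e, one_pow])
    by_cases h11 : 11 ≤ Nat.card Y
    · have : Fact (Nat.Prime 11) := ⟨by norm_num⟩
      have n4 : Nat.card W ≠ 4 := fun e =>
        h.card_ne_of_forall (by omega) hn (p := 11) (r := 2) (m := 8) (by norm_num) h11
          Nat.prime_two (by decide) (by rw [hW4, e]; norm_num)
      have n7 : Nat.card W ≠ 7 := fun e =>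
        h.card_ne_of_forall (by omega) hn (p := 11) (r := 7) (m := 4) (by norm_num) h11
          (by norm_num) (by decide) (by rw [hW4, e])
      have h10 : 10 ≤ Nat.card W := by omega
      rw [hW4]
      calc 2 ^ (Nat.card Y - 2) ≤ 2 ^ 12 := Nat.pow_le_pow_right (by norm_num) (by omega)
        _ ≤ 10 ^ 4 := by norm_num
        _ ≤ _ := Nat.pow_le_pow_left h10 4
    · have h4 : 4 ≤ Nat.card W := by omega
      rw [hW4]
      calc 2 ^ (Nat.card Y - 2) ≤ 2 ^ 8 := Nat.pow_le_pow_right (by norm_num) (by omega)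
        _ = 4 ^ 4 := by norm_num
        _ ≤ _ := Nat.pow_le_pow_left h4 4

end ThreeCycleRep

namespace ThreeCycleRep

variable {Y V : Type} [Fintype Y] [DecidableEq Y] [AddCommGroup V] [Finite V]
  {τ : Equiv.Perm Y → (AddMonoid.End V)ˣ}

lemma exists_extendDomainHom_eq {c d : Equiv.Perm Y} (hd : d.IsThreeCycle) (hcd : Disjoint c d) :
    ∃ d' : Equiv.Perm {y // c y = y}, d'.IsThreeCycle ∧
      extendDomainHom (Equiv.refl {y // c y = y}) d' = d := by
  have hp : ∀ y, c (d y) = d y ↔ c y = y := by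
    intro y
    have := congrArg (· y) hcd.commute.eq
    simp only [mul_apply] at this
    rw [this, d.injective.eq_iff]
  have heq : extendDomainHom (Equiv.refl {y // c y = y}) (d.subtypePerm hp) = d := by
    rw [extendDomainHom_apply]
    ext y
    by_cases hy : c y = y
    · exact extendDomain_apply_subtype (p := fun y => c y = y) _ (Equiv.refl _) hy
    · exact (extendDomain_apply_not_subtype (p := fun y => c y = y) _ (Equiv.refl _) hy).trans
        ((hcd y).resolve_left hy).symm
  refine ⟨d.subtypePerm hp, ?_, heq⟩
  rw [IsThreeCycle, ← cycleType_extendDomain (Equiv.refl {y // c y = y}),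
    ← extendDomainHom_apply, heq]
  exact hd

/-- A lower bound on the size of a module for five or more points. -/
lemma le_card_of_five_points (h : ThreeCycleRep τ) (h5 : 5 ≤ Nat.card Y) (hn : ¬ IsTrivialRep τ)
    {r : ℕ} (hr : r.Prime) (hV : ∀ v : V, r • v = 0) :
    16 ≤ Nat.card V ∧ (r ≠ 2 → 25 ≤ Nat.card V) := by
  by_cases r2 : r = 2
  · subst r2
    exact ⟨h.le_card_of_two h5 hn hV, fun e => absurd rfl e⟩
  have h25 : 25 ≤ Nat.card V := by
    by_cases r3 : r = 3
    · subst r3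
      exact le_trans (by norm_num) (h.le_card_of_three h5 hn hV)
    have r5 : 5 ≤ r := by
      by_contra hlt
      have := hr.two_le
      interval_cases r <;> first | omega | (revert hr; decide)
    exact h.le_card_of_five_le h5 hn hr r5 hV
  exact ⟨by omega, fun _ => h25⟩

/-- A module on which the three-cycles of `k ≥ 9` points act nontrivially has at least `2 ^ (k - 2)`
elements. -/
theorem two_pow_le_card {r : ℕ} (hr : r.Prime) (n : ℕ) : ∀ (Y V : Type) [Fintype Y]
    [DecidableEq Y] [AddCommGroup V] [Finite V] (τ : Equiv.Perm Y → (AddMonoid.End V)ˣ),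
    Nat.card Y = n → 9 ≤ Nat.card Y → ThreeCycleRep τ → ¬ IsTrivialRep τ → (∀ v : V, r • v = 0) →
    2 ^ (Nat.card Y - 2) ≤ Nat.card V := by
  induction n using Nat.strong_induction_on with
  | _ n ih =>
  intro Y V₀ _ _ _ _ τ₀ hYn h9 h₀ hn₀ hV₀
  obtain ⟨V, _, _, τ, hle, h, hn, hV, hfix⟩ :=
    exists_fixed_eq_bot (by omega) r (Nat.card V₀) V₀ τ₀ le_rfl h₀ hn₀ hV₀
  refine le_trans ?_ hle
  obtain ⟨c, hc⟩ := exists_isThreeCycle (Y := Y) (by omega)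
  let X := {y // c y = y}
  have hX : Nat.card X + 3 = Nat.card Y := by
    have h1 : Nat.card X = c.supportᶜ.card := by
      rw [Nat.card_eq_fintype_card, Fintype.card_of_subtype]
      intro y
      simp
    rw [h1, Finset.card_compl, Nat.card_eq_fintype_card, hc.card_support]
    rw [Nat.card_eq_fintype_card] at h9
    omega
  have hdis : ∀ d : Equiv.Perm X, Disjoint c (extendDomainHom (Equiv.refl X) d) := by
    intro d y
    by_cases hy : c y = y
    · exact Or.inl hy
    · exact Or.inr (extendDomain_apply_not_subtype _ _ hy)
  have h3X := fun c => isThreeCycle_extendDomainHom (c := c) (Equiv.refl X)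
  have hcomm : ∀ d : Equiv.Perm X, d.IsThreeCycle → ∀ v : V,
      τ c • τ (extendDomainHom (Equiv.refl X) d) • v =
        τ (extendDomainHom (Equiv.refl X) d) • τ c • v := fun d hd v => by
    rw [← mul_smul, h.commute_of_disjoint hc (h3X d hd) (hdis d), mul_smul]
  obtain ⟨τB, hB, hτB⟩ := (h.extendDomain (Equiv.refl X)).exists_restrict
    (unitsDelta (τ c)).range (by
      rintro d hd _ ⟨v, rfl⟩
      refine ⟨τ (extendDomainHom (Equiv.refl X) d) • v, ?_⟩
      rw [unitsDelta_apply, unitsDelta_apply, hcomm d hd, smul_sub])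
  obtain ⟨τC, hC, hτC⟩ := (h.extendDomain (Equiv.refl X)).exists_restrict
    (unitsDelta (τ c)).ker (by
      intro d hd v hv
      rw [mem_ker_unitsDelta] at *
      rw [hcomm d hd, hv])
  by_cases tB : IsTrivialRep τB
  · refine h.le_card_of_trivial_range h9 hn hr hV hfix hc fun d hd hcd w hw => ?_
    obtain ⟨d', hd', rfl⟩ := exists_extendDomainHom_eq hd hcd
    have := hτB d' hd' ⟨w, hw⟩
    rw [tB d' hd', one_smul] at this
    exact this.symm
  by_cases tC : IsTrivialRep τC
  · refine h.le_card_of_free h9 hn hV (h.eq_zero_of_trivial_ker (by omega) hfix hc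
      fun d hd hcd v hv => ?_) fun X W _ _ _ _ τ' h1 h2 => ih _ (hYn ▸ h2) X W τ' rfl h1
    obtain ⟨d', hd', rfl⟩ := exists_extendDomainHom_eq hd hcd
    have := hτC d' hd' ⟨v, mem_ker_unitsDelta.2 hv⟩
    rw [tC d' hd', one_smul] at this
    exact this.symm
  have hcard := (unitsDelta (τ c)).card_ker_mul_card_range
  have hVB : ∀ v : (unitsDelta (τ c)).range, r • v = 0 := fun v => Subtype.ext (hV v)
  have hVC : ∀ v : (unitsDelta (τ c)).ker, r • v = 0 := fun v => Subtype.ext (hV v)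
  by_cases h12 : 12 ≤ Nat.card Y
  · have b1 := ih _ (by omega) X _ τB rfl (by omega) hB tB hVB
    have b2 := ih _ (by omega) X _ τC rfl (by omega) hC tC hVC
    calc 2 ^ (Nat.card Y - 2) ≤ 2 ^ ((Nat.card X - 2) + (Nat.card X - 2)) :=
          Nat.pow_le_pow_right (by norm_num) (by omega)
      _ = 2 ^ (Nat.card X - 2) * 2 ^ (Nat.card X - 2) := pow_add _ _ _
      _ ≤ _ := Nat.mul_le_mul b2 b1
      _ = _ := hcard
  have b1 := hB.le_card_of_five_points (by omega) tB hr hVB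
  have b2 := hC.le_card_of_five_points (by omega) tC hr hVC
  by_cases r2 : r = 2
  · subst r2
    have h256 : 256 ≤ Nat.card V := hcard ▸ Nat.mul_le_mul b2.1 b1.1
    by_cases h11 : 11 ≤ Nat.card Y
    · have : Fact (Nat.Prime 11) := ⟨by norm_num⟩
      have h8 : Nat.card V ≠ 2 ^ 8 :=
        h.card_ne_of_forall (by omega) hn (p := 11) (by norm_num) h11 Nat.prime_two (by decide)
      obtain ⟨m, hm⟩ := AddCommGroup.exists_card_eq_pow Nat.prime_two hV
      rw [hm] at h256 h8 ⊢
      have : 8 ≤ m := (Nat.pow_le_pow_iff_right (a := 2) (by norm_num)).1 h256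
      have : m ≠ 8 := fun e => h8 (by rw [e])
      exact Nat.pow_le_pow_right (by norm_num) (by omega)
    · exact le_trans (Nat.pow_le_pow_right (by norm_num) (by omega : Nat.card Y - 2 ≤ 8)) h256
  · calc 2 ^ (Nat.card Y - 2) ≤ 2 ^ 9 := Nat.pow_le_pow_right (by norm_num) (by omega)
      _ ≤ 25 * 25 := by norm_num
      _ ≤ _ := Nat.mul_le_mul (b2.2 r2) (b1.2 r2)
      _ = _ := hcard

end ThreeCycleRep

/-- A minimal action of a group with the alternating group of `k ≥ 9` points as its image is on a
group of at least `2 ^ (k - 2)` elements. -/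
theorem IsMinAction.two_pow_le_card {Y H V : Type} [Fintype Y] [DecidableEq Y] [Group H] [Finite H]
    [AddCommGroup V] [Finite V] [DistribMulAction H V] {π : H →* alternatingGroup Y}
    (h : IsMinAction π V) (h9 : 9 ≤ Nat.card Y) : 2 ^ (Nat.card Y - 2) ≤ Nat.card V := by
  have : Group.IsPerfect (alternatingGroup Y) :=
    CentralLift.isPerfect_alternatingGroup (by omega)
  have : IsSimpleGroup (alternatingGroup Y) :=
    alternatingGroup.isSimpleGroup (by omega)
  have : Nontrivial Y := (Finite.one_lt_card_iff_nontrivial).1 (by omega)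
  have hcard : 65536 < Nat.card (alternatingGroup Y) := by
    have h1 : 2 * Nat.card (alternatingGroup Y) = (Nat.card Y).factorial := by
      rw [two_mul_nat_card_alternatingGroup, Nat.card_perm]
    have h2 := Nat.factorial_le h9
    have h3 : Nat.factorial 9 = 362880 := by decide
    omega
  obtain ⟨t, ht⟩ := CentralLift.exists_threeCycle_lift h.surj (h.ker_le_center hcard) (by omega)
  obtain ⟨r, hr, hrV⟩ := h.exponent
  let a : H →* (AddMonoid.End V)ˣ :=
    (DistribMulAction.toAddMonoidEnd H V).toHomUnits
  have ha : ∀ (g : H) (v : V), a g • v = g • v := fun g v => rfl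
  refine ThreeCycleRep.two_pow_le_card hr _ Y V (fun c => a (t c)) rfl h9
    ⟨fun c hc => ?_, fun c hc => ?_, fun c d hc hd => ?_⟩ (fun htr => ?_) hrV
  · rw [← map_pow, (ht c hc).2.1, map_one]
  · rw [← map_inv, (ht c hc).2.2.1]
  · rw [← map_inv, ← map_mul, ← map_mul, (ht d hd).2.2.2, (ht c hc).1]
  · obtain ⟨c, hc⟩ := ThreeCycleRep.exists_isThreeCycle (Y := Y) (by omega)
    have h1 : t c = 1 := h.faithful _ fun v => by rw [← ha, show a (t c) = 1 from htr c hc, one_smul]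
    have h2 := (ht c hc).1
    rw [h1, map_one] at h2
    have h3 := hc.orderOf
    rw [← h2] at h3
    simp at h3

/-- A group with few points all of whose stabilizers map onto the alternating group. -/
theorem isFull_ker_toPermHom {Y : Type} [Fintype Y] [DecidableEq Y] (h9 : 9 ≤ Nat.card Y) (n : ℕ)
    (hn : n < 2 ^ (Nat.card Y - 2)) (m : ℕ) : ∀ (G X : Type) [Group G] [Finite G] [Finite X]
    [MulAction G X] (φ : G →* alternatingGroup Y), Nat.card X = n → Nat.card G = m →
    Function.Surjective φ → (∀ x : X, IsFull φ (MulAction.stabilizer G x)) →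
    IsFull φ (MulAction.toPermHom G X).ker := by
  induction n using Nat.strong_induction_on generalizing m with
  | _ n ihn =>
  induction m using Nat.strong_induction_on with
  | _ m ihm =>
  intro G X _ _ _ _ φ hX hG hφ hst
  by_contra hnot
  have hmin : MinCx X φ := ⟨hφ, hst, hnot, fun G' _ _ X' _ _ φ' hφ' hlt hst' => by
    rw [hX, hG] at hlt
    rcases hlt with hlt | ⟨hle, hlt⟩
    · exact ihn _ hlt (hlt.trans hn) _ G' X' φ' rfl rfl hφ' hst'
    · rcases hle.lt_or_eq with hl | he
      · exact ihn _ hl (hl.trans hn) _ G' X' φ' rfl rfl hφ' hst'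
      · exact ihm _ hlt G' X' φ' he rfl hφ' hst'⟩
  have : Group.IsPerfect (alternatingGroup Y) :=
    CentralLift.isPerfect_alternatingGroup (by omega)
  have : IsSimpleGroup (alternatingGroup Y) :=
    alternatingGroup.isSimpleGroup (by omega)
  have : Nontrivial Y := (Finite.one_lt_card_iff_nontrivial).1 (by omega)
  have hcard : Nat.card X < Nat.card (alternatingGroup Y) := by
    have h1 : 2 * Nat.card (alternatingGroup Y) = (Nat.card Y).factorial := by
      rw [two_mul_nat_card_alternatingGroup, Nat.card_perm]
    have h2 : 2 ^ (Nat.card Y - 1) ≤ (Nat.card Y).factorial := by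
      have := Nat.factorial_mul_pow_le_factorial (m := 1) (n := Nat.card Y - 1)
      rwa [Nat.factorial_one, one_mul, Nat.add_sub_cancel' (by omega)] at this
    have h3 : 2 ^ (Nat.card Y - 1) = 2 * 2 ^ (Nat.card Y - 2) := by
      rw [← pow_succ']; congr 1; omega
    omega
  obtain ⟨H, _, _, V, _, _, _, π, hπ, hV⟩ := hmin.exists_isMinAction (hmin.hasAffine hcard)
  have := hπ.two_pow_le_card h9
  omega

/-- The pointwise stabilizer of the unaffected points is mapped onto a group containing `A_k`. -/
theorem IsGiantRep.le_map_pointwiseStabilizer {Ω : Type} [Finite Ω] {Γ : Subgroup (Equiv.Perm Ω)}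
    {k : ℕ} {φ : ↥Γ →* Equiv.Perm (Fin k)} (hφ : IsGiantRep Γ φ) (h9 : 9 ≤ k)
    (hΩ : Nat.card Ω < 2 ^ (k - 2)) :
    alternatingGroup (Fin k) ≤
      (PointwiseStabilizer Γ {α : Ω | ¬ AffectedBy Γ φ α}).map φ := by
  let D : Set Ω := {α | ¬ AffectedBy Γ φ α}
  let G := (alternatingGroup (Fin k)).comap φ
  let ψ : G →* alternatingGroup (Fin k) := φ.subgroupComap (alternatingGroup (Fin k))
  have hD : ∀ (g : Γ) (α : Ω), α ∈ D → g • α ∈ D := by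
    intro g α hα
    change ¬ ¬ _ at hα
    change ¬ ¬ _
    rw [not_not] at *
    intro s hs
    obtain ⟨x, hx, hxs⟩ := hα (Subgroup.Normal.conj_mem inferInstance s hs (φ g)⁻¹)
    refine ⟨g * x * g⁻¹, MulAction.conj_mem_stabilizer g hx, ?_⟩
    rw [map_mul, map_mul, map_inv, hxs]
    group
  let A : SubMulAction G Ω := { carrier := D, smul_mem' := fun g α hα => hD g α hα }
  have hst : ∀ x : A, IsFull ψ (MulAction.stabilizer G x) := by
    rintro ⟨α, hα⟩ ⟨s, hs⟩
    obtain ⟨x, hx, hxs⟩ := not_not.1 hα hs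
    exact ⟨⟨x, show φ x ∈ _ from hxs ▸ hs⟩, Subtype.ext hx, Subtype.ext hxs⟩
  have hsurj : Function.Surjective ψ := by
    rintro ⟨s, hs⟩
    obtain ⟨x, hxs⟩ := hφ hs
    exact ⟨⟨x, show φ x ∈ _ from hxs ▸ hs⟩, Subtype.ext hxs⟩
  have hA : Nat.card A < 2 ^ (Nat.card (Fin k) - 2) := by
    rw [Nat.card_fin]
    exact (Nat.card_le_card_of_injective _ Subtype.val_injective).trans_lt hΩ
  have key := isFull_ker_toPermHom (by rwa [Nat.card_fin]) _ hA _ G A ψ rfl rfl hsurj hst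
  intro s hs
  obtain ⟨x, hx, hxs⟩ := key ⟨s, hs⟩
  refine ⟨x, ?_, congrArg Subtype.val hxs⟩
  simp only [PointwiseStabilizer, SetLike.mem_coe, Subgroup.mem_iInf]
  intro α hα
  exact congrArg Subtype.val (congrArg (fun e : Equiv.Perm A => e ⟨α, hα⟩) (MonoidHom.mem_ker.1 hx))

end

/-- **Unaffected Stabilizers Theorem, Babai.**
If `φ : Γ → S_k` is a giant representation with `k > max {8, 2 + log₂ n}` where `n = |Ω|`,
and `D ⊆ Ω` is the set of points not affected by `φ`, then the image under `φ` of the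
pointwise stabilizer of `D` still contains `A_k`; in particular `D ≠ Ω`, i.e., at least one
point is affected by `φ`. -/
theorem unaffected_stabilizers (Ω : Type) [Fintype Ω]
    (Γ : Subgroup (Equiv.Perm Ω)) (k : ℕ)
    (φ : ↥Γ →* Equiv.Perm (Fin k)) (hgiant : IsGiantRep Γ φ)
    (hk : (k : ℝ) > max 8 (2 + Real.logb 2 (Fintype.card Ω))) :
    alternatingGroup (Fin k) ≤
        (PointwiseStabilizer Γ {α : Ω | ¬ AffectedBy Γ φ α}).map φ ∧
      {α : Ω | ¬ AffectedBy Γ φ α} ≠ Set.univ := by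
  obtain ⟨hk8, hklog⟩ := max_lt_iff.1 hk
  have h9 : 9 ≤ k := by exact_mod_cast hk8
  have hΩ : Nat.card Ω < 2 ^ (k - 2) := by
    rw [Nat.card_eq_fintype_card]
    rcases Nat.eq_zero_or_pos (Fintype.card Ω) with h0 | hpos
    · rw [h0]; positivity
    have h1 : Real.logb 2 (Fintype.card Ω) < (k - 2 : ℕ) := by
      rw [Nat.cast_sub (by omega)]
      push_cast
      linarith
    rw [Real.logb_lt_iff_lt_rpow (by norm_num) (by exact_mod_cast hpos), Real.rpow_natCast] at h1
    exact_mod_cast h1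
  have hmain := hgiant.le_map_pointwiseStabilizer h9 hΩ
  refine ⟨hmain, fun huniv => ?_⟩
  have hbot : PointwiseStabilizer Γ Set.univ = ⊥ := by
    refine (Subgroup.eq_bot_iff_forall _).2 fun g hg => Subtype.ext (Equiv.ext fun α => ?_)
    simp only [PointwiseStabilizer, Subgroup.mem_iInf] at hg
    exact hg α trivial
  rw [huniv, hbot, Subgroup.map_bot, le_bot_iff] at hmain
  obtain ⟨c, hc⟩ := ThreeCycleRep.exists_isThreeCycle (Y := Fin k) (by rw [Nat.card_fin]; omega)
  have h1 : c = 1 := (Subgroup.mem_bot).1 (hmain ▸ hc.mem_alternatingGroup)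
  have h3 := hc.orderOf
  rw [h1] at h3
  simp at h3
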